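/- For every integer n ≥ 3, the generalized 3-connectivity of the bubble-sort star graph satisfies κ₃(BS_n) = 2n − 4. -/

import Mathlib

/-- There exist `r` internally disjoint trees connecting `S` in `G`: `r` pairwise
edge-disjoint trees `T₁, …, T_r` of `G`, each containing `S`, with
`V(T_a) ∩ V(T_b) = S` for all `a ≠ b`. -/
def ConnectsSet {V : Type*} (G : SimpleGraph V) (S : Set V) (r : ℕ) : Prop :=
  ∃ T : Fin r → G.Subgraph,
    (∀ a, (T a).coe.IsTree) ∧
    (∀ a, S ⊆ (T a).verts) ∧
    (∀ a b, a ≠ b → (T a).verts ∩ (T b).verts = S) ∧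
    (∀ a b, a ≠ b → Disjoint (T a).edgeSet (T b).edgeSet)

/-- `κ_G(S)`: the maximum number of internally disjoint trees connecting `S` in `G`. -/
noncomputable def treeConn {V : Type*} (G : SimpleGraph V) (S : Set V) : ℕ :=
  sSup {r | ConnectsSet G S r}

/-- The generalized 3-connectivity `κ₃(G) = min {κ_G(S) : S ⊆ V(G), |S| = 3}`. -/
noncomputable def kappa3 {V : Type*} (G : SimpleGraph V) : ℕ :=
  sInf {k | ∃ S : Set V, S.ncard = 3 ∧ treeConn G S = k}

/-- The Cayley graph of a group with connection set `S`: `x` is adjacent to `x·s` for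
`s ∈ S` (symmetrized, loops removed). -/
def cayleyGraph {G : Type*} [Group G] (S : Set G) : SimpleGraph G :=
  SimpleGraph.fromRel (fun x y => ∃ s ∈ S, y = x * s)

/-- The bubble-sort star graph `BS_n`: the Cayley graph of `Sym(n)` (permutations of the
`n` positions `0, …, n-1`, written as words) with connection set
`{(1 i) : 2 ≤ i ≤ n} ∪ {(i, i+1) : 2 ≤ i ≤ n-1}` (in 1-based notation). -/
def bubbleSortStar (n : ℕ) (hn : 3 ≤ n) : SimpleGraph (Equiv.Perm (Fin n)) :=
  cayleyGraph ({σ | ∃ i : Fin n, 1 ≤ (i : ℕ) ∧ σ = Equiv.swap ⟨0, by omega⟩ i} ∪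
    {σ | ∃ j : ℕ, ∃ h : j + 1 < n, 1 ≤ j ∧ σ = Equiv.swap ⟨j, by omega⟩ ⟨j + 1, h⟩})

open Finset

section Joined

variable {V : Type*} {G H : SimpleGraph V} {Z W : Set V} {a b c : V}

/-- `a` and `b` are the ends of a walk of `G` all of whose edges lie inside `Z`. -/
def JoinedWithin (G : SimpleGraph V) (Z : Set V) : V → V → Prop :=
  Relation.ReflTransGen fun u v => G.Adj u v ∧ u ∈ Z ∧ v ∈ Z

/-- `Z` induces a preconnected subgraph of `G`. -/
def ConnectedOn (G : SimpleGraph V) (Z : Set V) : Prop :=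
  ∀ a ∈ Z, ∀ b ∈ Z, JoinedWithin G Z a b

namespace JoinedWithin

theorem refl (a : V) : JoinedWithin G Z a a := Relation.ReflTransGen.refl

theorem trans (h : JoinedWithin G Z a b) (h' : JoinedWithin G Z b c) : JoinedWithin G Z a c :=
  Relation.ReflTransGen.trans h h'

theorem single (h : G.Adj a b) (ha : a ∈ Z) (hb : b ∈ Z) : JoinedWithin G Z a b :=
  Relation.ReflTransGen.single ⟨h, ha, hb⟩

theorem symm (h : JoinedWithin G Z a b) : JoinedWithin G Z b a := by
  induction h with
  | refl => exact refl _
  | tail _ h ih => exact (single h.1.symm h.2.2 h.2.1).trans ih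

theorem mono (h : JoinedWithin G Z a b) (hG : G ≤ H) (hZ : Z ⊆ W) : JoinedWithin H W a b := by
  induction h with
  | refl => exact refl _
  | tail _ h ih => exact ih.trans (single (hG h.1) (hZ h.2.1) (hZ h.2.2))

theorem map {V' : Type*} {G' : SimpleGraph V'} {Z' : Set V'} (f : V → V')
    (hf : ∀ u ∈ Z, ∀ v ∈ Z, G.Adj u v → JoinedWithin G' Z' (f u) (f v))
    (h : JoinedWithin G Z a b) : JoinedWithin G' Z' (f a) (f b) := by
  induction h with
  | refl => exact refl _
  | tail _ h ih => exact ih.trans (hf _ h.2.1 _ h.2.2 h.1)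

theorem of_forall_adj (hf : ∀ u ∈ Z, ∀ v ∈ Z, G.Adj u v → JoinedWithin H W u v)
    (h : JoinedWithin G Z a b) : JoinedWithin H W a b :=
  h.map id hf

/-- A walk either avoids `D` or has an initial part reaching `D`. -/
theorem avoid_or_hit (D : Set V) (ha : a ∈ Z) (h : JoinedWithin G Z a b) :
    (b ∉ D ∧ JoinedWithin G (Z \ D) a b) ∨ ∃ d ∈ D, d ∈ Z ∧ JoinedWithin G Z a d := by
  induction h with
  | refl =>
    by_cases hD : a ∈ D
    · exact Or.inr ⟨a, hD, ha, refl _⟩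
    · exact Or.inl ⟨hD, refl _⟩
  | @tail u v _ h ih =>
    obtain ⟨hu, ih⟩ | ih := ih
    · by_cases hD : v ∈ D
      · exact Or.inr ⟨v, hD, h.2.2, (ih.mono le_rfl Set.sdiff_subset).trans
          (single h.1 h.2.1 h.2.2)⟩
      · exact Or.inl ⟨hD, ih.trans (single h.1 ⟨h.2.1, hu⟩ ⟨h.2.2, hD⟩)⟩
    · exact Or.inr ih

/-- The last departure from the starting point of a walk. -/
theorem exists_adj_start (h : JoinedWithin G Z a b) (hab : a ≠ b) :
    ∃ c, G.Adj a c ∧ c ∈ Z ∧ c ≠ a ∧ JoinedWithin G (Z \ {a}) c b := by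
  induction h with
  | refl => exact absurd rfl hab
  | @tail u v _ h ih =>
    by_cases hu : a = u
    · subst hu
      exact ⟨v, h.1, h.2.2, hab.symm, refl _⟩
    · obtain ⟨c, h1, h2, h3, h4⟩ := ih hu
      exact ⟨c, h1, h2, h3, h4.trans (single h.1 ⟨h.2.1, Ne.symm hu⟩ ⟨h.2.2, hab.symm⟩)⟩

/-- A walk survives the deletion of an edge `xy`, or it uses `xy`. -/
theorem deleteEdges_or (x y : V) (h : JoinedWithin G Z a b) :
    JoinedWithin (G.deleteEdges {s(x, y)}) Z a b ∨ (x ∈ Z ∧ y ∈ Z ∧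
      ((JoinedWithin (G.deleteEdges {s(x, y)}) Z a x ∧
          JoinedWithin (G.deleteEdges {s(x, y)}) Z y b) ∨
        (JoinedWithin (G.deleteEdges {s(x, y)}) Z a y ∧
          JoinedWithin (G.deleteEdges {s(x, y)}) Z x b))) := by
  induction h with
  | refl => exact Or.inl (refl _)
  | @tail u v _ h ih =>
    by_cases he : s(u, v) = s(x, y)
    · rw [Sym2.eq_iff] at he
      obtain ⟨rfl, rfl⟩ | ⟨rfl, rfl⟩ := he
      · obtain ih | ⟨hu, hv, ⟨h1, h2⟩ | ⟨h1, h2⟩⟩ := ih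
        · exact Or.inr ⟨h.2.1, h.2.2, Or.inl ⟨ih, refl _⟩⟩
        · exact Or.inr ⟨h.2.1, h.2.2, Or.inl ⟨h1, refl _⟩⟩
        · exact Or.inl h1
      · obtain ih | ⟨hu, hv, ⟨h1, h2⟩ | ⟨h1, h2⟩⟩ := ih
        · exact Or.inr ⟨h.2.2, h.2.1, Or.inr ⟨ih, refl _⟩⟩
        · exact Or.inl h1
        · exact Or.inr ⟨h.2.2, h.2.1, Or.inr ⟨h1, refl _⟩⟩
    · have hs : JoinedWithin (G.deleteEdges {s(x, y)}) Z u v :=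
        single (SimpleGraph.deleteEdges_adj.2 ⟨h.1, by simpa using he⟩) h.2.1 h.2.2
      obtain ih | ⟨hu, hv, ⟨h1, h2⟩ | ⟨h1, h2⟩⟩ := ih
      · exact Or.inl (ih.trans hs)
      · exact Or.inr ⟨hu, hv, Or.inl ⟨h1, h2.trans hs⟩⟩
      · exact Or.inr ⟨hu, hv, Or.inr ⟨h1, h2.trans hs⟩⟩

end JoinedWithin

namespace ConnectedOn

theorem of_center (c : V) (h : ∀ a ∈ Z, JoinedWithin G Z c a) : ConnectedOn G Z :=
  fun a ha b hb => (h a ha).symm.trans (h b hb)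

theorem singleton (a : V) : ConnectedOn G {a} := by
  rintro _ rfl _ rfl
  exact JoinedWithin.refl _

theorem mono (h : ConnectedOn G Z) (hG : G ≤ H) : ConnectedOn H Z :=
  fun a ha b hb => (h a ha b hb).mono hG le_rfl

theorem union_of_adj (hZ : ConnectedOn G Z) (hW : ConnectedOn G W) (ha : a ∈ Z) (hb : b ∈ W)
    (hab : G.Adj a b) : ConnectedOn G (Z ∪ W) := by
  refine of_center a ?_
  rintro x (hx | hx)
  · exact (hZ a ha x hx).mono le_rfl Set.subset_union_left
  · exact (JoinedWithin.single hab (Or.inl ha) (Or.inr hb)).trans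
      ((hW b hb x hx).mono le_rfl Set.subset_union_right)

theorem union_of_mem (hZ : ConnectedOn G Z) (hW : ConnectedOn G W) (ha : a ∈ Z) (hb : a ∈ W) :
    ConnectedOn G (Z ∪ W) := by
  refine of_center a ?_
  rintro x (hx | hx)
  · exact (hZ a ha x hx).mono le_rfl Set.subset_union_left
  · exact (hW a hb x hx).mono le_rfl Set.subset_union_right

theorem insert_of_adj (hZ : ConnectedOn G Z) (ha : a ∈ Z) (hab : G.Adj b a) :
    ConnectedOn G (insert b Z) := by
  rw [Set.insert_eq]
  exact (singleton b).union_of_adj hZ rfl ha hab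

theorem pair (hab : G.Adj a b) : ConnectedOn G {a, b} :=
  (singleton b).insert_of_adj rfl hab

/-- Adding vertices each of which has a neighbour in `Z`. -/
theorem union_of_forall_adj (hZ : ConnectedOn G Z) (h : ∀ w ∈ W, w ∈ Z ∨ ∃ z ∈ Z, G.Adj w z) :
    ConnectedOn G (Z ∪ W) := by
  have key : ∀ x ∈ Z ∪ W, ∃ z ∈ Z, JoinedWithin G (Z ∪ W) z x := by
    rintro x (hx | hx)
    · exact ⟨x, hx, JoinedWithin.refl _⟩
    · obtain h | ⟨z, hz, h⟩ := h x hx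
      · exact ⟨x, h, JoinedWithin.refl _⟩
      · exact ⟨z, hz, JoinedWithin.single h.symm (Or.inl hz) (Or.inr hx)⟩
  intro x hx y hy
  obtain ⟨u, hu, hux⟩ := key x hx
  obtain ⟨v, hv, hvy⟩ := key y hy
  exact hux.symm.trans (((hZ u hu v hv).mono le_rfl Set.subset_union_left).trans hvy)

/-- A union of connected pieces indexed by a connected family. -/
theorem biUnion_of_links {ι : Type*} {I : Set ι} {P : ι → Set V}
    (hP : ∀ i ∈ I, ConnectedOn G (P i))
    (hlink : ∀ i ∈ I, ∀ j ∈ I, Relation.ReflTransGen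
      (fun i j => i ∈ I ∧ j ∈ I ∧ ∃ u ∈ P i, ∃ v ∈ P j, G.Adj u v ∨ u = v) i j) :
    ConnectedOn G (⋃ i ∈ I, P i) := by
  intro a ha b hb
  simp only [Set.mem_iUnion] at ha hb
  obtain ⟨i, hi, ha⟩ := ha
  obtain ⟨j, hj, hb⟩ := hb
  have hsub : ∀ i ∈ I, P i ⊆ ⋃ i ∈ I, P i := fun i hi => Set.subset_biUnion_of_mem hi
  have key : ∀ b ∈ P j, JoinedWithin G (⋃ i ∈ I, P i) a b := by
    have h := hlink i hi j hj
    clear hb hj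
    induction h with
    | refl => exact fun b hb => (hP i hi a ha b hb).mono le_rfl (hsub i hi)
    | tail _ h ih =>
      obtain ⟨h1, h2, u, hu, v, hv, huv⟩ := h
      intro b hb
      refine (ih u hu).trans (JoinedWithin.trans ?_ ((hP _ h2 v hv b hb).mono le_rfl (hsub _ h2)))
      obtain huv | rfl := huv
      · exact JoinedWithin.single huv (hsub _ h1 hu) (hsub _ h2 hv)
      · exact JoinedWithin.refl _
  exact key b hb

end ConnectedOn

namespace JoinedWithin

theorem exists_connectedOn_of_ne (ha : a ∈ Z) (w : V) (h : JoinedWithin G Z a b) :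
    (∃ P ⊆ Z, ConnectedOn G P ∧ a ∈ P ∧ w ∈ P ∧
      ∀ u ∈ P, u ≠ w → a ≠ w ∧ JoinedWithin G (Z \ {w}) a u) ∨
    (b ≠ w ∧ ∃ P ⊆ Z, ConnectedOn G P ∧ a ∈ P ∧ b ∈ P ∧
      ∀ u ∈ P, u ≠ w ∧ a ≠ w ∧ JoinedWithin G (Z \ {w}) a u) := by
  induction h with
  | refl =>
    by_cases haw : a = w
    · subst haw
      exact Or.inl ⟨{a}, by simpa using ha, ConnectedOn.singleton a, rfl, rfl,
        fun u hu hne => absurd hu hne⟩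
    · refine Or.inr ⟨haw, {a}, by simpa using ha, ConnectedOn.singleton a, rfl, rfl, ?_⟩
      rintro u rfl
      exact ⟨haw, haw, refl _⟩
  | @tail u v _ h ih =>
    obtain ih | ⟨hu, P, hPZ, hP, haP, huP, hPw⟩ := ih
    · exact Or.inl ih
    · by_cases hv : v = w
      · subst hv
        refine Or.inl ⟨insert v P, Set.insert_subset h.2.2 hPZ, hP.insert_of_adj huP h.1.symm,
          Or.inr haP, Or.inl rfl, ?_⟩
        rintro x (rfl | hx) hne
        · exact absurd rfl hne
        · exact (hPw x hx).2
      · refine Or.inr ⟨hv, insert v P, Set.insert_subset h.2.2 hPZ, hP.insert_of_adj huP h.1.symm,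
          Or.inr haP, Or.inl rfl, ?_⟩
        rintro x (rfl | hx)
        · exact ⟨hv, (hPw u huP).2.1,
            (hPw u huP).2.2.trans (single h.1 ⟨h.2.1, hu⟩ ⟨h.2.2, hv⟩)⟩
        · exact hPw x hx

/-- Trimming a connection from `a` to `w` at its first visit of `w`. -/
theorem exists_trim (ha : a ∈ Z) (h : JoinedWithin G Z a b) :
    ∃ P ⊆ Z, ConnectedOn G P ∧ a ∈ P ∧ b ∈ P ∧
      ∀ u ∈ P, u ≠ b → a ≠ b ∧ JoinedWithin G (Z \ {b}) a u := by
  obtain h | ⟨h, -⟩ := exists_connectedOn_of_ne ha b h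
  · exact h
  · exact absurd rfl h

end JoinedWithin

end Joined

section Menger

variable {V : Type*}

theorem exists_reindex_of_meets {k : ℕ} (P : Fin k → Set V) (X : Finset V) (hX : #X = k)
    (hdis : ∀ i j, i ≠ j → Disjoint (P i) (P j)) (hne : ∀ i, ∃ x ∈ X, x ∈ P i) :
    ∃ Q : V → Set V, (∀ x ∈ X, x ∈ Q x ∧ ∃ i, Q x = P i) ∧
      ∀ x ∈ X, ∀ y ∈ X, x ≠ y → Disjoint (Q x) (Q y) := by
  classical
  choose g hgX hgP using hne
  have hinj : Function.Injective g := by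
    intro i j hij
    by_contra hne
    exact Set.disjoint_left.1 (hdis i j hne) (hgP i) (hij ▸ hgP j)
  have himg : univ.image g = X := by
    refine eq_of_subset_of_card_le (by simpa [Finset.subset_iff] using hgX) ?_
    rw [card_image_of_injective _ hinj, hX, card_univ, Fintype.card_fin]
  have hsurj : ∀ x ∈ X, ∃ Q : Set V, ∃ i, g i = x ∧ Q = P i := by
    intro x hx
    rw [← himg] at hx
    obtain ⟨i, -, hi⟩ := mem_image.1 hx
    exact ⟨_, i, hi, rfl⟩
  choose! Q hQ using hsurj
  refine ⟨Q, fun x hx => ?_, fun x hx y hy hxy => ?_⟩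
  · obtain ⟨i, rfl, h⟩ := hQ x hx
    exact ⟨h ▸ hgP i, i, h⟩
  · obtain ⟨i, rfl, h⟩ := hQ x hx
    obtain ⟨j, rfl, h'⟩ := hQ y hy
    rw [h, h']
    exact hdis i j fun h => hxy (h ▸ rfl)

/-- The half-step of the induction in Menger's theorem: a family of `k` disjoint connections
between `A` and the separator `X = insert x D`, trimmed so as to meet `X` only once. -/
theorem exists_trimmed_family [DecidableEq V] (G' : SimpleGraph V) (A : Set V) (D : Finset V)
    (x : V) {k : ℕ} (hX : #(insert x D) = k) (P : Fin k → Set V)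
    (hdis : ∀ i j, i ≠ j → Disjoint (P i) (P j))
    (hP : ∀ i, ConnectedOn G' (P i) ∧ (∃ a ∈ A, a ∈ P i) ∧ ∃ w ∈ insert x D, w ∈ P i) :
    ∃ Q : V → Set V, (∀ w ∈ insert x D, w ∈ Q w ∧ ConnectedOn G' (Q w) ∧ (∃ a ∈ A, a ∈ Q w) ∧
        ∀ u ∈ Q w, u ≠ w → u ∉ insert x D ∧ ∃ a ∈ A, a ∉ D ∧ JoinedWithin G' (↑D)ᶜ a u) ∧
      ∀ w ∈ insert x D, ∀ w' ∈ insert x D, w ≠ w' → Disjoint (Q w) (Q w') := by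
  obtain ⟨R, hR, hRdis⟩ := exists_reindex_of_meets P (insert x D) hX hdis fun i => (hP i).2.2
  have key : ∀ w ∈ insert x D, ∃ Q ⊆ R w, w ∈ Q ∧ ConnectedOn G' Q ∧ (∃ a ∈ A, a ∈ Q) ∧
      ∀ u ∈ Q, u ≠ w → u ∉ insert x D ∧ ∃ a ∈ A, a ∉ D ∧ JoinedWithin G' (↑D)ᶜ a u := by
    intro w hw
    have honly : ∀ u ∈ R w, u ≠ w → u ∉ insert x D := fun u hu huw huX =>
      Set.disjoint_left.1 (hRdis u huX w hw huw) (hR u huX).1 hu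
    obtain ⟨hwR, i, hi⟩ := hR w hw
    obtain ⟨a, haA, haP⟩ := (hP i).2.1
    rw [← hi] at haP
    have hconn : ConnectedOn G' (R w) := hi ▸ (hP i).1
    obtain ⟨Q, hQ, h1, h2, h3, h4⟩ := (hconn a haP w hwR).exists_trim haP
    refine ⟨Q, hQ, h3, h1, ⟨a, haA, h2⟩, fun u hu huw => ⟨honly u (hQ hu) huw, a, haA, ?_, ?_⟩⟩
    · exact fun haD => honly a haP (h4 u hu huw).1 (mem_insert_of_mem haD)
    · exact (h4 u hu huw).2.mono le_rfl fun v hv hvD =>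
        honly v hv.1 hv.2 (mem_insert_of_mem hvD)
  choose! Q hQR hQ using key
  exact ⟨Q, hQ, fun w hw w' hw' hne => (hRdis w hw w' hw' hne).mono (hQR w hw) (hQR w' hw')⟩

/-- Connections from `A` to the separator `insert x D` cannot be blocked by fewer vertices than
connections from `A` to `B`. -/
theorem exists_joined_separator [DecidableEq V] {G : SimpleGraph V} {A B : Set V} {D : Finset V}
    {x y b₀ : V}
    (hD : ∀ a ∈ A, ∀ b ∈ B, a ∉ D → b ∉ D → ¬ JoinedWithin (G.deleteEdges {s(x, y)}) (↑D)ᶜ a b)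
    (hb₀ : b₀ ∈ B) (hb₀D : b₀ ∉ D)
    (hyb : JoinedWithin (G.deleteEdges {s(x, y)}) (↑D)ᶜ y b₀) (E : Finset V)
    (hE : ∃ a ∈ A, ∃ b ∈ B, a ∉ E ∧ b ∉ E ∧ JoinedWithin G (↑E)ᶜ a b) :
    ∃ a ∈ A, ∃ b ∈ (↑(insert x D) : Set V), a ∉ E ∧ b ∉ E ∧
      JoinedWithin (G.deleteEdges {s(x, y)}) (↑E)ᶜ a b := by
  obtain ⟨a, ha, b, hb, haE, hbE, hab⟩ := hE
  have hit : ∀ u, JoinedWithin (G.deleteEdges {s(x, y)}) (↑E)ᶜ a u →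
      (a ∉ D ∧ u ∉ D ∧ JoinedWithin (G.deleteEdges {s(x, y)}) (↑D)ᶜ a u) ∨
      ∃ b ∈ (↑(insert x D) : Set V), b ∉ E ∧
        JoinedWithin (G.deleteEdges {s(x, y)}) (↑E)ᶜ a b := by
    intro u hu
    by_cases haD : a ∈ D
    · exact Or.inr ⟨a, by simp [haD], haE, JoinedWithin.refl _⟩
    obtain ⟨h1, h2⟩ | ⟨d, h1, h2, h3⟩ := hu.avoid_or_hit (D : Set V) haE
    · exact Or.inl ⟨haD, h1, h2.mono le_rfl fun v hv => hv.2⟩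
    · exact Or.inr ⟨d, by simpa using Or.inr h1, h2, h3⟩
  obtain h | ⟨hxE, -, ⟨h, -⟩ | ⟨h, -⟩⟩ := hab.deleteEdges_or x y
  · obtain ⟨h1, h2, h3⟩ | ⟨d, h1, h2, h3⟩ := hit b h
    · exact absurd h3 (hD a ha b hb h1 h2)
    · exact ⟨a, ha, d, h1, haE, h2, h3⟩
  · exact ⟨a, ha, x, by simp, haE, hxE, h⟩
  · obtain ⟨h1, h2, h3⟩ | ⟨d, h1, h2, h3⟩ := hit y h
    · exact absurd (h3.trans hyb) (hD a ha b₀ hb₀ h1 hb₀D)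
    · exact ⟨a, ha, d, h1, haE, h2, h3⟩

/-- Menger's theorem for vertex sets, in a graph with finitely many edges. -/
theorem menger (G : SimpleGraph V) (hfin : G.edgeSet.Finite) (A B : Set V) (k : ℕ)
    (h : ∀ D : Finset V, #D < k →
      ∃ a ∈ A, ∃ b ∈ B, a ∉ D ∧ b ∉ D ∧ JoinedWithin G (↑D)ᶜ a b) :
    ∃ P : Fin k → Set V, (∀ i j, i ≠ j → Disjoint (P i) (P j)) ∧
      ∀ i, ConnectedOn G (P i) ∧ (∃ a ∈ A, a ∈ P i) ∧ ∃ b ∈ B, b ∈ P i := by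
  classical
  induction hm : G.edgeSet.ncard using Nat.strong_induction_on generalizing G A B with
  | _ m ih =>
  by_cases hedge : ∃ x y, G.Adj x y
  swap
  · push Not at hedge
    have heq : ∀ (Z : Set V) a b, JoinedWithin G Z a b → a = b := by
      intro Z a b h
      induction h with
      | refl => rfl
      | tail _ h _ => exact absurd h.1 (hedge _ _)
    have hX : ∃ X : Finset V, ↑X ⊆ A ∩ B ∧ #X = k := by
      by_contra hX
      have : ∀ j ≤ k, ∃ X : Finset V, ↑X ⊆ A ∩ B ∧ #X = j := by
        intro j
        induction j with
        | zero => exact fun _ => ⟨∅, by simp, rfl⟩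
        | succ j ihj =>
          intro hj
          obtain ⟨X, hXAB, hXj⟩ := ihj (by omega)
          obtain ⟨a, ha, b, hb, haX, hbX, hab⟩ := h X (by omega)
          obtain rfl := heq _ _ _ hab
          refine ⟨insert a X, ?_, by rw [card_insert_of_notMem haX, hXj]⟩
          rw [coe_insert]
          exact Set.insert_subset ⟨ha, hb⟩ hXAB
      exact hX (this k le_rfl)
    obtain ⟨X, hXAB, rfl⟩ := hX
    refine ⟨fun i => {(X.equivFin.symm i : V)}, fun i j hij => ?_, fun i => ?_⟩
    · simpa [Subtype.ext_iff] using fun h => hij (X.equivFin.symm.injective (Subtype.ext h))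
    · have := hXAB (X.equivFin.symm i).2
      exact ⟨ConnectedOn.singleton _, ⟨_, this.1, rfl⟩, ⟨_, this.2, rfl⟩⟩
  obtain ⟨x, y, hxy⟩ := hedge
  have hlt : ∀ x y, G.Adj x y → (G.deleteEdges {s(x, y)}).edgeSet.ncard < m := by
    intro x y hxy
    rw [← hm, SimpleGraph.edgeSet_deleteEdges]
    exact Set.ncard_lt_ncard ⟨Set.sdiff_subset, fun hsub => (hsub (a := s(x, y)) hxy).2 rfl⟩ hfin
  have hfin' : ∀ x y, (G.deleteEdges {s(x, y)}).edgeSet.Finite := by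
    intro x y
    rw [SimpleGraph.edgeSet_deleteEdges]
    exact hfin.subset Set.sdiff_subset
  have hle : ∀ x y, G.deleteEdges {s(x, y)} ≤ G := fun x y => SimpleGraph.deleteEdges_le _
  by_cases hG' : ∀ D : Finset V, #D < k → ∃ a ∈ A, ∃ b ∈ B, a ∉ D ∧ b ∉ D ∧
      JoinedWithin (G.deleteEdges {s(x, y)}) (↑D)ᶜ a b
  · obtain ⟨P, hP, hP'⟩ := ih _ (hlt x y hxy) _ (hfin' x y) A B hG' rfl
    exact ⟨P, hP, fun i => ⟨(hP' i).1.mono (hle x y), (hP' i).2⟩⟩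
  push Not at hG'
  obtain ⟨D, hDk, hD⟩ := hG'
  obtain ⟨x, y, hxy, hD, hxD, hyD, a₀, ha₀, b₀, hb₀, ha₀D, hb₀D, hax, hyb⟩ :
      ∃ x y, G.Adj x y ∧
        (∀ a ∈ A, ∀ b ∈ B, a ∉ D → b ∉ D →
          ¬ JoinedWithin (G.deleteEdges {s(x, y)}) (↑D)ᶜ a b) ∧ x ∉ D ∧ y ∉ D ∧
        ∃ a ∈ A, ∃ b ∈ B, a ∉ D ∧ b ∉ D ∧
          JoinedWithin (G.deleteEdges {s(x, y)}) (↑D)ᶜ a x ∧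
          JoinedWithin (G.deleteEdges {s(x, y)}) (↑D)ᶜ y b := by
    obtain ⟨a, ha, b, hb, haD, hbD, hab⟩ := h D hDk
    obtain h | ⟨hxD, hyD, h | h⟩ := hab.deleteEdges_or x y
    · exact absurd h (hD a ha b hb haD hbD)
    · exact ⟨x, y, hxy, hD, hxD, hyD, a, ha, b, hb, haD, hbD, h⟩
    · rw [Sym2.eq_swap] at h hD
      exact ⟨y, x, hxy.symm, hD, hyD, hxD, a, ha, b, hb, haD, hbD, h⟩
  have hDk' : #D + 1 = k := by
    by_contra hne
    obtain ⟨a, ha, b, hb, haD, hbD, hab⟩ := h (insert x D) (by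
      rw [card_insert_of_notMem hxD]; omega)
    refine hD a ha b hb (fun h => haD (mem_insert_of_mem h)) (fun h => hbD (mem_insert_of_mem h))
      (hab.of_forall_adj fun u hu v hv huv => JoinedWithin.single ?_ ?_ ?_)
    · refine SimpleGraph.deleteEdges_adj.2 ⟨huv, ?_⟩
      rintro (heq : s(u, v) = s(x, y))
      simp only [coe_insert, Set.mem_compl_iff, Set.mem_insert_iff, not_or] at hu hv
      rw [Sym2.eq_iff] at heq
      obtain h | h := heq
      · exact hu.1 h.1
      · exact hv.1 h.2
    · exact fun h => hu (by simpa using Or.inr h)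
    · exact fun h => hv (by simpa using Or.inr h)
  have hXk : #(insert x D) = k := by rw [card_insert_of_notMem hxD, hDk']
  have hYk : #(insert y D) = k := by rw [card_insert_of_notMem hyD, hDk']
  obtain ⟨P₀, hP₀, hP₀'⟩ := ih _ (hlt x y hxy) _ (hfin' x y) A ↑(insert x D)
    (fun E hE => exists_joined_separator hD hb₀ hb₀D hyb E (h E hE)) rfl
  obtain ⟨Q₀, hQ₀, hQ₀'⟩ := ih _ (hlt x y hxy) _ (hfin' x y) B ↑(insert y D) (by
    intro E hE
    rw [Sym2.eq_swap]
    refine exists_joined_separator (fun b hb a ha hbD haD hba => hD a ha b hb haD hbD ?_)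
      ha₀ ha₀D ?_ E ?_
    · rw [Sym2.eq_swap]; exact hba.symm
    · rw [Sym2.eq_swap]; exact hax.symm
    · obtain ⟨a, ha, b, hb, haE, hbE, hab⟩ := h E hE
      exact ⟨b, hb, a, ha, hbE, haE, hab.symm⟩) rfl
  obtain ⟨P, hP, hPdis⟩ := exists_trimmed_family _ A D x hXk P₀ hP₀ hP₀'
  obtain ⟨Q, hQ, hQdis⟩ := exists_trimmed_family _ B D y hYk Q₀ hQ₀ hQ₀'
  clear ih hP₀ hQ₀ hP₀' hQ₀'
  have hPA : ∀ w ∈ insert x D, ∀ u ∈ P w, (u ∈ D ∧ u = w) ∨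
      (u ∉ D ∧ ∃ a ∈ A, a ∉ D ∧ JoinedWithin (G.deleteEdges {s(x, y)}) (↑D)ᶜ a u) := by
    intro w hw u hu
    by_cases huw : u = w
    · subst huw
      obtain rfl | hw := mem_insert.1 hw
      · exact Or.inr ⟨hxD, a₀, ha₀, ha₀D, hax⟩
      · exact Or.inl ⟨hw, rfl⟩
    · obtain ⟨h1, h2⟩ := (hP w hw).2.2.2 u hu huw
      exact Or.inr ⟨fun h => h1 (mem_insert_of_mem h), h2⟩
  have hQB : ∀ w ∈ insert y D, ∀ u ∈ Q w, (u ∈ D ∧ u = w) ∨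
      (u ∉ D ∧ ∃ b ∈ B, b ∉ D ∧ JoinedWithin (G.deleteEdges {s(x, y)}) (↑D)ᶜ b u) := by
    intro w hw u hu
    by_cases huw : u = w
    · subst huw
      obtain rfl | hw := mem_insert.1 hw
      · exact Or.inr ⟨hyD, b₀, hb₀, hb₀D, hyb.symm⟩
      · exact Or.inl ⟨hw, rfl⟩
    · obtain ⟨h1, h2⟩ := (hQ w hw).2.2.2 u hu huw
      exact Or.inr ⟨fun h => h1 (mem_insert_of_mem h), h2⟩
  have hPQ : ∀ w ∈ insert x D, ∀ w' ∈ insert y D, ∀ u ∈ P w, u ∈ Q w' → w ∈ D ∧ w' = w := by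
    intro w hw w' hw' u hu hu'
    obtain ⟨h1, rfl⟩ | ⟨h1, a, ha, haD, hau⟩ := hPA w hw u hu
    · obtain ⟨h2, rfl⟩ | ⟨h2, -⟩ := hQB w' hw' u hu'
      · exact ⟨h1, rfl⟩
      · exact absurd h1 h2
    · obtain ⟨h2, rfl⟩ | ⟨h2, b, hb, hbD, hbu⟩ := hQB w' hw' u hu'
      · exact absurd h2 h1
      · exact absurd (hau.trans hbu.symm) (hD a ha b hb haD hbD)
  let τ : V → V := fun w => if w = x then y else w
  have hτ : ∀ w ∈ insert x D, τ w ∈ insert y D := by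
    intro w hw
    by_cases hwx : w = x
    · simp [τ, hwx]
    · simpa [τ, hwx] using Or.inr ((mem_insert.1 hw).resolve_left hwx)
  have hτne : ∀ w ∈ insert x D, ∀ w' ∈ insert x D, w ≠ w' → τ w ≠ τ w' := by
    intro w hw w' hw' hne
    have hD' : ∀ w ∈ insert x D, w ≠ x → w ≠ y := fun w hw hwx hwy =>
      hyD (hwy ▸ (mem_insert.1 hw).resolve_left hwx)
    by_cases h1 : w = x <;> by_cases h2 : w' = x
    · exact absurd (h1.trans h2.symm) hne
    · simpa [τ, h1, h2] using (hD' w' hw' h2).symm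
    · simpa [τ, h1, h2] using hD' w hw h1
    · simpa [τ, h1, h2] using hne
  have hτD : ∀ w ∈ insert x D, ∀ w' ∈ insert x D, w' ∈ D → w ≠ w' → τ w ≠ w' := by
    intro w hw w' hw' hw'D hne heq
    have : τ w' = w' := by
      simp only [τ, ite_eq_right_iff]
      rintro rfl
      exact absurd hw'D hxD
    exact hτne w hw w' hw' hne (heq.trans this.symm)
  let e : Fin k ≃ {w // w ∈ insert x D} := (finCongr hXk.symm).trans (insert x D).equivFin.symm
  refine ⟨fun i => P (e i) ∪ Q (τ (e i)), fun i j hij => ?_, fun i => ?_⟩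
  · have hne : (e i : V) ≠ e j := fun h => hij (e.injective (Subtype.ext h))
    rw [Set.disjoint_union_left, Set.disjoint_union_right, Set.disjoint_union_right]
    refine ⟨⟨hPdis _ (e i).2 _ (e j).2 hne, ?_⟩, ?_,
      hQdis _ (hτ _ (e i).2) _ (hτ _ (e j).2) (hτne _ (e i).2 _ (e j).2 hne)⟩
    · rw [Set.disjoint_left]
      intro u hu hu'
      obtain ⟨h1, h2⟩ := hPQ _ (e i).2 _ (hτ _ (e j).2) u hu hu'
      exact hτD _ (e j).2 _ (e i).2 h1 hne.symm h2
    · rw [Set.disjoint_left]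
      intro u hu hu'
      obtain ⟨h1, h2⟩ := hPQ _ (e j).2 _ (hτ _ (e i).2) u hu' hu
      exact hτD _ (e i).2 _ (e j).2 h1 hne h2
  · obtain ⟨h1, h2, ⟨a, ha, haP⟩, -⟩ := hP _ (e i).2
    obtain ⟨h3, h4, ⟨b, hb, hbQ⟩, -⟩ := hQ _ (hτ _ (e i).2)
    refine ⟨?_, ⟨a, ha, Or.inl haP⟩, ⟨b, hb, Or.inr hbQ⟩⟩
    by_cases hix : (e i : V) = x
    · refine (h2.mono (hle x y)).union_of_adj (h4.mono (hle x y)) h1 h3 ?_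
      simpa [τ, hix] using hxy
    · refine (h2.mono (hle x y)).union_of_mem (h4.mono (hle x y)) h1 ?_
      have : τ (e i) = e i := by simp [τ, hix]
      rwa [this] at h3 ⊢

/-- The fan lemma inside a finite region `C`. -/
theorem exists_fan (G : SimpleGraph V) {C : Set V} (hC : C.Finite) (y : V) (B : Finset V)
    (hBC : ↑B ⊆ C) (hyB : y ∉ B)
    (h : ∀ D : Finset V, y ∉ D → #D < #B → ∃ b ∈ B, b ∉ D ∧ JoinedWithin G (C \ D) y b) :
    ∃ P : V → Set V, (∀ b ∈ B, b ∈ P b ∧ P b ⊆ C ∧ ConnectedOn G (P b) ∧ y ∉ P b ∧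
        ∃ u ∈ P b, G.Adj y u) ∧
      ∀ b ∈ B, ∀ b' ∈ B, b ≠ b' → Disjoint (P b) (P b') := by
  classical
  let G' : SimpleGraph V :=
    { Adj := fun u v => G.Adj u v ∧ u ∈ C \ {y} ∧ v ∈ C \ {y}
      symm := ⟨fun u v h => ⟨h.1.symm, h.2.2, h.2.1⟩⟩
      loopless := ⟨fun u h => G.loopless.irrefl u h.1⟩ }
  have hG' : G' ≤ G := fun u v h => h.1
  have hfin : G'.edgeSet.Finite := by
    refine ((hC.prod hC).image fun p => s(p.1, p.2)).subset ?_
    intro e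
    induction e with | _ u v
    intro (huv : G'.Adj u v)
    exact ⟨(u, v), ⟨huv.2.1.1, huv.2.2.1⟩, rfl⟩
  obtain ⟨P, hPdis, hP⟩ := menger G' hfin {u | u ∈ C ∧ G.Adj y u} B #B (by
    intro D hD
    obtain ⟨b, hb, hbD, hyb⟩ := h (D.erase y) (by simp)
      (lt_of_le_of_lt (card_le_card (erase_subset _ _)) hD)
    have hne : y ≠ b := fun h => hyB (h ▸ hb)
    obtain ⟨a, ha, haC, hay, hab⟩ := hyb.exists_adj_start hne
    have hD' : ∀ u ∈ (C \ (D.erase y : Finset V)) \ {y}, u ∉ D := by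
      rintro u ⟨hu, huy⟩ huD
      exact hu.2 (by simpa using ⟨huD, huy⟩)
    refine ⟨a, ⟨haC.1, ha⟩, b, hb, hD' a ⟨haC, hay⟩, fun h => hbD (by simp [h, hne.symm]),
      hab.of_forall_adj fun u hu v hv huv => ?_⟩
    exact JoinedWithin.single ⟨huv, ⟨hu.1.1, hu.2⟩, hv.1.1, hv.2⟩ (hD' u hu) (hD' v hv))
  obtain ⟨Q, hQ, hQdis⟩ := exists_reindex_of_meets P B rfl hPdis fun i => (hP i).2.2
  refine ⟨Q, fun b hb => ?_, hQdis⟩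
  obtain ⟨hbQ, i, hi⟩ := hQ b hb
  obtain ⟨hconn, ⟨a, ha, haP⟩, -⟩ := hP i
  rw [← hi] at hconn haP
  have hsub : Q b ⊆ C \ {y} := by
    intro u hu
    have hbu := hconn b hbQ u hu
    have hbC : b ∈ C \ {y} := ⟨hBC hb, fun h => hyB (h ▸ hb)⟩
    cases hbu with
    | refl => exact hbC
    | tail _ h => exact h.1.2.2
  exact ⟨hbQ, fun u hu => (hsub hu).1, hconn.mono hG', fun h => (hsub h).2 rfl, a, haP, ha.2⟩

/-- A fan from `y` one of whose targets is the adjacent pair `{f, g}`. -/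
theorem exists_hooking_fan [DecidableEq V] (G : SimpleGraph V) {C : Set V} (hC : C.Finite)
    {y f g : V} (hyC : y ∈ C) (hfC : f ∈ C) (hgC : g ∈ C) (hfg : G.Adj f g) (hyf : y ≠ f)
    (hyg : y ≠ g) (B : Finset V) (hBC : ↑B ⊆ C) (hyB : y ∉ B) (hfB : f ∉ B) (hgB : g ∉ B)
    (hκ : ∀ D : Finset V, #D ≤ #B → ConnectedOn G (C \ D))
    (hσ : ∀ D : Finset V, #D ≤ #B + 1 → f ∈ D → g ∈ D → ConnectedOn G (C \ D)) :
    ∃ (P : V → Set V) (F : Set V),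
      (∀ b ∈ B, b ∈ P b ∧ P b ⊆ C ∧ ConnectedOn G (P b) ∧ y ∉ P b ∧ Disjoint (P b) F ∧
        ∃ u ∈ P b, G.Adj y u) ∧
      (∀ b ∈ B, ∀ b' ∈ B, b ≠ b' → Disjoint (P b) (P b')) ∧
      f ∈ F ∧ g ∈ F ∧ F ⊆ C ∧ ConnectedOn G F ∧ y ∉ F ∧ ∃ u ∈ F, G.Adj y u := by
  let π : V → V := fun u => if u = g then f else u
  have hπ : ∀ {u}, u ≠ g → π u = u := fun h => if_neg h
  have hπg : π g = f := if_pos rfl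
  let G' : SimpleGraph V :=
    { Adj := fun u v => u ≠ v ∧ ∃ u' v', π u' = u ∧ π v' = v ∧ G.Adj u' v'
      symm := ⟨fun u v ⟨h, u', v', h1, h2, h3⟩ => ⟨h.symm, v', u', h2, h1, h3.symm⟩⟩
      loopless := ⟨fun u h => h.1 rfl⟩ }
  have hlift : ∀ {u v}, π u = v → u = v ∨ (u = g ∧ v = f) := by
    intro u v h
    by_cases hu : u = g
    · exact Or.inr ⟨hu, by rw [← h, hu, hπg]⟩
    · exact Or.inl (by rw [← h, hπ hu])
  obtain ⟨P, hP, hPdis⟩ := exists_fan G' (C := C \ {g}) (hC.subset Set.sdiff_subset) y (insert f B)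
    (by
      rw [coe_insert]
      refine Set.insert_subset ⟨hfC, hfg.ne⟩ fun b hb => ⟨hBC hb, ?_⟩
      rintro rfl
      exact hgB hb) (by simp [hyf, hyB]) (by
      intro D hyD hD
      rw [card_insert_of_notMem hfB] at hD
      obtain ⟨b, hb, hbD⟩ : ∃ b ∈ insert f B, b ∉ D := by
        by_contra hcon
        push Not at hcon
        have := card_le_card (show insert f B ⊆ D from hcon)
        rw [card_insert_of_notMem hfB] at this
        omega
      refine ⟨b, hb, hbD, ?_⟩
      have hbC : b ∈ C := by
        obtain rfl | hb := mem_insert.1 hb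
        exacts [hfC, hBC hb]
      have hbg : b ≠ g := by
        obtain rfl | hb := mem_insert.1 hb
        · exact hfg.ne
        · rintro rfl
          exact hgB hb
      by_cases hfD : f ∈ D
      · have h := hσ (insert g D) ((card_insert_le _ _).trans (by omega))
          (mem_insert_of_mem hfD) (mem_insert_self _ _) y ⟨hyC, by simp [hyg, hyD]⟩ b
          ⟨hbC, by simp [hbg, hbD]⟩
        refine h.of_forall_adj fun u hu v hv huv => ?_
        simp only [coe_insert, Set.mem_sdiff, Set.mem_insert_iff, not_or, mem_coe] at hu hv
        exact JoinedWithin.single ⟨huv.ne, u, v, hπ hu.2.1, hπ hv.2.1, huv⟩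
          ⟨⟨hu.1, hu.2.1⟩, hu.2.2⟩ ⟨⟨hv.1, hv.2.1⟩, hv.2.2⟩
      · have h := hκ (D.erase g) ((card_le_card (erase_subset _ _)).trans (by omega)) y
          ⟨hyC, by simp [hyD]⟩ b ⟨hbC, by simp [hbD]⟩
        have hmem : ∀ u ∈ C \ (D.erase g : Finset V), π u ∈ (C \ {g}) \ (D : Set V) := by
          rintro u ⟨hu, huD⟩
          by_cases hug : u = g
          · rw [hug, hπg]
            exact ⟨⟨hfC, hfg.ne⟩, hfD⟩
          · rw [hπ hug]
            exact ⟨⟨hu, hug⟩, fun h => huD (by simpa using ⟨h, hug⟩)⟩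
        have h' := h.map (G' := G') (Z' := (C \ {g}) \ (D : Set V)) π fun u hu v hv huv => by
          by_cases hne : π u = π v
          · rw [hne]
            exact JoinedWithin.refl _
          · exact JoinedWithin.single ⟨hne, u, v, rfl, rfl, huv⟩ (hmem u hu) (hmem v hv)
        rwa [hπ hyg, hπ hbg] at h')
  have hnb : ∀ {u}, G'.Adj y u → G.Adj y u ∨ (u = f ∧ G.Adj y g) := by
    rintro u ⟨-, y', u', hy', hu', hadj⟩
    obtain rfl | ⟨-, h⟩ := hlift hy'
    · obtain rfl | ⟨rfl, rfl⟩ := hlift hu'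
      exacts [Or.inl hadj, Or.inr ⟨rfl, hadj⟩]
    · exact absurd h hyf
  obtain ⟨hfP, hfC', hfconn, hyPf, u₀, hu₀, hyu₀⟩ := hP f (mem_insert_self _ _)
  have hfne : ∀ b ∈ B, b ≠ f := fun b hb h => hfB (h ▸ hb)
  have hfb : ∀ b ∈ B, f ∉ P b := fun b hb hfPb =>
    Set.disjoint_left.1 (hPdis b (mem_insert_of_mem hb) f (mem_insert_self _ _) (hfne b hb)) hfPb
      hfP
  refine ⟨P, insert g (P f), fun b hb => ?_, fun b hb b' hb' => hPdis b (mem_insert_of_mem hb) b'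
    (mem_insert_of_mem hb'), Or.inr hfP, Or.inl rfl, ?_, ?_, ?_, ?_⟩
  · obtain ⟨h1, h2, h3, h4, u, hu, hyu⟩ := hP b (mem_insert_of_mem hb)
    refine ⟨h1, fun v hv => (h2 hv).1, fun a ha c hc => ?_, h4, ?_, u, hu, ?_⟩
    · refine (h3 a ha c hc).of_forall_adj fun v hv w hw hvw => ?_
      obtain ⟨-, v', w', hv', hw', hadj⟩ := hvw
      obtain rfl | ⟨-, rfl⟩ := hlift hv'
      · obtain rfl | ⟨-, rfl⟩ := hlift hw'
        · exact JoinedWithin.single hadj hv hw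
        · exact absurd hw (hfb b hb)
      · exact absurd hv (hfb b hb)
    · rw [Set.disjoint_insert_right]
      exact ⟨fun h => (h2 h).2 rfl, hPdis b (mem_insert_of_mem hb) f (mem_insert_self _ _)
        (hfne b hb)⟩
    · obtain h | ⟨rfl, -⟩ := hnb hyu
      exacts [h, absurd hu (hfb b hb)]
  · exact Set.insert_subset hgC fun v hv => (hfC' hv).1
  · have hlift' : ∀ {u v}, π u = v → v ∈ P f → JoinedWithin G (insert g (P f)) u v := by
      intro u v h hv
      obtain rfl | ⟨rfl, rfl⟩ := hlift h
      · exact JoinedWithin.refl _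
      · exact JoinedWithin.single hfg.symm (Or.inl rfl) (Or.inr hfP)
    refine ConnectedOn.of_center f fun a ha => ?_
    obtain rfl | ha := ha
    · exact JoinedWithin.single hfg (Or.inr hfP) (Or.inl rfl)
    · refine (hfconn f hfP a ha).of_forall_adj fun v hv w hw hvw => ?_
      obtain ⟨-, v', w', hv', hw', hadj⟩ := hvw
      have h1 := hlift' hv' hv
      have h2 := hlift' hw' hw
      refine h1.symm.trans (JoinedWithin.trans ?_ h2)
      have hin : ∀ {u v}, π u = v → v ∈ P f → u ∈ insert g (P f) := by
        intro u v h hv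
        obtain rfl | ⟨rfl, -⟩ := hlift h
        exacts [Or.inr hv, Or.inl rfl]
      exact JoinedWithin.single hadj (hin hv' hv) (hin hw' hw)
  · rintro (h | h)
    exacts [hyg h, hyPf h]
  · obtain h | ⟨rfl, h⟩ := hnb hyu₀
    exacts [⟨u₀, Or.inr hu₀, h⟩, ⟨g, Or.inl rfl, h⟩]

end Menger

section Words

open Equiv

/-- Permutations of `ℕ` (words) moving only positions below `n`. -/
def words (n : ℕ) : Set (Perm ℕ) := {u | ∀ p, n ≤ p → u p = p}

/-- The generators of the bubble-sort star graph on the positions below `n`. -/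
noncomputable def gens (n : ℕ) : Finset (Perm ℕ) := by
  classical exact (Ico 1 n).image (fun i => swap 0 i) ∪
    (Ico 1 (n - 1)).image fun j => swap j (j + 1)

theorem mem_gens {n : ℕ} {s : Perm ℕ} :
    s ∈ gens n ↔ (∃ i, 1 ≤ i ∧ i < n ∧ s = swap 0 i) ∨
      ∃ j, 1 ≤ j ∧ j + 1 < n ∧ s = swap j (j + 1) := by
  classical
  simp only [gens, mem_union, mem_image, mem_Ico]
  constructor
  · rintro (⟨i, h, rfl⟩ | ⟨j, h, rfl⟩)
    · exact Or.inl ⟨i, h.1, h.2, rfl⟩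
    · exact Or.inr ⟨j, h.1, by omega, rfl⟩
  · rintro (⟨i, h, h', rfl⟩ | ⟨j, h, h', rfl⟩)
    · exact Or.inl ⟨i, ⟨h, h'⟩, rfl⟩
    · exact Or.inr ⟨j, ⟨h, by omega⟩, rfl⟩

theorem exists_swap_of_mem_gens {n : ℕ} {s : Perm ℕ} (h : s ∈ gens n) :
    ∃ a b, a ≠ b ∧ a < n ∧ b < n ∧ s = swap a b := by
  obtain ⟨i, h1, h2, rfl⟩ | ⟨j, h1, h2, rfl⟩ := mem_gens.1 h
  · exact ⟨0, i, by omega, by omega, h2, rfl⟩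
  · exact ⟨j, j + 1, by omega, by omega, h2, rfl⟩

theorem gens_mono {n m : ℕ} (h : n ≤ m) : gens n ⊆ gens m := by
  intro s hs
  obtain ⟨i, h1, h2, rfl⟩ | ⟨j, h1, h2, rfl⟩ := mem_gens.1 hs
  · exact mem_gens.2 (Or.inl ⟨i, h1, by omega, rfl⟩)
  · exact mem_gens.2 (Or.inr ⟨j, h1, by omega, rfl⟩)

theorem mul_self_of_mem_gens {n : ℕ} {s : Perm ℕ} (h : s ∈ gens n) : s * s = 1 := by
  obtain ⟨a, b, -, -, -, rfl⟩ := exists_swap_of_mem_gens h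
  exact swap_mul_self a b

theorem swap_eq_swap_iff {a b c d : ℕ} (hab : a ≠ b) :
    swap a b = swap c d ↔ (a = c ∧ b = d) ∨ (a = d ∧ b = c) := by
  constructor
  · intro h
    have h1 := congrArg (· a) h
    have h2 := congrArg (· b) h
    simp only [swap_apply_left, swap_apply_right, swap_apply_def] at h1 h2
    grind
  · rintro (⟨rfl, rfl⟩ | ⟨rfl, rfl⟩)
    · rfl
    · exact swap_comm _ _

theorem card_gens (n : ℕ) (hn : 2 ≤ n) : #(gens n) = 2 * n - 3 := by
  classical
  rw [gens, card_union_of_disjoint, card_image_of_injOn, card_image_of_injOn, Nat.card_Ico,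
    Nat.card_Ico]
  · omega
  · intro i hi j hj h
    rw [swap_eq_swap_iff (by omega)] at h
    omega
  · intro i hi j hj h
    simp only [coe_Ico, Set.mem_Ico] at hi
    rw [swap_eq_swap_iff (by omega)] at h
    omega
  · rw [disjoint_left]
    simp only [mem_image, mem_Ico]
    rintro _ ⟨i, hi, rfl⟩ ⟨j, hj, h⟩
    rw [swap_eq_swap_iff (by omega)] at h
    omega

/-- The bubble-sort star graph on words moving only positions below `n`. -/
def wordGraph (n : ℕ) : SimpleGraph (Perm ℕ) where
  Adj u v := ∃ s ∈ gens n, v = u * s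
  symm := ⟨by
    rintro u _ ⟨s, hs, rfl⟩
    exact ⟨s, hs, by rw [mul_assoc, mul_self_of_mem_gens hs, mul_one]⟩⟩
  loopless := ⟨by
    rintro u ⟨s, hs, h⟩
    obtain ⟨a, b, hab, -, -, rfl⟩ := exists_swap_of_mem_gens hs
    rw [left_eq_mul] at h
    exact hab (by simpa using (congrArg (· a) h).symm)⟩

variable {n m : ℕ} {u v g : Perm ℕ}

theorem wordGraph_mono (h : n ≤ m) : wordGraph n ≤ wordGraph m :=
  fun _ _ ⟨s, hs, e⟩ => ⟨s, gens_mono h hs, e⟩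

theorem adj_star (u : Perm ℕ) {i : ℕ} (h1 : 1 ≤ i) (h2 : i < n) :
    (wordGraph n).Adj u (u * swap 0 i) :=
  ⟨_, mem_gens.2 (Or.inl ⟨i, h1, h2, rfl⟩), rfl⟩

theorem adj_bubble (u : Perm ℕ) {j : ℕ} (h1 : 1 ≤ j) (h2 : j + 1 < n) :
    (wordGraph n).Adj u (u * swap j (j + 1)) :=
  ⟨_, mem_gens.2 (Or.inr ⟨j, h1, h2, rfl⟩), rfl⟩

theorem adj_mul_left (g : Perm ℕ) : (wordGraph n).Adj (g * u) (g * v) ↔ (wordGraph n).Adj u v := by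
  constructor
  · rintro ⟨s, hs, h⟩
    exact ⟨s, hs, by rwa [mul_assoc, mul_right_inj] at h⟩
  · rintro ⟨s, hs, rfl⟩
    exact ⟨s, hs, (mul_assoc _ _ _).symm⟩

theorem apply_lt_iff (hu : u ∈ words n) {p : ℕ} : u p < n ↔ p < n := by
  constructor
  · intro h
    by_contra hp
    rw [hu p (by omega)] at h
    exact hp h
  · intro h
    by_contra hp
    have := u.injective (hu (u p) (by omega))
    omega

theorem words_mono (h : n ≤ m) : words n ⊆ words m := fun _ hu p hp => hu p (h.trans hp)

theorem mul_mem_words (hu : u ∈ words n) (hv : v ∈ words n) : u * v ∈ words n := by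
  intro p hp
  rw [Perm.mul_apply, hv p hp, hu p hp]

theorem inv_mem_words (hu : u ∈ words n) : u⁻¹ ∈ words n := by
  intro p hp
  rw [Perm.inv_eq_iff_eq, hu p hp]

theorem swap_mem_words {a b : ℕ} (ha : a < n) (hb : b < n) : swap a b ∈ words n :=
  fun p hp => swap_apply_of_ne_of_ne (by omega) (by omega)

theorem mem_words_of_mem_gens {s : Perm ℕ} (hs : s ∈ gens n) : s ∈ words n := by
  obtain ⟨a, b, -, ha, hb, rfl⟩ := exists_swap_of_mem_gens hs
  exact swap_mem_words ha hb

theorem mem_words_of_adj (h : (wordGraph n).Adj u v) (hu : u ∈ words n) : v ∈ words n := by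
  obtain ⟨s, hs, rfl⟩ := h
  exact mul_mem_words hu (mem_words_of_mem_gens hs)

/-- The word of a permutation of `Fin n`. -/
def toWord (n : ℕ) : Perm (Fin n) →* Perm ℕ := Perm.extendDomainHom Fin.equivSubtype

theorem toWord_injective (n : ℕ) : Function.Injective (toWord n) :=
  Perm.extendDomainHom_injective _

theorem toWord_apply (σ : Perm (Fin n)) (p : Fin n) : toWord n σ p = σ p :=
  Perm.extendDomain_apply_image σ Fin.equivSubtype p

theorem toWord_apply_of_le (σ : Perm (Fin n)) {p : ℕ} (hp : n ≤ p) : toWord n σ p = p :=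
  Perm.extendDomain_apply_not_subtype σ Fin.equivSubtype (by omega)

theorem toWord_swap (a b : Fin n) : toWord n (swap a b) = swap (a : ℕ) b := by
  ext p
  by_cases hp : p < n
  · rw [show p = ((⟨p, hp⟩ : Fin n) : ℕ) from rfl, toWord_apply]
    simp only [swap_apply_def, Fin.ext_iff]
    grind
  · rw [toWord_apply_of_le _ (by omega), swap_apply_of_ne_of_ne] <;> omega

theorem range_toWord (n : ℕ) : Set.range (toWord n) = words n := by
  ext u
  constructor
  · rintro ⟨σ, rfl⟩ p hp
    exact toWord_apply_of_le σ hp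
  · intro hu
    refine ⟨⟨fun p => ⟨u p, (apply_lt_iff hu).2 p.2⟩,
      fun p => ⟨u⁻¹ p, (apply_lt_iff (inv_mem_words hu)).2 p.2⟩, fun p => by simp,
      fun p => by simp⟩, ?_⟩
    ext p
    by_cases hp : p < n
    · exact toWord_apply _ ⟨p, hp⟩
    · rw [toWord_apply_of_le _ (by omega), hu p (by omega)]

theorem finite_words (n : ℕ) : (words n).Finite :=
  range_toWord n ▸ Set.finite_range _

/-- A product of two transpositions is not a transposition. -/
theorem mul_ne_of_mem_gens {s t r : Perm ℕ} (hs : s ∈ gens n) (ht : t ∈ gens n)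
    (hr : r ∈ gens n) : s * t ≠ r := by
  have key : ∀ s ∈ gens n, ∃ s' : Perm (Fin n), Perm.sign s' = -1 ∧ toWord n s' = s := by
    intro s hs
    obtain ⟨a, b, hab, ha, hb, rfl⟩ := exists_swap_of_mem_gens hs
    exact ⟨swap ⟨a, ha⟩ ⟨b, hb⟩, Perm.sign_swap (by simpa using hab), toWord_swap _ _⟩
  obtain ⟨s', hs', rfl⟩ := key s hs
  obtain ⟨t', ht', rfl⟩ := key t ht
  obtain ⟨r', hr', rfl⟩ := key r hr
  intro h
  rw [← map_mul] at h
  have := congrArg Perm.sign (toWord_injective n h)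
  rw [map_mul, hs', ht', hr'] at this
  simp at this

/-- The neighbourhood of `u`. -/
noncomputable def nbrs (n : ℕ) (u : Perm ℕ) : Finset (Perm ℕ) := by
  classical exact (gens n).image (u * ·)

theorem mem_nbrs : v ∈ nbrs n u ↔ (wordGraph n).Adj u v := by
  classical
  simp only [nbrs, mem_image, wordGraph]
  exact ⟨fun ⟨s, hs, h⟩ => ⟨s, hs, h.symm⟩, fun ⟨s, hs, h⟩ => ⟨s, hs, h.symm⟩⟩

theorem card_nbrs (hn : 2 ≤ n) (u : Perm ℕ) : #(nbrs n u) = 2 * n - 3 := by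
  classical
  rw [nbrs, card_image_of_injective _ (mul_right_injective u), card_gens n hn]

theorem exists_word_update (hu : u ∈ words n) {p a : ℕ} (hp : p < n) (ha : a < n) :
    ∃ v ∈ words n, v p = a ∧ ∀ q, q ≠ p → u q ≠ a → v q = u q := by
  refine ⟨swap (u p) a * u, mul_mem_words (swap_mem_words ((apply_lt_iff hu).2 hp) ha) hu, ?_, ?_⟩
  · simp
  · intro q hq hqa
    exact swap_apply_of_ne_of_ne (fun h => hq (u.injective h)) hqa

theorem exists_word₂ {p q a b : ℕ} (hp : p < n) (hq : q < n) (ha : a < n) (hb : b < n)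
    (hpq : p ≠ q) (hab : a ≠ b) : ∃ u ∈ words n, u p = a ∧ u q = b := by
  obtain ⟨u, hu, h1, -⟩ := exists_word_update (n := n) (u := 1) (fun _ _ => rfl) hp ha
  obtain ⟨v, hv, h2, h3⟩ := exists_word_update hu hq hb
  exact ⟨v, hv, by rw [h3 p hpq (by rwa [h1]), h1], h2⟩

theorem exists_word₄ {p q r t a b c d : ℕ} (hp : p < n) (hq : q < n) (hr : r < n) (ht : t < n)
    (ha : a < n) (hb : b < n) (hc : c < n) (hd : d < n) (hpq : p ≠ q) (hpr : p ≠ r) (hpt : p ≠ t)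
    (hqr : q ≠ r) (hqt : q ≠ t) (hrt : r ≠ t) (hab : a ≠ b) (hac : a ≠ c) (had : a ≠ d)
    (hbc : b ≠ c) (hbd : b ≠ d) (hcd : c ≠ d) :
    ∃ u ∈ words n, u p = a ∧ u q = b ∧ u r = c ∧ u t = d := by
  obtain ⟨u, hu, h1, h2⟩ := exists_word₂ hp hq ha hb hpq hab
  obtain ⟨v, hv, h3, h4⟩ := exists_word_update hu hr hc
  have h5 := h4 p hpr (by rwa [h1])
  have h6 := h4 q hqr (by rwa [h2])
  obtain ⟨w, hw, h7, h8⟩ := exists_word_update hv ht hd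
  exact ⟨w, hw, by rw [h8 p hpt (by rwa [h5, h1]), h5, h1], by
    rw [h8 q hqt (by rwa [h6, h2]), h6, h2], by rw [h8 r hrt (by rwa [h3]), h3], h7⟩

theorem exists_position (hu : u ∈ words n) {a : ℕ} (ha : a < n) : ∃ p < n, u p = a :=
  ⟨u⁻¹ a, (apply_lt_iff (inv_mem_words hu)).2 ha, by simp⟩

/-- Connectivity of a set of words is preserved by left translation. -/
theorem ConnectedOn.mul_left {Z : Set (Perm ℕ)} (g : Perm ℕ) (h : ConnectedOn (wordGraph n) Z) :
    ConnectedOn (wordGraph n) ((g⁻¹ * ·) ⁻¹' Z) := by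
  intro a ha b hb
  have := (h _ ha _ hb).map (Z' := (g⁻¹ * ·) ⁻¹' Z) (g * ·) fun u hu v hv huv =>
    JoinedWithin.single ((adj_mul_left g).2 huv) (by simpa using hu) (by simpa using hv)
  simpa using this

end Words

section Connectivity

open Equiv

variable {n m : ℕ} {u v w : Perm ℕ} {c d : ℕ}

/-- Deleting at most `2 n - 3` vertices isolates a vertex or leaves the graph connected. -/
def SuperConnected (n : ℕ) : Prop := ∀ D : Finset (Perm ℕ), #D ≤ 2 * n - 3 →
  (∃ v ∈ words n, v ∉ D ∧ nbrs n v ⊆ D) ∨ ConnectedOn (wordGraph n) (words n \ D)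

theorem SuperConnected.connectedOn (h : SuperConnected n) (hn : 3 ≤ n) (D : Finset (Perm ℕ))
    (hD : #D ≤ 2 * n - 4) : ConnectedOn (wordGraph n) (words n \ D) := by
  obtain ⟨v, -, -, hv⟩ | h := h D (by omega)
  · have := card_le_card hv
    rw [card_nbrs (by omega)] at this
    omega
  · exact h

theorem not_adj_of_adj_of_adj (huv : (wordGraph n).Adj u v) (huw : (wordGraph n).Adj u w) :
    ¬ (wordGraph n).Adj v w := by
  obtain ⟨s, hs, rfl⟩ := huv
  obtain ⟨t, ht, rfl⟩ := huw
  rintro ⟨r, hr, h⟩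
  rw [mul_assoc, mul_right_inj] at h
  exact mul_ne_of_mem_gens hs hr ht h.symm

theorem SuperConnected.connectedOn_of_adj (h : SuperConnected n) (hn : 2 ≤ n)
    (D : Finset (Perm ℕ)) (hD : #D ≤ 2 * n - 3) (hv : v ∈ D) (hw : w ∈ D)
    (hvw : (wordGraph n).Adj v w) : ConnectedOn (wordGraph n) (words n \ D) := by
  obtain ⟨u, -, -, hu⟩ | h := h D hD
  · have heq := eq_of_subset_of_card_le hu (by rwa [card_nbrs hn])
    rw [← heq, mem_nbrs] at hv hw
    exact absurd hvw (not_adj_of_adj_of_adj hv hw)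
  · exact h

theorem adj_toWord_three {σ τ : Perm (Fin 3)} (h : Perm.sign σ ≠ Perm.sign τ) :
    (wordGraph 3).Adj (toWord 3 σ) (toWord 3 τ) := by
  have : ∀ σ τ : Perm (Fin 3), Perm.sign σ ≠ Perm.sign τ →
      τ = σ * swap 0 1 ∨ τ = σ * swap 0 2 ∨ τ = σ * swap 1 2 := by decide
  obtain rfl | rfl | rfl := this σ τ h
  · rw [map_mul, toWord_swap]
    exact adj_star _ (by decide) (by decide)
  · rw [map_mul, toWord_swap]
    exact adj_star _ (by decide) (by decide)
  · rw [map_mul, toWord_swap]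
    exact adj_bubble _ (j := 1) (by decide) (by decide)

theorem sign_ne_of_adj_toWord {σ τ : Perm (Fin n)}
    (h : (wordGraph n).Adj (toWord n σ) (toWord n τ)) : Perm.sign σ ≠ Perm.sign τ := by
  obtain ⟨s, hs, h⟩ := h
  obtain ⟨a, b, hab, ha, hb, rfl⟩ := exists_swap_of_mem_gens hs
  have : swap a b = toWord n (swap ⟨a, ha⟩ ⟨b, hb⟩) :=
    (toWord_swap ⟨a, ha⟩ ⟨b, hb⟩).symm
  rw [this, ← map_mul] at h
  rw [toWord_injective n h, Perm.sign_mul, Perm.sign_swap (by simpa using hab)]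
  intro h
  rw [eq_comm, mul_neg_one] at h
  exact units_ne_neg_self _ h.symm

theorem superConnected_three : SuperConnected 3 := by
  intro D _
  by_contra! hcon
  obtain ⟨hnb, hcon⟩ := hcon
  refine hcon fun a ha b hb => ?_
  obtain ⟨w, hw, hwD⟩ := not_subset.1 (hnb a ha.1 ha.2)
  rw [mem_nbrs] at hw
  have hw3 := mem_words_of_adj hw ha.1
  obtain ⟨⟨ha3, haD⟩, hb3, hbD⟩ := ha, hb
  rw [← range_toWord] at ha3 hb3 hw3
  obtain ⟨σ, rfl⟩ := ha3
  obtain ⟨τ, rfl⟩ := hb3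
  obtain ⟨ρ, rfl⟩ := hw3
  have hmem : ∀ σ, toWord 3 σ ∉ D → toWord 3 σ ∈ words 3 \ (D : Set (Perm ℕ)) := fun σ h =>
    ⟨range_toWord 3 ▸ ⟨σ, rfl⟩, h⟩
  have h1 := sign_ne_of_adj_toWord hw
  by_cases h2 : Perm.sign σ = Perm.sign τ
  · exact (JoinedWithin.single hw (hmem _ haD) (hmem _ hwD)).trans
      (JoinedWithin.single (adj_toWord_three (h2 ▸ h1.symm)) (hmem _ hwD) (hmem _ hbD))
  · exact JoinedWithin.single (adj_toWord_three h2) (hmem _ haD) (hmem _ hbD)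

/-- The words on `m + 2` positions with last symbol `c`. -/
def cluster (m c : ℕ) : Set (Perm ℕ) := {u | u ∈ words (m + 2) ∧ u (m + 1) = c}

theorem finite_cluster (m c : ℕ) : (cluster m c).Finite := (finite_words _).subset fun _ h => h.1

theorem cluster_eq_preimage (hc : c < m + 2) :
    cluster m c = ((swap c (m + 1))⁻¹ * ·) ⁻¹' words (m + 1) := by
  ext u
  simp only [cluster, Set.mem_ofPred_eq, Set.mem_preimage, swap_inv]
  constructor
  · rintro ⟨hu, rfl⟩ p hp
    rcases hp.eq_or_lt with rfl | hp
    · simp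
    · rw [Perm.mul_apply, hu p (by omega)]
      exact swap_apply_of_ne_of_ne (by omega) (by omega)
  · intro hu
    have h : u = swap c (m + 1) * (swap c (m + 1) * u) := by
      rw [← mul_assoc, swap_mul_self, one_mul]
    refine ⟨?_, ?_⟩
    · rw [h]
      exact mul_mem_words (swap_mem_words hc (by omega)) (words_mono (by omega) hu)
    · rw [h, Perm.mul_apply, hu _ le_rfl, swap_apply_right]

theorem preimage_mul_diff (g : Perm ℕ) (Z : Set (Perm ℕ)) (D : Finset (Perm ℕ)) :
    ∃ D' : Finset (Perm ℕ), #D' = #D ∧ (∀ u, g⁻¹ * u ∈ D' ↔ u ∈ D) ∧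
      (g⁻¹ * ·) ⁻¹' (Z \ D') = ((g⁻¹ * ·) ⁻¹' Z) \ D := by
  classical
  have key : ∀ u, g⁻¹ * u ∈ D.image (g⁻¹ * ·) ↔ u ∈ D := by
    intro u
    simp
  refine ⟨D.image (g⁻¹ * ·), card_image_of_injective _ (mul_right_injective _), key, ?_⟩
  ext u
  simp only [Set.mem_preimage, Set.mem_sdiff, mem_coe, key]

theorem connectedOn_cluster (h : SuperConnected (m + 1)) (hm : 2 ≤ m) (hc : c < m + 2)
    (D : Finset (Perm ℕ)) (hD : #D ≤ 2 * m - 2) :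
    ConnectedOn (wordGraph (m + 1)) (cluster m c \ D) := by
  obtain ⟨D', hD', -, heq⟩ := preimage_mul_diff (swap c (m + 1)) (words (m + 1)) D
  rw [cluster_eq_preimage hc, ← heq]
  exact (h.connectedOn (by omega) D' (by omega)).mul_left _

theorem connectedOn_cluster_of_adj (h : SuperConnected (m + 1)) (hm : 2 ≤ m) (hc : c < m + 2)
    (D : Finset (Perm ℕ)) (hD : #D ≤ 2 * m - 1) (hv : v ∈ D) (hw : w ∈ D)
    (hvw : (wordGraph (m + 1)).Adj v w) :
    ConnectedOn (wordGraph (m + 1)) (cluster m c \ D) := by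
  obtain ⟨D', hD', hmem, heq⟩ := preimage_mul_diff (swap c (m + 1)) (words (m + 1)) D
  rw [cluster_eq_preimage hc, ← heq]
  exact (h.connectedOn_of_adj (by omega) D' (by omega) ((hmem v).2 hv) ((hmem w).2 hw)
    ((adj_mul_left _).2 hvw)).mul_left _

theorem star_mem_cluster (hu : u ∈ words (m + 2)) :
    u * swap 0 (m + 1) ∈ cluster m (u 0) :=
  ⟨mul_mem_words hu (swap_mem_words (by omega) (by omega)), by simp⟩

theorem bubble_mem_cluster (hu : u ∈ words (m + 2)) :
    u * swap m (m + 1) ∈ cluster m (u m) :=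
  ⟨mul_mem_words hu (swap_mem_words (by omega) (by omega)), by simp⟩

theorem mem_cluster_of_adj (h : (wordGraph (m + 1)).Adj u v) (hu : u ∈ cluster m c) :
    v ∈ cluster m c := by
  obtain ⟨s, hs, rfl⟩ := h
  exact ⟨mul_mem_words hu.1 (words_mono (by omega) (mem_words_of_mem_gens hs)), by
    rw [Perm.mul_apply, mem_words_of_mem_gens hs _ le_rfl, hu.2]⟩

/-- Two clusters stay linked after the deletion of fewer than `2 m` vertices. -/
theorem exists_link (hm : 2 ≤ m) (hc : c < m + 2) (hd : d < m + 2) (hcd : c ≠ d)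
    (C D : Finset (Perm ℕ)) (hCD : #C + #D < 2 * m) :
    ∃ u ∈ cluster m c, ∃ v ∈ cluster m d, u ∉ C ∧ v ∉ D ∧ (wordGraph (m + 2)).Adj u v := by
  classical
  obtain ⟨a, ha, ha0, ham⟩ := exists_word₂ (n := m + 2) (p := 0) (q := m + 1) (by omega) (by omega)
    hd hc (by omega) hcd.symm
  obtain ⟨b, hb, hbm, hbm'⟩ := exists_word₂ (n := m + 2) (p := m) (q := m + 1) (by omega)
    (by omega) hd hc (by omega) hcd.symm
  by_contra! hcon
  set E := (Icc 1 m).image (fun t => a * swap 1 t) with hE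
  set F := (range m).image (fun t => b * swap 0 t) with hF
  have hEcard : #E = m := by
    rw [hE, card_image_of_injOn, Nat.card_Icc, Nat.add_sub_cancel]
    intro s hs t ht hst
    simpa using congrArg (· 1) (mul_left_cancel hst)
  have hFcard : #F = m := by
    rw [hF, card_image_of_injOn, card_range]
    intro s hs t ht hst
    simpa using congrArg (· 0) (mul_left_cancel hst)
  have hEmem : ∀ u ∈ E, u ∈ cluster m c ∧ u 0 = d := by
    simp only [hE, mem_image, mem_Icc]
    rintro _ ⟨t, ht, rfl⟩
    refine ⟨⟨mul_mem_words ha (swap_mem_words (by omega) (by omega)), ?_⟩, ?_⟩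
    · rw [Perm.mul_apply, swap_apply_of_ne_of_ne (by omega) (by omega), ham]
    · rw [Perm.mul_apply, swap_apply_of_ne_of_ne (by omega) (by omega), ha0]
  have hFmem : ∀ u ∈ F, u ∈ cluster m c ∧ u m = d := by
    simp only [hF, mem_image, mem_range]
    rintro _ ⟨t, ht, rfl⟩
    refine ⟨⟨mul_mem_words hb (swap_mem_words (by omega) (by omega)), ?_⟩, ?_⟩
    · rw [Perm.mul_apply, swap_apply_of_ne_of_ne (by omega) (by omega), hbm']
    · rw [Perm.mul_apply, swap_apply_of_ne_of_ne (by omega) (by omega), hbm]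
  have hdis : Disjoint E F := by
    rw [disjoint_left]
    intro u hu hu'
    have := u.injective ((hEmem u hu).2.trans (hFmem u hu').2.symm)
    omega
  let back : Perm ℕ → Perm ℕ := fun v =>
    if v 0 = c then v * swap 0 (m + 1) else v * swap m (m + 1)
  have hsub : E ∪ F ⊆ C ∪ D.image back := by
    intro u hu
    rw [mem_union] at hu ⊢
    by_cases huC : u ∈ C
    · exact Or.inl huC
    right
    rw [mem_image]
    obtain hu | hu := hu
    · obtain ⟨h1, h2⟩ := hEmem u hu
      have h3 := star_mem_cluster h1.1
      rw [h2] at h3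
      refine ⟨u * swap 0 (m + 1), ?_, ?_⟩
      · by_contra hD
        exact hcon u h1 _ h3 huC hD (adj_star u (by omega) (by omega))
      · have : (u * swap 0 (m + 1)) 0 = c := by rw [Perm.mul_apply, swap_apply_left, h1.2]
        rw [show back (u * swap 0 (m + 1)) = _ from if_pos this, mul_assoc, swap_mul_self, mul_one]
    · obtain ⟨h1, h2⟩ := hFmem u hu
      have h3 := bubble_mem_cluster h1.1
      rw [h2] at h3
      refine ⟨u * swap m (m + 1), ?_, ?_⟩
      · by_contra hD
        exact hcon u h1 _ h3 huC hD (adj_bubble u (by omega) (by omega))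
      · have : (u * swap m (m + 1)) 0 ≠ c := by
          rw [Perm.mul_apply, swap_apply_of_ne_of_ne (by omega) (by omega), ← h1.2]
          exact fun h => by have := u.injective h; omega
        rw [show back (u * swap m (m + 1)) = _ from if_neg this, mul_assoc, swap_mul_self, mul_one]
  have h1 := card_le_card hsub
  rw [card_union_of_disjoint hdis, hEcard, hFcard] at h1
  have h2 := card_union_le C (D.image back)
  have h3 := card_image_le (s := D) (f := back)
  omega

theorem superConnected_succ (hm : 2 ≤ m) (h : SuperConnected (m + 1)) :
    SuperConnected (m + 2) := by
  classical
  intro D hD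
  by_contra! hcon
  obtain ⟨hnb, hcon⟩ := hcon
  let part : ℕ → Finset (Perm ℕ) := fun c => D.filter fun u => u (m + 1) = c
  have hparts : ∀ I : Finset ℕ, ∑ c ∈ I, #(part c) ≤ #D := by
    intro I
    rw [← card_biUnion]
    · exact card_le_card (biUnion_subset.2 fun c _ => filter_subset _ _)
    · intro c _ d _ hcd
      refine disjoint_left.2 fun u hu hu' => ?_
      exact hcd ((mem_filter.1 hu).2.symm.trans (mem_filter.1 hu').2)
  have hdiff : ∀ c, cluster m c \ (part c : Set (Perm ℕ)) = cluster m c \ (D : Set (Perm ℕ)) := by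
    intro c
    ext u
    simp only [Set.mem_sdiff, mem_coe, part, mem_filter, not_and]
    exact ⟨fun hu => ⟨hu.1, fun h => hu.2 h hu.1.2⟩, fun hu => ⟨hu.1, fun h => absurd h hu.2⟩⟩
  have hgood : ∀ c < m + 2, #(part c) ≤ 2 * m - 2 →
      ConnectedOn (wordGraph (m + 2)) (cluster m c \ (D : Set (Perm ℕ))) := by
    intro c hc hcD
    rw [← hdiff]
    exact (connectedOn_cluster h hm hc _ hcD).mono (wordGraph_mono (by omega))
  let I : Set ℕ := {c | c < m + 2 ∧ #(part c) ≤ 2 * m - 2}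
  have hlink : ∀ c < m + 2, ∀ d < m + 2, c ≠ d → #(part c) + #(part d) < 2 * m →
      ∃ u ∈ cluster m c \ (D : Set (Perm ℕ)), ∃ v ∈ cluster m d \ (D : Set (Perm ℕ)),
        (wordGraph (m + 2)).Adj u v ∨ u = v := by
    intro c hc d hd hcd hlt
    obtain ⟨u, hu, v, hv, huC, hvD, huv⟩ := exists_link hm hc hd hcd _ _ hlt
    refine ⟨u, ?_, v, ?_, Or.inl huv⟩
    · rw [← hdiff]; exact ⟨hu, huC⟩
    · rw [← hdiff]; exact ⟨hv, hvD⟩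
  have hU : ConnectedOn (wordGraph (m + 2)) (⋃ c ∈ I, cluster m c \ (D : Set (Perm ℕ))) := by
    refine ConnectedOn.biUnion_of_links (fun c hc => hgood c hc.1 hc.2) fun c hc d hd => ?_
    by_cases hcd : c = d
    · subst hcd
      exact Relation.ReflTransGen.refl
    by_cases hlt : #(part c) + #(part d) < 2 * m
    · exact Relation.ReflTransGen.single ⟨hc, hd, hlink c hc.1 d hd.1 hcd hlt⟩
    · obtain ⟨e, he, hec, hed⟩ : ∃ e < m + 2, e ≠ c ∧ e ≠ d := by
        by_contra! hcon
        have h0 := hcon 0 (by omega)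
        have h1 := hcon 1 (by omega)
        have h2 := hcon 2 (by omega)
        omega
      have h3 := hparts {c, d, e}
      rw [sum_insert (by simp [hcd, hec.symm]), sum_insert (by simp [hed.symm]),
        sum_singleton] at h3
      have hcm := hc.2
      have hdm := hd.2
      have heI : e ∈ I := ⟨he, by omega⟩
      exact (Relation.ReflTransGen.single ⟨hc, heI, hlink c hc.1 e he hec.symm (by omega)⟩).tail
        ⟨heI, hd, hlink e he d hd.1 hed (by omega)⟩
  have hUsub : (⋃ c ∈ I, cluster m c \ (D : Set (Perm ℕ))) ⊆ words (m + 2) \ D := by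
    simp only [Set.iUnion_subset_iff]
    exact fun c _ u hu => ⟨hu.1.1, hu.2⟩
  have hbad : ∀ c < m + 2, ∀ d < m + 2, c ≠ d → 2 * m - 1 ≤ #(part c) → d ∈ I := by
    intro c hc d hd hcd hcm
    have h3 := hparts {c, d}
    rw [sum_pair hcd] at h3
    exact ⟨hd, by omega⟩
  have hmem : ∀ u ∈ words (m + 2), u (m + 1) ∈ I → u ∉ D →
      u ∈ ⋃ c ∈ I, cluster m c \ (D : Set (Perm ℕ)) := by
    intro u hu huI huD
    simp only [Set.mem_iUnion]
    exact ⟨_, huI, ⟨hu, rfl⟩, huD⟩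
  have hmemD : ∀ {u : Perm ℕ}, u ∈ words (m + 2) → u ∉ D →
      u ∈ words (m + 2) \ (D : Set (Perm ℕ)) := fun hu hD => ⟨hu, hD⟩
  have key : ∀ u ∈ words (m + 2), u ∉ D → ∃ v ∈ ⋃ c ∈ I, cluster m c \ (D : Set (Perm ℕ)),
      JoinedWithin (wordGraph (m + 2)) (words (m + 2) \ D) v u := by
    intro u hu huD
    by_cases huI : u (m + 1) ∈ I
    · exact ⟨u, hmem u hu huI huD, JoinedWithin.refl _⟩
    have hlt : ∀ {u : Perm ℕ}, u ∈ words (m + 2) → ∀ p < m + 2, u p < m + 2 :=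
      fun hu p hp => (apply_lt_iff hu).2 hp
    have hum : 2 * m - 1 ≤ #(part (u (m + 1))) := by
      by_contra hlt'
      exact huI ⟨hlt hu _ (by omega), by omega⟩
    have hstar : ∀ v ∈ words (m + 2), v (m + 1) = u (m + 1) → v * swap 0 (m + 1) ∉ D →
        v * swap 0 (m + 1) ∈ ⋃ c ∈ I, cluster m c \ (D : Set (Perm ℕ)) := by
      intro v hv hvu hvD
      have h1 := star_mem_cluster hv
      refine hmem _ h1.1 ?_ hvD
      rw [h1.2]
      refine hbad _ (hlt hu _ (by omega)) _ (hlt hv _ (by omega)) ?_ hum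
      rw [← hvu]
      exact fun h => by have := v.injective h; omega
    by_cases hu1 : u * swap 0 (m + 1) ∈ D
    swap
    · exact ⟨_, hstar u hu rfl hu1, (JoinedWithin.single (adj_star u (by omega) (by omega))
        (hmemD hu huD) (hUsub (hstar u hu rfl hu1))).symm⟩
    by_cases hu2 : u * swap m (m + 1) ∈ D
    swap
    · have h1 := bubble_mem_cluster hu
      have h2 : u * swap m (m + 1) ∈ ⋃ c ∈ I, cluster m c \ (D : Set (Perm ℕ)) := by
        refine hmem _ h1.1 ?_ hu2
        rw [h1.2]
        refine hbad _ (hlt hu _ (by omega)) _ (hlt hu _ (by omega)) ?_ hum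
        exact fun h => by have := u.injective h; omega
      exact ⟨_, h2, (JoinedWithin.single (adj_bubble u (by omega) (by omega))
        (hmemD hu huD) (hUsub h2)).symm⟩
    obtain ⟨w, hw, hwD⟩ := not_subset.1 (hnb u hu huD)
    rw [mem_nbrs] at hw
    have hw' : (wordGraph (m + 1)).Adj u w := by
      obtain ⟨s, hs, rfl⟩ := hw
      obtain ⟨i, h1, h2, rfl⟩ | ⟨j, h1, h2, rfl⟩ := mem_gens.1 hs
      · have : i ≠ m + 1 := by
          rintro rfl
          exact hwD hu1
        exact adj_star _ h1 (by omega)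
      · have : j ≠ m := by
          rintro rfl
          exact hwD hu2
        exact adj_bubble _ h1 (by omega)
    have hwC := mem_cluster_of_adj hw' ⟨hu, rfl⟩
    have hw1 : w * swap 0 (m + 1) ∉ D := by
      intro hw1
      have hne1 : u * swap 0 (m + 1) ≠ u * swap m (m + 1) := by
        intro h
        rw [mul_right_inj, swap_eq_swap_iff (by omega)] at h
        omega
      have hne2 : u * swap 0 (m + 1) ≠ w * swap 0 (m + 1) := by
        intro h
        rw [mul_left_inj] at h
        exact hw.ne h
      have hne3 : u * swap m (m + 1) ≠ w * swap 0 (m + 1) := by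
        intro h
        exact not_adj_of_adj_of_adj hw (adj_bubble u (by omega) (by omega))
          (h ▸ adj_star w (by omega) (by omega))
      have hsub : part (u (m + 1)) ∪ {u * swap 0 (m + 1), u * swap m (m + 1),
          w * swap 0 (m + 1)} ⊆ D := by
        rw [union_subset_iff]
        refine ⟨filter_subset _ _, ?_⟩
        simp only [insert_subset_iff, singleton_subset_iff]
        exact ⟨hu1, hu2, hw1⟩
      have hcard := card_le_card hsub
      rw [card_union_of_disjoint, card_insert_of_notMem (by simp [hne1, hne2]),
        card_insert_of_notMem (by simp [hne3]), card_singleton] at hcard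
      · omega
      · rw [disjoint_right]
        simp only [mem_insert, mem_singleton, part, mem_filter, not_and]
        rintro v (rfl | rfl | rfl) -
        · rw [(star_mem_cluster hu).2]
          exact fun h => by have := u.injective h; omega
        · rw [(bubble_mem_cluster hu).2]
          exact fun h => by have := u.injective h; omega
        · rw [(star_mem_cluster hwC.1).2, ← hwC.2]
          exact fun h => by have := w.injective h; omega
    exact ⟨_, hstar w hwC.1 hwC.2 hw1, ((JoinedWithin.single hw
      (hmemD hu huD) (hmemD hwC.1 hwD)).trans
      (JoinedWithin.single (adj_star w (by omega) (by omega)) (hmemD hwC.1 hwD)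
        (hUsub (hstar w hwC.1 hwC.2 hw1)))).symm⟩
  refine hcon fun a ha b hb => ?_
  obtain ⟨a', ha', haa⟩ := key a ha.1 ha.2
  obtain ⟨b', hb', hbb⟩ := key b hb.1 hb.2
  exact haa.symm.trans (((hU a' ha' b' hb').mono le_rfl hUsub).trans hbb)

theorem superConnected (hn : 3 ≤ n) : SuperConnected n := by
  induction n, hn using Nat.le_induction with
  | base => exact superConnected_three
  | succ n hn ih =>
    obtain ⟨m, rfl⟩ : ∃ m, n = m + 1 := ⟨n - 1, by omega⟩
    exact superConnected_succ (by omega) ih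

end Connectivity

section Packing

variable {V : Type*} {G H : SimpleGraph V} {K L S : Set V} {r : ℕ}

/-- `r` disjoint subsets of `K`, away from `S`, all but one of which are connected and adjacent to
every vertex of `S`; the exceptional one is only required to be connected together with `S`. -/
def HasPacking (G : SimpleGraph V) (K S : Set V) (r : ℕ) : Prop :=
  ∃ (ι : Type) (T : ι → Set V) (a₀ : ι), Nat.card ι = r ∧ (∀ a, T a ⊆ K) ∧
    (∀ a, Disjoint (T a) S) ∧ (∀ a b, a ≠ b → Disjoint (T a) (T b)) ∧
    (∀ a, a ≠ a₀ → ConnectedOn G (T a) ∧ ∀ s ∈ S, ∃ t ∈ T a, G.Adj s t) ∧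
    ConnectedOn G (T a₀ ∪ S)

theorem HasPacking.add_two (h : HasPacking G K S r) (hr : 0 < r) (hG : G ≤ H) (hK : K ⊆ L)
    {A B : Set V} (hA : ConnectedOn H A) (hB : ConnectedOn H B) (hAL : A ⊆ L) (hBL : B ⊆ L)
    (hAK : Disjoint A K) (hBK : Disjoint B K) (hAB : Disjoint A B) (hSK : S ⊆ K)
    (hSA : ∀ s ∈ S, ∃ t ∈ A, H.Adj s t) (hSB : ∀ s ∈ S, ∃ t ∈ B, H.Adj s t) :
    HasPacking H L S (r + 2) := by
  obtain ⟨ι, T, a₀, hι, hTK, hTS, hT, hT1, hT0⟩ := h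
  have : Finite ι := Nat.finite_of_card_ne_zero (by omega)
  refine ⟨ι ⊕ Bool, Sum.elim T fun b => bif b then A else B, Sum.inl a₀, ?_, ?_, ?_, ?_, ?_, ?_⟩
  · rw [Nat.card_sum, hι, Nat.card_eq_fintype_card, Fintype.card_bool]
  · rintro (a | _ | _)
    exacts [(hTK a).trans hK, hBL, hAL]
  · rintro (a | _ | _)
    exacts [hTS a, hBK.mono_right hSK, hAK.mono_right hSK]
  · rintro (a | _ | _) (b | _ | _) hab
    exacts [hT a b (by simpa using hab), (hBK.mono_right (hTK a)).symm,
      (hAK.mono_right (hTK a)).symm, hBK.mono_right (hTK b), absurd rfl hab, hAB.symm,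
      hAK.mono_right (hTK b), hAB, absurd rfl hab]
  · rintro (a | _ | _) ha
    · obtain ⟨h1, h2⟩ := hT1 a (by simpa using ha)
      refine ⟨h1.mono hG, fun s hs => ?_⟩
      obtain ⟨t, ht, hst⟩ := h2 s hs
      exact ⟨t, ht, hG hst⟩
    exacts [⟨hB, hSB⟩, ⟨hA, hSA⟩]
  · exact hT0.mono hG

end Packing

section Inside

open Equiv

variable {n m i : ℕ} {u v x y z : Perm ℕ}

theorem HasPacking.mul_left {K S : Set (Perm ℕ)} {r : ℕ} (g : Perm ℕ)
    (h : HasPacking (wordGraph n) K S r) :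
    HasPacking (wordGraph n) ((g⁻¹ * ·) ⁻¹' K) ((g⁻¹ * ·) ⁻¹' S) r := by
  obtain ⟨ι, T, a₀, hι, hTK, hTS, hT, hT1, hT0⟩ := h
  refine ⟨ι, fun a => (g⁻¹ * ·) ⁻¹' T a, a₀, hι, fun a => Set.preimage_mono (hTK a),
    fun a => (hTS a).preimage _, fun a b hab => (hT a b hab).preimage _, fun a ha => ?_,
    hT0.mul_left g⟩
  refine ⟨(hT1 a ha).1.mul_left g, fun s hs => ?_⟩
  obtain ⟨t, ht, hst⟩ := (hT1 a ha).2 _ hs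
  exact ⟨g * t, by simpa using ht, by rwa [← adj_mul_left g⁻¹, inv_mul_cancel_left]⟩

/-- Any three words on `n` positions are connected by `2 n - 4` internally disjoint trees. -/
def TriplyConnected (n : ℕ) : Prop := ∀ x ∈ words n, ∀ y ∈ words n, ∀ z ∈ words n,
  x ≠ y → x ≠ z → y ≠ z → HasPacking (wordGraph n) (words n) {x, y, z} (2 * n - 4)

theorem mul_swap_apply (u : Perm ℕ) (a b p : ℕ) :
    (u * swap a b) p = if p = a then u b else if p = b then u a else u p := by
  rw [Perm.mul_apply, swap_apply_def]
  split_ifs <;> rfl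

theorem apply_ne (u : Perm ℕ) {p q : ℕ} (h : p ≠ q) : u p ≠ u q := u.injective.ne h

theorem apply_lt (hu : u ∈ words n) {p : ℕ} (hp : p < n) : u p < n := (apply_lt_iff hu).2 hp

/-- The clusters with index in a given set span a connected subgraph. -/
theorem connectedOn_clusters (hm : 2 ≤ m) (I : Set ℕ) (hI : ∀ c ∈ I, c < m + 2) :
    ConnectedOn (wordGraph (m + 2)) (⋃ c ∈ I, cluster m c) := by
  refine ConnectedOn.biUnion_of_links (fun c hc => ?_) fun c hc d hd => ?_
  · have := connectedOn_cluster (superConnected (by omega)) hm (hI c hc) ∅ (by simp)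
    rw [coe_empty, Set.sdiff_empty] at this
    exact this.mono (wordGraph_mono (by omega))
  · by_cases hcd : c = d
    · subst hcd
      exact Relation.ReflTransGen.refl
    · obtain ⟨u, hu, v, hv, -, -, huv⟩ := exists_link hm (hI c hc) (hI d hd) hcd ∅ ∅
        (by simp; omega)
      exact Relation.ReflTransGen.single ⟨hc, hd, u, hu, v, hv, Or.inl huv⟩

theorem exists_outer (hu : u ∈ words (m + 2)) {c : ℕ} (hc : u 0 = c ∨ u m = c) :
    ∃ v ∈ cluster m c, (wordGraph (m + 2)).Adj u v := by
  obtain rfl | rfl := hc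
  · exact ⟨_, star_mem_cluster hu, adj_star u (by omega) (by omega)⟩
  · by_cases hm : m = 0
    · subst hm
      exact ⟨_, star_mem_cluster hu, adj_star u (by omega) (by omega)⟩
    · exact ⟨_, bubble_mem_cluster hu, adj_bubble u (by omega) (by omega)⟩

theorem exists_split (a a' b b' c c' : ℕ) (ha : a ≠ a') (hb : b ≠ b') (hc : c ≠ c') :
    (∃ T : Set ℕ, (a ∈ T ↔ a' ∉ T) ∧ (b ∈ T ↔ b' ∉ T) ∧ (c ∈ T ↔ c' ∉ T)) ∨
      ∃ p, p ≠ b ∧ p ≠ b' ∧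
        (((a = p ∨ a' = p) ∧ (a = b ∨ a' = b) ∧ (c = p ∨ c' = p) ∧ (c = b' ∨ c' = b')) ∨
        ((c = p ∨ c' = p) ∧ (c = b ∨ c' = b) ∧ (a = p ∨ a' = p) ∧ (a = b' ∨ a' = b'))) := by
  by_contra! hcon
  obtain ⟨h1, h2⟩ := hcon
  have e1 := h1 {a, b, c}
  have e2 := h1 {a, b, c'}
  have e3 := h1 {a, b', c}
  have e4 := h1 {a, b', c'}
  have e5 := h2 a
  have e6 := h2 a'
  clear h1 h2
  simp [ha.symm, hb.symm, hc.symm] at e1 e2 e3 e4 e5 e6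
  grind

theorem hasPacking_of_split (hm : 2 ≤ m) (ih : TriplyConnected (m + 1)) (hi : i < m + 2)
    (hx : x ∈ cluster m i) (hy : y ∈ cluster m i) (hz : z ∈ cluster m i) (hxy : x ≠ y)
    (hxz : x ≠ z) (hyz : y ≠ z) {A B : Set (Perm ℕ)} (hA : ConnectedOn (wordGraph (m + 2)) A)
    (hB : ConnectedOn (wordGraph (m + 2)) B) (hAi : ∀ u ∈ A, u ∈ words (m + 2) ∧ u (m + 1) ≠ i)
    (hBi : ∀ u ∈ B, u ∈ words (m + 2) ∧ u (m + 1) ≠ i) (hAB : Disjoint A B)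
    (hSA : ∀ s ∈ ({x, y, z} : Set (Perm ℕ)), ∃ t ∈ A, (wordGraph (m + 2)).Adj s t)
    (hSB : ∀ s ∈ ({x, y, z} : Set (Perm ℕ)), ∃ t ∈ B, (wordGraph (m + 2)).Adj s t) :
    HasPacking (wordGraph (m + 2)) (words (m + 2)) {x, y, z} (2 * (m + 2) - 4) := by
  have hin : HasPacking (wordGraph (m + 1)) (cluster m i) {x, y, z} (2 * (m + 1) - 4) := by
    have hmem := cluster_eq_preimage hi
    set g := swap i (m + 1)
    have := (ih (g⁻¹ * x) (by rwa [hmem] at hx) (g⁻¹ * y) (by rwa [hmem] at hy) (g⁻¹ * z)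
      (by rwa [hmem] at hz) (by simpa) (by simpa) (by simpa)).mul_left g
    rw [← hmem] at this
    convert this using 1
    ext u
    simp
  rw [show 2 * (m + 2) - 4 = 2 * (m + 1) - 4 + 2 by omega]
  refine hin.add_two (by omega) (wordGraph_mono (by omega)) (fun u hu => hu.1) hA hB
    (fun u hu => (hAi u hu).1) (fun u hu => (hBi u hu).1) ?_ ?_ hAB ?_ hSA hSB
  · exact Set.disjoint_left.2 fun u hu hu' => (hAi u hu).2 hu'.2
  · exact Set.disjoint_left.2 fun u hu hu' => (hBi u hu).2 hu'.2
  · rintro u (rfl | rfl | rfl) <;> assumption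

theorem hasPacking_of_triangle (hm : 2 ≤ m) (ih : TriplyConnected (m + 1)) (hi : i < m + 2)
    (hx : x ∈ cluster m i) (hy : y ∈ cluster m i) (hz : z ∈ cluster m i) (hxy : x ≠ y)
    (hxz : x ≠ z) (hyz : y ≠ z) {p : ℕ} (hp0 : p ≠ y 0) (hpm : p ≠ y m)
    (hxp : x 0 = p ∨ x m = p) (hxq : x 0 = y 0 ∨ x m = y 0) (hzp : z 0 = p ∨ z m = p)
    (hzr : z 0 = y m ∨ z m = y m) :
    HasPacking (wordGraph (m + 2)) (words (m + 2)) {x, y, z} (2 * (m + 2) - 4) := by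
  classical
  have hlast : ∀ {u : Perm ℕ}, u ∈ cluster m i → u 0 ≠ i ∧ u m ≠ i := fun hu => by
    rw [← hu.2]
    exact ⟨apply_ne _ (by omega), apply_ne _ (by omega)⟩
  have h0m : y 0 ≠ y m := apply_ne _ (by omega)
  have hpi : p ≠ i := by
    obtain rfl | rfl := hxp
    exacts [(hlast hx).1, (hlast hx).2]
  have hpn : p < m + 2 := by
    obtain rfl | rfl := hxp
    exacts [apply_lt hx.1 (by omega), apply_lt hx.1 (by omega)]
  have h0n : y 0 < m + 2 := apply_lt hy.1 (by omega)
  have hmn : y m < m + 2 := apply_lt hy.1 (by omega)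
  have hyi := hlast hy
  have hy2 := hy.2
  set y' := y * swap 0 (m + 1) with hy'
  have hy'c : y' ∈ cluster m (y 0) := star_mem_cluster hy.1
  have hv : ∀ p, y' p = if p = 0 then i else if p = m + 1 then y 0 else y p := by
    intro p
    rw [hy', mul_swap_apply, hy2]
  obtain ⟨t, htn, ht⟩ := exists_position hy'c.1 hpn
  have ht' := ht
  rw [hv] at ht'
  have ht0 : t ≠ 0 := by rintro rfl; simp at ht'; omega
  have htm : t ≠ m := by
    rintro rfl
    rw [if_neg ht0, if_neg (by omega)] at ht'
    omega
  have htm' : t ≠ m + 1 := by rintro rfl; simp at ht'; omega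
  set w := y' * swap 0 t with hw
  have hyw : (wordGraph (m + 1)).Adj y' w := adj_star _ (by omega) (by omega)
  have hwc : w ∈ cluster m (y 0) := mem_cluster_of_adj hyw hy'c
  have hw0 : w 0 = p := by rw [hw, mul_swap_apply, if_pos rfl, ht]
  have hwm : w m = y m := by
    rw [hw, mul_swap_apply, if_neg (by omega), if_neg (by omega), hv, if_neg (by omega),
      if_neg (by omega)]
  have hy'm : y' m = y m := by
    rw [hv, if_neg (by omega), if_neg (by omega)]
  have hcl : ∀ c < m + 2, ConnectedOn (wordGraph (m + 2)) (cluster m c) := fun c hc => by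
    have := connectedOn_clusters hm {c} (by simpa)
    simpa using this
  obtain ⟨w', hw'c, hww'⟩ := exists_outer hwc.1 (Or.inl hw0)
  have hcard : #{y', w} ≤ 2 := card_le_two
  have hq : ConnectedOn (wordGraph (m + 2)) (cluster m (y 0) \ {y', w}) := by
    have := connectedOn_cluster (superConnected (by omega)) hm h0n {y', w} (by omega)
    rw [coe_pair] at this
    exact this.mono (wordGraph_mono (by omega))
  obtain ⟨a, ha, b, hb, -, hbD, hab⟩ := exists_link hm hmn h0n h0m.symm ∅ {y', w} (by simp; omega)
  have hA := ((hcl p hpn).insert_of_adj hw'c hww').insert_of_adj (Or.inl rfl)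
    (wordGraph_mono (by omega) hyw)
  have hB := (hcl (y m) hmn).union_of_adj hq ha ⟨hb, by simpa using hbD⟩ hab
  refine hasPacking_of_split hm ih hi hx hy hz hxy hxz hyz hA hB ?_ ?_ ?_ ?_ ?_
  · rintro u (rfl | rfl | hu)
    exacts [⟨hy'c.1, by rw [hy'c.2]; exact hyi.1⟩, ⟨hwc.1, by rw [hwc.2]; exact hyi.1⟩,
      ⟨hu.1, by rw [hu.2]; exact hpi⟩]
  · rintro u (hu | hu)
    exacts [⟨hu.1, by rw [hu.2]; exact hyi.2⟩, ⟨hu.1.1, by rw [hu.1.2]; exact hyi.1⟩]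
  · rw [Set.disjoint_left]
    rintro u (rfl | rfl | hu) (hu' | hu')
    · exact h0m (hy'c.2.symm.trans hu'.2)
    · exact hu'.2 (Or.inl rfl)
    · exact h0m (hwc.2.symm.trans hu'.2)
    · exact hu'.2 (Or.inr rfl)
    · exact hpm (hu.2.symm.trans hu'.2)
    · exact hp0 (hu.2.symm.trans hu'.1.2)
  · rintro s (rfl | rfl | rfl)
    · obtain ⟨v, hv, hxv⟩ := exists_outer hx.1 hxp
      exact ⟨v, Or.inr (Or.inr hv), hxv⟩
    · exact ⟨y', Or.inl rfl, adj_star _ (by omega) (by omega)⟩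
    · obtain ⟨v, hv, hxv⟩ := exists_outer hz.1 hzp
      exact ⟨v, Or.inr (Or.inr hv), hxv⟩
  · rintro s (rfl | rfl | rfl)
    · obtain hxq | hxq := hxq
      · refine ⟨s * swap 0 (m + 1), Or.inr ⟨hxq ▸ star_mem_cluster hx.1, ?_⟩,
          adj_star _ (by omega) (by omega)⟩
        rintro (h | h)
        · exact hxy (mul_right_cancel h)
        · have := congrArg (· 0) h
          simp only [mul_swap_apply s, if_true, hw0, hx.2] at this
          exact hpi this.symm
      · have hm' : (s * swap m (m + 1)) m = i := by
          rw [mul_swap_apply, if_pos rfl, hx.2]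
        refine ⟨s * swap m (m + 1), Or.inr ⟨hxq ▸ bubble_mem_cluster hx.1, ?_⟩,
          adj_bubble _ (by omega) (by omega)⟩
        rintro (h | h)
        · rw [h, hy'm] at hm'
          exact hyi.2 hm'
        · rw [h, hwm] at hm'
          exact hyi.2 hm'
    · obtain ⟨v, hv, hxv⟩ := exists_outer hy.1 (Or.inr rfl)
      exact ⟨v, Or.inl hv, hxv⟩
    · obtain ⟨v, hv, hxv⟩ := exists_outer hz.1 hzr
      exact ⟨v, Or.inl hv, hxv⟩

/-- Three words with the same last symbol. -/
theorem hasPacking_of_same_cluster (hm : 2 ≤ m) (ih : TriplyConnected (m + 1)) (hi : i < m + 2)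
    (hx : x ∈ cluster m i) (hy : y ∈ cluster m i) (hz : z ∈ cluster m i) (hxy : x ≠ y)
    (hxz : x ≠ z) (hyz : y ≠ z) :
    HasPacking (wordGraph (m + 2)) (words (m + 2)) {x, y, z} (2 * (m + 2) - 4) := by
  have h0m : ∀ u : Perm ℕ, u 0 ≠ u m := fun u => apply_ne u (by omega)
  obtain ⟨T, hTx, hTy, hTz⟩ | ⟨p, hp0, hpm, ⟨h1, h2, h3, h4⟩ | ⟨h1, h2, h3, h4⟩⟩ :=
    exists_split _ _ _ _ _ _ (h0m x) (h0m y) (h0m z)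
  · have key : ∀ T : Set ℕ, (x 0 ∈ T ↔ x m ∉ T) → (y 0 ∈ T ↔ y m ∉ T) → (z 0 ∈ T ↔ z m ∉ T) →
        ∀ s ∈ ({x, y, z} : Set (Perm ℕ)), ∃ t ∈ ⋃ c ∈ {c | c < m + 2 ∧ c ≠ i ∧ c ∈ T},
          cluster m c, (wordGraph (m + 2)).Adj s t := by
      intro T hTx hTy hTz s hs
      have hs' : s ∈ cluster m i ∧ (s 0 ∈ T ↔ s m ∉ T) := by
        obtain rfl | rfl | rfl := hs
        exacts [⟨hx, hTx⟩, ⟨hy, hTy⟩, ⟨hz, hTz⟩]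
      obtain ⟨⟨hsn, rfl⟩, hT⟩ := hs'
      by_cases h0 : s 0 ∈ T
      · obtain ⟨v, hv, hsv⟩ := exists_outer hsn (Or.inl rfl)
        exact ⟨v, Set.mem_biUnion (x := s 0) ⟨apply_lt hsn (by omega), apply_ne _ (by omega), h0⟩
          hv, hsv⟩
      · obtain ⟨v, hv, hsv⟩ := exists_outer hsn (Or.inr rfl)
        exact ⟨v, Set.mem_biUnion (x := s m) ⟨apply_lt hsn (by omega), apply_ne _ (by omega),
          by tauto⟩ hv, hsv⟩
    refine hasPacking_of_split hm ih hi hx hy hz hxy hxz hyz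
      (connectedOn_clusters hm {c | c < m + 2 ∧ c ≠ i ∧ c ∈ T} fun c hc => hc.1)
      (connectedOn_clusters hm {c | c < m + 2 ∧ c ≠ i ∧ c ∈ Tᶜ} fun c hc => hc.1)
      ?_ ?_ ?_ (key T hTx hTy hTz) (key Tᶜ ?_ ?_ ?_)
    · simp only [Set.mem_iUnion]
      rintro u ⟨c, hc, hu⟩
      exact ⟨hu.1, hu.2 ▸ hc.2.1⟩
    · simp only [Set.mem_iUnion]
      rintro u ⟨c, hc, hu⟩
      exact ⟨hu.1, hu.2 ▸ hc.2.1⟩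
    · simp only [Set.disjoint_left, Set.mem_iUnion]
      rintro u ⟨c, hc, hu⟩ ⟨d, hd, hu'⟩
      exact hd.2.2 (hu'.2 ▸ hu.2 ▸ hc.2.2)
    all_goals simp only [Set.mem_compl_iff]; tauto
  · exact hasPacking_of_triangle hm ih hi hx hy hz hxy hxz hyz hp0 hpm h1 h2 h3 h4
  · have := hasPacking_of_triangle hm ih hi hz hy hx hyz.symm hxz.symm hxy.symm hp0 hpm h1 h2 h3 h4
    rwa [Set.insert_comm z y, Set.pair_comm z x, Set.insert_comm y x] at this

end Inside

section TwoClusters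

open Equiv

variable {m i j c : ℕ} {u v x y z : Perm ℕ}

/-- Disjoint paths inside a cluster from a word to at most `2 m - 1` others. -/
theorem exists_fan_cluster (hm : 2 ≤ m) (hc : c < m + 2) (hy : y ∈ cluster m c)
    (B : Finset (Perm ℕ)) (hBC : ↑B ⊆ cluster m c) (hyB : y ∉ B) (hB : #B ≤ 2 * m - 1) :
    ∃ P : Perm ℕ → Set (Perm ℕ), (∀ b ∈ B, b ∈ P b ∧ P b ⊆ cluster m c ∧
      ConnectedOn (wordGraph (m + 1)) (P b) ∧ y ∉ P b ∧ ∃ u ∈ P b, (wordGraph (m + 1)).Adj y u) ∧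
      ∀ b ∈ B, ∀ b' ∈ B, b ≠ b' → Disjoint (P b) (P b') := by
  classical
  refine exists_fan _ (finite_cluster m c) y B hBC hyB fun D hyD hD => ?_
  obtain ⟨b, hb, hbD⟩ := exists_mem_notMem_of_card_lt_card hD
  exact ⟨b, hb, hbD, connectedOn_cluster (superConnected (by omega)) hm hc D (by omega) y
    ⟨hy, hyD⟩ b ⟨hBC hb, hbD⟩⟩

/-- Disjoint paths inside a cluster from `y` to the neighbours of `x` that avoid `x`. -/
theorem exists_fan_nbrs (hm : 2 ≤ m) (hc : c < m + 2) (hx : x ∈ cluster m c)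
    (hy : y ∈ cluster m c) (hxy : x ≠ y) :
    ∃ P : Perm ℕ → Set (Perm ℕ), (∀ b ∈ nbrs (m + 1) x, b ≠ y → b ∈ P b ∧
      P b ⊆ cluster m c \ {x} ∧ ConnectedOn (wordGraph (m + 1)) (P b) ∧ y ∉ P b ∧
      ∃ u ∈ P b, (wordGraph (m + 1)).Adj y u) ∧
      ∀ b ∈ nbrs (m + 1) x, ∀ b' ∈ nbrs (m + 1) x, b ≠ y → b' ≠ y → b ≠ b' →
        Disjoint (P b) (P b') := by
  classical
  have hN : ∀ b ∈ nbrs (m + 1) x, b ∈ cluster m c \ {x} := fun b hb =>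
    ⟨mem_cluster_of_adj (mem_nbrs.1 hb) hx, (mem_nbrs.1 hb).ne'⟩
  have hκ := fun D hD => connectedOn_cluster (superConnected (by omega)) hm hc D hD
  have hcard := card_nbrs (n := m + 1) (by omega) x
  have key : ∀ D : Finset (Perm ℕ), y ∉ D → #D < #((nbrs (m + 1) x).erase y) →
      ∃ b ∈ (nbrs (m + 1) x).erase y, b ∉ D ∧
        JoinedWithin (wordGraph (m + 1)) ((cluster m c \ {x}) \ D) y b := by
    intro D hyD hD
    by_cases hyN : y ∈ nbrs (m + 1) x
    · obtain ⟨b, hb, hbD⟩ := exists_mem_notMem_of_card_lt_card hD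
      refine ⟨b, hb, hbD, ?_⟩
      rw [card_erase_of_mem hyN] at hD
      have h1 := card_insert_le x D
      have := hκ (insert x D) (by omega) y ⟨hy, by simp [hxy.symm, hyD]⟩ b
        ⟨(hN b (mem_of_mem_erase hb)).1, by simpa [hbD] using (hN b (mem_of_mem_erase hb)).2⟩
      rwa [coe_insert, Set.insert_eq, ← Set.sdiff_sdiff] at this
    · rw [erase_eq_of_notMem hyN] at hD ⊢
      have h1 := card_erase_le (s := D) (a := x)
      obtain ⟨b, hxb, hb, hbx, hby⟩ := (hκ (D.erase x) (by omega) x ⟨hx, by simp⟩ y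
        ⟨hy, by simp [hyD]⟩).exists_adj_start hxy
      refine ⟨b, mem_nbrs.2 hxb, fun hbD => hb.2 (by simp [hbx, hbD]), ?_⟩
      refine hby.symm.mono le_rfl ?_
      rintro v ⟨⟨h1, h2⟩, h3⟩
      exact ⟨⟨h1, h3⟩, fun h => h2 (mem_coe.2 (mem_erase.2 ⟨h3, h⟩))⟩
  obtain ⟨P, hP, hPd⟩ := exists_fan (wordGraph (m + 1)) (C := cluster m c \ {x})
    ((finite_cluster m c).subset Set.sdiff_subset) y ((nbrs (m + 1) x).erase y)
    (fun b hb => hN b (mem_of_mem_erase hb)) (notMem_erase _ _) key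
  refine ⟨P, fun b hb hby => ?_, fun b hb b' hb' hby hb'y => ?_⟩
  · exact hP b (mem_erase.2 ⟨hby, hb⟩)
  · exact hPd b (mem_erase.2 ⟨hby, hb⟩) b' (mem_erase.2 ⟨hb'y, hb'⟩)

/-- The words outside the clusters `i` and `j` used for joining `u` to `swap i j * u`. -/
noncomputable def bridge (m i j : ℕ) (u : Perm ℕ) : Finset (Perm ℕ) := by
  classical exact if u 0 = j ∨ u m = j then ∅ else
    {u * swap 0 (m + 1), swap i j * u * swap 0 (m + 1)}

theorem bridge_eq_empty (h : u 0 = j ∨ u m = j) : bridge m i j u = ∅ := if_pos h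

theorem swap_mul_apply_of_ne {p : ℕ} (hi : u p ≠ i) (hj : u p ≠ j) : (swap i j * u) p = u p := by
  rw [Perm.mul_apply, swap_apply_of_ne_of_ne hi hj]

theorem mem_bridge (hm : 2 ≤ m) (hi : i < m + 2) (hj : j < m + 2) (hu : u ∈ cluster m i)
    (hv : v ∈ bridge m i j u) : (v = u * swap 0 (m + 1) ∨ v = swap i j * u * swap 0 (m + 1)) ∧
      v ∈ cluster m (u 0) ∧ u 0 ≠ i ∧ u 0 ≠ j ∧ (v 0 = i ∨ v 0 = j) ∧ v m ≠ i ∧ v m ≠ j := by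
  classical
  by_cases h : u 0 = j ∨ u m = j
  · rw [bridge_eq_empty h] at hv
    exact absurd hv (notMem_empty v)
  rw [bridge, if_neg h, mem_insert, mem_singleton] at hv
  refine ⟨hv, ?_⟩
  push Not at h
  have h0 : u 0 ≠ i := hu.2 ▸ apply_ne u (by omega)
  have h1 : u m ≠ i := hu.2 ▸ apply_ne u (by omega)
  have hw : swap i j * u ∈ words (m + 2) := mul_mem_words (swap_mem_words hi hj) hu.1
  obtain rfl | rfl := hv
  · refine ⟨star_mem_cluster hu.1, h0, h.1, Or.inl ?_, ?_⟩
    · rw [mul_swap_apply, if_pos rfl, hu.2]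
    · rw [mul_swap_apply, if_neg (by omega), if_neg (by omega)]
      exact ⟨h1, h.2⟩
  · have h2 := star_mem_cluster hw
    rw [swap_mul_apply_of_ne h0 h.1] at h2
    refine ⟨h2, h0, h.1, Or.inr ?_, ?_⟩
    · rw [mul_swap_apply, if_pos rfl, Perm.mul_apply, hu.2, swap_apply_left]
    · rw [mul_swap_apply, if_neg (by omega), if_neg (by omega), swap_mul_apply_of_ne h1 h.2]
      exact ⟨h1, h.2⟩

theorem bridge_disjoint (hm : 2 ≤ m) (hi : i < m + 2) (hj : j < m + 2) (hij : i ≠ j)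
    (hu : u ∈ cluster m i) (hv : v ∈ cluster m i) (huv : u ≠ v) :
    Disjoint (bridge m i j u) (bridge m i j v) := by
  have hval : ∀ {u}, u ∈ cluster m i →
      (u * swap 0 (m + 1)) 0 ≠ (swap i j * v * swap 0 (m + 1)) 0 := by
    intro u hu
    rw [mul_swap_apply, if_pos rfl, mul_swap_apply, if_pos rfl, Perm.mul_apply, hu.2, hv.2,
      swap_apply_left]
    exact hij
  have hval' : (v * swap 0 (m + 1)) 0 ≠ (swap i j * u * swap 0 (m + 1)) 0 := by
    rw [mul_swap_apply, if_pos rfl, mul_swap_apply, if_pos rfl, Perm.mul_apply, hu.2, hv.2,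
      swap_apply_left]
    exact hij
  rw [disjoint_left]
  intro w hw hw'
  obtain ⟨rfl | rfl, -⟩ := mem_bridge hm hi hj hu hw
  · obtain ⟨h | h, -⟩ := mem_bridge hm hi hj hv hw'
    · exact huv (mul_right_cancel h)
    · exact hval hu (by rw [h])
  · obtain ⟨h | h, -⟩ := mem_bridge hm hi hj hv hw'
    · exact hval' (by rw [h])
    · exact huv (mul_left_cancel (mul_right_cancel h))

theorem exists_bridge (hm : 2 ≤ m) (hj : j < m + 2) (hij : i ≠ j) (hu : u ∈ cluster m i) :
    ConnectedOn (wordGraph (m + 2)) ({u} ∪ bridge m i j u) ∧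
      ∃ v ∈ ({u} ∪ bridge m i j u : Set (Perm ℕ)), (wordGraph (m + 2)).Adj v (swap i j * u) := by
  classical
  have hinv : u⁻¹ i = m + 1 := by rw [Perm.inv_eq_iff_eq, hu.2]
  obtain ⟨t, htn, ht⟩ := exists_position hu.1 hj
  have hinv' : u⁻¹ j = t := by rw [Perm.inv_eq_iff_eq, ht]
  have ht' : t ≠ m + 1 := by
    rintro rfl
    exact hij (hu.2.symm.trans ht)
  by_cases h : u 0 = j ∨ u m = j
  · rw [bridge_eq_empty h, coe_empty, Set.union_empty]
    refine ⟨ConnectedOn.singleton u, u, rfl, ?_⟩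
    rw [swap_mul_eq_mul_swap, hinv, hinv', swap_comm]
    have htt : t = 0 ∨ t = m := by
      obtain h | h := h
      exacts [Or.inl (u.injective (ht.trans h.symm)), Or.inr (u.injective (ht.trans h.symm))]
    obtain rfl | rfl := htt
    exacts [adj_star _ (by omega) (by omega), adj_bubble _ (by omega) (by omega)]
  · have ht0 : t ≠ 0 := by rintro rfl; exact h (Or.inl ht)
    have hadj : (wordGraph (m + 2)).Adj (u * swap 0 (m + 1)) (swap i j * u * swap 0 (m + 1)) := by
      have h1 : (u * swap 0 (m + 1))⁻¹ i = 0 := by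
        rw [Perm.inv_eq_iff_eq, mul_swap_apply, if_pos rfl, hu.2]
      have h2 : (u * swap 0 (m + 1))⁻¹ j = t := by
        rw [Perm.inv_eq_iff_eq, mul_swap_apply, if_neg ht0, if_neg ht', ht]
      rw [mul_assoc, swap_mul_eq_mul_swap, h1, h2]
      exact adj_star _ (by omega) (by omega)
    have hb : bridge m i j u = {u * swap 0 (m + 1), swap i j * u * swap 0 (m + 1)} := if_neg h
    rw [hb, coe_pair]
    exact ⟨(ConnectedOn.singleton u).union_of_adj (ConnectedOn.pair hadj) rfl (Or.inl rfl)
      (adj_star _ (by omega) (by omega)), _, Or.inr (Or.inr rfl),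
      (adj_star _ (by omega) (by omega)).symm⟩

theorem card_filter_nbrs_le (hm : 2 ≤ m) (hx : x ∈ words (m + 2)) (hc : c < m + 2) :
    #((nbrs (m + 1) x).filter fun u => u 0 = c) ≤ m - 1 := by
  classical
  by_cases hxc : x 0 = c
  · have hsub : ((nbrs (m + 1) x).filter fun u => u 0 = c) ⊆
        (Ico 1 m).image fun t => x * swap t (t + 1) := by
      intro u hu
      rw [mem_filter, mem_nbrs] at hu
      obtain ⟨⟨s, hs, rfl⟩, h0⟩ := hu
      obtain ⟨t, h1, h2, rfl⟩ | ⟨t, h1, h2, rfl⟩ := mem_gens.1 hs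
      · rw [mul_swap_apply, if_pos rfl, ← hxc] at h0
        exact absurd h0 (apply_ne x (by omega))
      · exact mem_image_of_mem _ (mem_Ico.2 ⟨h1, by omega⟩)
    refine (card_le_card hsub).trans (card_image_le.trans ?_)
    rw [Nat.card_Ico]
  · obtain ⟨t, -, ht⟩ := exists_position hx hc
    have hsub : ((nbrs (m + 1) x).filter fun u => u 0 = c) ⊆ {x * swap 0 t} := by
      intro u hu
      rw [mem_filter, mem_nbrs] at hu
      obtain ⟨⟨s, hs, rfl⟩, h0⟩ := hu
      obtain ⟨r, h1, h2, rfl⟩ | ⟨r, h1, h2, rfl⟩ := mem_gens.1 hs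
      · rw [mul_swap_apply, if_pos rfl, ← ht] at h0
        rw [x.injective h0, mem_singleton]
      · rw [mul_swap_apply, if_neg (by omega), if_neg (by omega)] at h0
        exact absurd h0 hxc
    refine (card_le_card hsub).trans ?_
    rw [card_singleton]
    omega

/-- The words outside the clusters `i` and `j` that lie on no bridge of a neighbour of `x`. -/
def beyond (m i j : ℕ) (x : Perm ℕ) : Set (Perm ℕ) :=
  {v | v ∈ words (m + 2) ∧ v (m + 1) ≠ i ∧ v (m + 1) ≠ j ∧
    ∀ u ∈ nbrs (m + 1) x, v ∉ bridge m i j u}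

theorem connectedOn_beyond (hm : 2 ≤ m) (hi : i < m + 2) (hj : j < m + 2)
    (hx : x ∈ cluster m i) : ConnectedOn (wordGraph (m + 2)) (beyond m i j x) := by
  classical
  have hU : ∀ u ∈ nbrs (m + 1) x, u ∈ cluster m i := fun u hu =>
    mem_cluster_of_adj (mem_nbrs.1 hu) hx
  let rem : ℕ → Finset (Perm ℕ) := fun c =>
    ((nbrs (m + 1) x).filter fun u => u 0 = c).biUnion (bridge m i j)
  have hrem : ∀ c < m + 2, #(rem c) ≤ 2 * m - 2 := by
    intro c hc
    have h1 := card_filter_nbrs_le hm hx.1 hc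
    have h2 := card_biUnion_le_card_mul ((nbrs (m + 1) x).filter fun u => u 0 = c) (bridge m i j) 2
      fun u _ => by
        rw [bridge]
        split_ifs
        exacts [by simp, card_le_two]
    have h3 := Nat.mul_le_mul_right 2 h1
    simp only [rem]
    omega
  have heq : beyond m i j x =
      ⋃ c ∈ {c | c < m + 2 ∧ c ≠ i ∧ c ≠ j}, cluster m c \ (rem c : Set (Perm ℕ)) := by
    ext v
    simp only [beyond, Set.mem_iUnion, Set.mem_ofPred_eq, exists_prop]
    constructor
    · rintro ⟨h1, h2, h3, h4⟩
      refine ⟨v (m + 1), ⟨apply_lt h1 (by omega), h2, h3⟩, ⟨h1, rfl⟩, fun h => ?_⟩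
      obtain ⟨u, hu, hvu⟩ := mem_biUnion.1 (mem_coe.1 h)
      exact h4 u (mem_filter.1 hu).1 hvu
    · rintro ⟨c, ⟨-, h2, h3⟩, ⟨h4, rfl⟩, h5⟩
      refine ⟨h4, h2, h3, fun u hu hv => h5 (mem_coe.2 (mem_biUnion.2 ⟨u, mem_filter.2 ⟨hu, ?_⟩,
        hv⟩))⟩
      exact (mem_bridge hm hi hj (hU u hu) hv).2.1.2.symm
  rw [heq]
  refine ConnectedOn.biUnion_of_links (fun c hc => ?_) fun c hc d hd => ?_
  · exact (connectedOn_cluster (superConnected (by omega)) hm hc.1 _ (hrem c hc.1)).mono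
      (wordGraph_mono (by omega))
  · by_cases hcd : c = d
    · subst hcd
      exact Relation.ReflTransGen.refl
    have hnot : ∀ {c v}, v 0 ≠ i → v 0 ≠ j → v ∉ (rem c : Set (Perm ℕ)) := by
      intro c v h1 h2 hv
      obtain ⟨u, hu, hvu⟩ := mem_biUnion.1 (mem_coe.1 hv)
      obtain ⟨-, -, -, -, h | h, -⟩ := mem_bridge hm hi hj (hU u (mem_filter.1 hu).1) hvu
      exacts [h1 h, h2 h]
    obtain ⟨a, ha, ha0, ham⟩ := exists_word₂ (n := m + 2) (p := 0) (q := m + 1) (by omega)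
      (by omega) hd.1 hc.1 (by omega) (Ne.symm hcd)
    refine Relation.ReflTransGen.single ⟨hc, hd, a, ⟨⟨ha, ham⟩, ?_⟩, a * swap 0 (m + 1),
      ⟨ha0 ▸ star_mem_cluster ha, ?_⟩, Or.inl (adj_star _ (by omega) (by omega))⟩
    · exact hnot (ha0 ▸ hd.2.1) (ha0 ▸ hd.2.2)
    · have : (a * swap 0 (m + 1)) 0 = c := by rw [mul_swap_apply, if_pos rfl, ham]
      exact hnot (this ▸ hc.2.1) (this ▸ hc.2.2)

theorem exists_adj_beyond (hm : 2 ≤ m) (hi : i < m + 2) (hj : j < m + 2)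
    (hx : x ∈ cluster m i) {k l : ℕ} (hkl : k = i ∧ l = j ∨ k = j ∧ l = i)
    (hv : v ∈ cluster m k) : ∃ w ∈ beyond m i j x, (wordGraph (m + 2)).Adj v w := by
  have hU : ∀ u ∈ nbrs (m + 1) x, u ∈ cluster m i := fun u hu =>
    mem_cluster_of_adj (mem_nbrs.1 hu) hx
  have hvk := hv.2
  have hv0 : v 0 ≠ k := hvk ▸ apply_ne v (by omega)
  have hvm : v m ≠ k := hvk ▸ apply_ne v (by omega)
  have h0m : v 0 ≠ v m := apply_ne v (by omega)
  by_cases h : v m = l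
  · have h1 := star_mem_cluster hv.1
    have hwm : (v * swap 0 (m + 1)) m = v m := by
      rw [mul_swap_apply, if_neg (by omega), if_neg (by omega)]
    refine ⟨_, ⟨h1.1, ?_, ?_, fun u hu hw => ?_⟩, adj_star _ (by omega) (by omega)⟩
    · rw [h1.2]
      omega
    · rw [h1.2]
      omega
    · obtain ⟨-, -, -, -, -, h2, h3⟩ := mem_bridge hm hi hj (hU u hu) hw
      omega
  · have h1 := bubble_mem_cluster hv.1
    have hwm : (v * swap m (m + 1)) m = k := by
      rw [mul_swap_apply, if_pos rfl, hvk]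
    refine ⟨_, ⟨h1.1, ?_, ?_, fun u hu hw => ?_⟩, adj_bubble _ (by omega) (by omega)⟩
    · rw [h1.2]
      omega
    · rw [h1.2]
      omega
    · obtain ⟨-, -, -, -, -, h2, h3⟩ := mem_bridge hm hi hj (hU u hu) hw
      omega

theorem union_triple {V : Type*} (A B : Set V) (x y z : V) :
    A ∪ B ∪ {x, y, z} = insert x (({y} ∪ A) ∪ insert z B) := by
  ext v
  simp only [Set.mem_union, Set.mem_insert_iff, Set.mem_singleton_iff]
  tauto

set_option maxHeartbeats 800000 in
/-- Three words with exactly two different last symbols. -/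
theorem hasPacking_of_two_clusters (hm : 2 ≤ m) (hi : i < m + 2) (hj : j < m + 2) (hij : i ≠ j)
    (hx : x ∈ cluster m i) (hy : y ∈ cluster m i) (hz : z ∈ cluster m j) (hxy : x ≠ y) :
    HasPacking (wordGraph (m + 2)) (words (m + 2)) {x, y, z} (2 * (m + 2) - 4) := by
  classical
  have hG : wordGraph (m + 1) ≤ wordGraph (m + 2) := wordGraph_mono (by omega)
  have hU : ∀ u ∈ nbrs (m + 1) x, u ∈ cluster m i := fun u hu =>
    mem_cluster_of_adj (mem_nbrs.1 hu) hx
  have hφ : ∀ u ∈ nbrs (m + 1) x, swap i j * u ∈ cluster m j := fun u hu =>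
    ⟨mul_mem_words (swap_mem_words hi hj) (hU u hu).1, by
      rw [Perm.mul_apply, (hU u hu).2, swap_apply_left]⟩
  have hcard := card_nbrs (n := m + 1) (by omega) x
  obtain ⟨P, hP, hPd⟩ := exists_fan_nbrs hm hi hx hy hxy
  obtain ⟨Q, hQ, hQd⟩ := exists_fan_cluster hm hj hz
    (((nbrs (m + 1) x).image (swap i j * ·)).erase z) (by
      intro v hv
      obtain ⟨u, hu, rfl⟩ := mem_image.1 (mem_of_mem_erase hv)
      exact hφ u hu) (notMem_erase _ _) (by
      refine (card_erase_le).trans (card_image_le.trans ?_)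
      omega)
  replace hQ := fun u hu (hne : swap i j * u ≠ z) =>
    hQ (swap i j * u) (mem_erase.2 ⟨hne, mem_image_of_mem _ hu⟩)
  let P' : Perm ℕ → Set (Perm ℕ) := fun u => if u = y then ∅ else P u
  let Q' : Perm ℕ → Set (Perm ℕ) := fun u => if swap i j * u = z then ∅ else Q (swap i j * u)
  have hP' : ∀ u ∈ nbrs (m + 1) x, ∀ v ∈ P' u, v ∈ cluster m i ∧ v ≠ x ∧ v ≠ y := by
    intro u hu v hv
    by_cases huy : u = y
    · simp [P', huy] at hv
    · rw [show P' u = P u from if_neg huy] at hv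
      obtain ⟨-, h1, -, h2, -⟩ := hP u hu huy
      exact ⟨(h1 hv).1, (h1 hv).2, fun h => h2 (h ▸ hv)⟩
  have hQ' : ∀ u ∈ nbrs (m + 1) x, ∀ v ∈ Q' u, v ∈ cluster m j ∧ v ≠ z := by
    intro u hu v hv
    by_cases huz : swap i j * u = z
    · simp [Q', huz] at hv
    · rw [show Q' u = Q (swap i j * u) from if_neg huz] at hv
      obtain ⟨-, h1, -, h2, -⟩ := hQ u hu huz
      exact ⟨h1 hv, fun h => h2 (h ▸ hv)⟩
  have hR : ∀ u ∈ nbrs (m + 1) x, ∀ v ∈ bridge m i j u,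
      v ∈ words (m + 2) ∧ v (m + 1) ≠ i ∧ v (m + 1) ≠ j := by
    intro u hu v hv
    obtain ⟨-, h1, h2, h3, -⟩ := mem_bridge hm hi hj (hU u hu) hv
    exact ⟨h1.1, h1.2.symm ▸ h2, h1.2.symm ▸ h3⟩
  let T : Option (nbrs (m + 1) x) → Set (Perm ℕ) := fun a =>
    a.elim (beyond m i j x) fun u => P' u ∪ bridge m i j u ∪ Q' u
  have hQz : ∀ u ∈ nbrs (m + 1) x, ConnectedOn (wordGraph (m + 2)) (insert z (Q' u)) ∧
      swap i j * u ∈ insert z (Q' u) := by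
    intro u hu
    by_cases huz : swap i j * u = z
    · rw [show Q' u = ∅ from if_pos huz]
      exact ⟨by simpa using ConnectedOn.singleton z, Or.inl huz⟩
    · rw [show Q' u = Q (swap i j * u) from if_neg huz]
      obtain ⟨h0, -, h1, -, v, hv, hzv⟩ := hQ u hu huz
      exact ⟨(h1.mono hG).insert_of_adj hv (hG hzv), Or.inr h0⟩
  have hTK : ∀ a, T a ⊆ words (m + 2) := by
    rintro (_ | ⟨u, hu⟩) v hv
    · exact hv.1
    · obtain (hv | hv) | hv := hv
      exacts [(hP' u hu v hv).1.1, (hR u hu v hv).1, (hQ' u hu v hv).1.1]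
  have hTS : ∀ a, Disjoint (T a) {x, y, z} := by
    intro a
    rw [Set.disjoint_left]
    rintro v hv hvS
    have hlast : v (m + 1) = i ∨ v (m + 1) = j := by
      obtain rfl | rfl | rfl := hvS
      exacts [Or.inl hx.2, Or.inl hy.2, Or.inr hz.2]
    obtain _ | ⟨u, hu⟩ := a
    · exact hlast.elim hv.2.1 hv.2.2.1
    · obtain (hv | hv) | hv := hv
      · obtain ⟨h1, h2, h3⟩ := hP' u hu v hv
        obtain rfl | rfl | rfl := hvS
        exacts [h2 rfl, h3 rfl, hij (h1.2.symm.trans hz.2)]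
      · exact hlast.elim (hR u hu v hv).2.1 (hR u hu v hv).2.2
      · obtain ⟨h1, h2⟩ := hQ' u hu v hv
        obtain rfl | rfl | rfl := hvS
        exacts [hij (hx.2.symm.trans h1.2), hij (hy.2.symm.trans h1.2), h2 rfl]
  have hTd : ∀ a b, a ≠ b → Disjoint (T a) (T b) := by
    have hbey : ∀ u, ∀ hu : u ∈ nbrs (m + 1) x, Disjoint (beyond m i j x) (T (some ⟨u, hu⟩)) := by
      intro u hu
      rw [Set.disjoint_left]
      rintro v hv ((hv' | hv') | hv')
      exacts [hv.2.1 (hP' u hu v hv').1.2, hv.2.2.2 u hu hv', hv.2.2.1 (hQ' u hu v hv').1.2]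
    rintro (_ | ⟨u, hu⟩) (_ | ⟨w, hw⟩) hab
    · exact absurd rfl hab
    · exact hbey w hw
    · exact (hbey u hu).symm
    have huw : u ≠ w := fun h => hab (by subst h; rfl)
    rw [Set.disjoint_left]
    rintro v ((hv | hv) | hv) ((hv' | hv') | hv')
    · by_cases huy : u = y
      · simp [P', huy] at hv
      by_cases hwy : w = y
      · simp [P', hwy] at hv'
      simp only [P', if_neg huy, if_neg hwy] at hv hv'
      exact Set.disjoint_left.1 (hPd u hu w hw huy hwy huw) hv hv'
    · exact (hR w hw v hv').2.1 (hP' u hu v hv).1.2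
    · exact hij ((hP' u hu v hv).1.2.symm.trans (hQ' w hw v hv').1.2)
    · exact (hR u hu v hv).2.1 (hP' w hw v hv').1.2
    · exact disjoint_left.1 (bridge_disjoint hm hi hj hij (hU u hu) (hU w hw) huw) hv hv'
    · exact (hR u hu v hv).2.2 (hQ' w hw v hv').1.2
    · exact hij ((hP' w hw v hv').1.2.symm.trans (hQ' u hu v hv).1.2)
    · exact (hR w hw v hv').2.2 (hQ' u hu v hv).1.2
    · by_cases huz : swap i j * u = z
      · simp [Q', huz] at hv
      by_cases hwz : swap i j * w = z
      · simp [Q', hwz] at hv'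
      simp only [Q', if_neg huz, if_neg hwz] at hv hv'
      exact Set.disjoint_left.1 (hQd _ (mem_erase.2 ⟨huz, mem_image_of_mem _ hu⟩) _
        (mem_erase.2 ⟨hwz, mem_image_of_mem _ hw⟩) (by simpa using huw)) hv hv'
  have hT1 : ∀ a, (∀ h : y ∈ nbrs (m + 1) x, a ≠ some ⟨y, h⟩) →
      ConnectedOn (wordGraph (m + 2)) (T a) ∧
        ∀ s ∈ ({x, y, z} : Set (Perm ℕ)), ∃ t ∈ T a, (wordGraph (m + 2)).Adj s t := by
    rintro (_ | ⟨u, hu⟩) ha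
    · refine ⟨connectedOn_beyond hm hi hj hx, ?_⟩
      rintro s (rfl | rfl | rfl)
      exacts [exists_adj_beyond hm hi hj hx (Or.inl ⟨rfl, rfl⟩) hx,
        exists_adj_beyond hm hi hj hx (Or.inl ⟨rfl, rfl⟩) hy,
        exists_adj_beyond hm hi hj hx (Or.inr ⟨rfl, rfl⟩) hz]
    have huy : u ≠ y := by
      rintro rfl
      exact ha hu rfl
    have hTu : T (some ⟨u, hu⟩) = P u ∪ bridge m i j u ∪ Q' u := by
      simp only [T, P', Option.elim, if_neg huy]
    rw [hTu]
    obtain ⟨h1, h2, h3, h4, v, hv, hyv⟩ := hP u hu huy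
    obtain ⟨hW, w, hw, hwφ⟩ := exists_bridge hm hj hij (hU u hu)
    have hPW : ConnectedOn (wordGraph (m + 2)) (P u ∪ bridge m i j u) := by
      have := (h3.mono hG).union_of_mem hW h1 (Or.inl rfl)
      rwa [← Set.union_assoc, Set.union_eq_self_of_subset_right (Set.singleton_subset_iff.2 h1)]
        at this
    have hwPW : w ∈ P u ∪ bridge m i j u := by
      obtain rfl | hw := hw
      exacts [Or.inl h1, Or.inr hw]
    by_cases huz : swap i j * u = z
    · rw [show Q' u = ∅ from if_pos huz, Set.union_empty]
      refine ⟨hPW, ?_⟩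
      rintro s (rfl | rfl | rfl)
      exacts [⟨u, Or.inl h1, hG (mem_nbrs.1 hu)⟩, ⟨v, Or.inl hv, hG hyv⟩,
        ⟨w, hwPW, huz ▸ hwφ.symm⟩]
    · rw [show Q' u = Q (swap i j * u) from if_neg huz]
      obtain ⟨k0, -, k1, -, b, hb, hzb⟩ := hQ u hu huz
      refine ⟨hPW.union_of_adj (k1.mono hG) hwPW k0 hwφ, ?_⟩
      rintro s (rfl | rfl | rfl)
      exacts [⟨u, Or.inl (Or.inl h1), hG (mem_nbrs.1 hu)⟩, ⟨v, Or.inl (Or.inl hv), hG hyv⟩,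
        ⟨b, Or.inr hb, hG hzb⟩]
  have hιcard : Nat.card (Option (nbrs (m + 1) x)) = 2 * (m + 2) - 4 := by
    rw [Nat.card_eq_fintype_card, Fintype.card_option, Fintype.card_coe, hcard]
    omega
  by_cases hyU : y ∈ nbrs (m + 1) x
  · refine ⟨_, T, some ⟨y, hyU⟩, hιcard, hTK, hTS, hTd, fun a ha => hT1 a fun _ => ha, ?_⟩
    obtain ⟨hW, w, hw, hwφ⟩ := exists_bridge hm hj hij hy
    have hTy : T (some ⟨y, hyU⟩) ∪ {x, y, z} =
        insert x (({y} ∪ (bridge m i j y : Set (Perm ℕ))) ∪ insert z (Q' y)) := by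
      simp only [T, P', Option.elim, if_true, Set.empty_union]
      exact union_triple _ _ _ _ _
    rw [hTy]
    exact (hW.union_of_adj (hQz y hyU).1 hw (hQz y hyU).2 hwφ).insert_of_adj
      (Or.inl (Or.inl rfl)) (hG (mem_nbrs.1 hyU))
  · refine ⟨_, T, none, hιcard, hTK, hTS, hTd, fun a ha => hT1 a fun h => absurd h hyU, ?_⟩
    obtain ⟨h1, h2⟩ := hT1 none fun h => absurd h hyU
    exact h1.union_of_forall_adj fun s hs => Or.inr (h2 s hs)

end TwoClusters

section Middle

open Equiv

variable {m c : ℕ} {A : Finset ℕ} {u v p : Perm ℕ} {R H : Set (Perm ℕ)}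

/-- The words whose last symbol is not in `A`. -/
def middle (m : ℕ) (A : Finset ℕ) : Set (Perm ℕ) := {v | v ∈ words (m + 2) ∧ v (m + 1) ∉ A}

/-- The words ending in the two symbols `d c`. -/
def block (m c d : ℕ) : Set (Perm ℕ) := {v | v ∈ words (m + 2) ∧ v (m + 1) = c ∧ v m = d}

theorem connectedOn_block (hm : 3 ≤ m) (c d : ℕ) :
    ConnectedOn (wordGraph (m + 2)) (block m c d) := by
  intro g hg v hv
  have hw : ConnectedOn (wordGraph m) (words m) := by
    have := (superConnected hm).connectedOn hm ∅ (by simp)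
    rwa [coe_empty, Set.sdiff_empty] at this
  have heq : (g⁻¹ * ·) ⁻¹' words m = block m c d := by
    ext u
    simp only [Set.mem_preimage, block]
    constructor
    · intro hu
      have hgu : u = g * (g⁻¹ * u) := by simp
      have h : ∀ p, m ≤ p → u p = g p := fun p hp => by rw [hgu, Perm.mul_apply, hu p hp]
      exact ⟨fun p hp => (h p (by omega)).trans (hg.1 p hp), (h _ (by omega)).trans hg.2.1,
        (h _ le_rfl).trans hg.2.2⟩
    · rintro ⟨h1, h2, h3⟩ p hp
      rw [Perm.mul_apply, Perm.inv_eq_iff_eq]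
      obtain rfl | rfl | hp : p = m ∨ p = m + 1 ∨ m + 2 ≤ p := by omega
      exacts [h3.trans hg.2.2.symm, h2.trans hg.2.1.symm, (h1 p hp).trans (hg.1 p hp).symm]
  have := hw.mul_left g
  rw [heq] at this
  exact (this g hg v hv).mono (wordGraph_mono (by omega)) le_rfl

theorem connectedOn_blocks (hm : 3 ≤ m) (A : Finset ℕ) :
    ConnectedOn (wordGraph (m + 2)) {v | v ∈ middle m A ∧ v m ∉ A} := by
  let I : Set (ℕ × ℕ) := {e | e.1 < m + 2 ∧ e.2 < m + 2 ∧ e.1 ∉ A ∧ e.2 ∉ A ∧ e.1 ≠ e.2}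
  have heq : {v | v ∈ middle m A ∧ v m ∉ A} = ⋃ e ∈ I, block m e.1 e.2 := by
    ext v
    simp only [Set.mem_iUnion, exists_prop, middle, block, Set.mem_ofPred_eq]
    constructor
    · rintro ⟨⟨h1, h2⟩, h3⟩
      exact ⟨(v (m + 1), v m), ⟨apply_lt h1 (by omega), apply_lt h1 (by omega), h2, h3,
        apply_ne v (by omega)⟩, h1, rfl, rfl⟩
    · rintro ⟨⟨c, d⟩, ⟨-, -, h1, h2, -⟩, h3, rfl, rfl⟩
      exact ⟨⟨h3, h1⟩, h2⟩
  rw [heq]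
  refine ConnectedOn.biUnion_of_links (fun e _ => connectedOn_block hm _ _) ?_
  have hswap : ∀ c d, (c, d) ∈ I → Relation.ReflTransGen (fun e f => e ∈ I ∧ f ∈ I ∧
      ∃ u ∈ block m e.1 e.2, ∃ v ∈ block m f.1 f.2, (wordGraph (m + 2)).Adj u v ∨ u = v)
      (c, d) (d, c) := by
    rintro c d ⟨h1, h2, h3, h4, h5⟩
    obtain ⟨a, ha, ham, hal⟩ := exists_word₂ (n := m + 2) (p := m) (q := m + 1) (by omega)
      (by omega) h2 h1 (by omega) (Ne.symm h5)
    refine Relation.ReflTransGen.single ⟨⟨h1, h2, h3, h4, h5⟩, ⟨h2, h1, h4, h3, h5.symm⟩, a,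
      ⟨ha, hal, ham⟩, a * swap m (m + 1), ⟨(bubble_mem_cluster ha).1, ?_, ?_⟩,
      Or.inl (adj_bubble _ (by omega) (by omega))⟩
    · exact (bubble_mem_cluster ha).2.trans ham
    · rw [mul_swap_apply, if_pos rfl, hal]
  have hmove : ∀ c d c', (c, d) ∈ I → (c', d) ∈ I →
      Relation.ReflTransGen (fun e f => e ∈ I ∧ f ∈ I ∧
      ∃ u ∈ block m e.1 e.2, ∃ v ∈ block m f.1 f.2, (wordGraph (m + 2)).Adj u v ∨ u = v)
      (c, d) (c', d) := by
    intro c d c' h h'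
    by_cases hcc : c = c'
    · subst hcc
      exact Relation.ReflTransGen.refl
    obtain ⟨b, hb, hbm, hbl⟩ := exists_word₂ (n := m + 2) (p := m) (q := m + 1) (by omega)
      (by omega) h.2.1 h.1 (by omega) (Ne.symm h.2.2.2.2)
    obtain ⟨a, ha, ha0, hab⟩ := exists_word_update hb (p := 0) (by omega) h'.1
    have ham : a m = d := (hab m (by omega) (hbm.trans_ne h'.2.2.2.2.symm)).trans hbm
    have hal : a (m + 1) = c := (hab _ (by omega) (hbl.trans_ne hcc)).trans hbl
    refine Relation.ReflTransGen.single ⟨h, h', a, ⟨ha, hal, ham⟩, a * swap 0 (m + 1),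
      ⟨(star_mem_cluster ha).1, (star_mem_cluster ha).2.trans ha0, ?_⟩,
      Or.inl (adj_star _ (by omega) (by omega))⟩
    rw [mul_swap_apply, if_neg (by omega), if_neg (by omega), ham]
  rintro ⟨c, d⟩ h ⟨c', d'⟩ h'
  obtain ⟨h1, h2, h3, h4, h5⟩ := id h
  obtain ⟨k1, k2, k3, k4, k5⟩ := id h'
  by_cases hcd : c' = d
  · subst hcd
    exact (hmove c c' d' h ⟨k2, k1, k4, k3, k5.symm⟩).trans (hswap _ _ ⟨k2, k1, k4, k3, k5.symm⟩)
  · have e1 : (c', d) ∈ I := ⟨k1, h2, k3, h4, hcd⟩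
    have e2 : (d, c') ∈ I := ⟨h2, k1, h4, k3, Ne.symm hcd⟩
    have e3 : (d', c') ∈ I := ⟨k2, k1, k4, k3, k5.symm⟩
    exact (hmove _ _ _ h e1).trans ((hswap _ _ e1).trans ((hmove _ _ _ e2 e3).trans (hswap _ _ e3)))

/-- The middle stays connected after deleting words with both outer neighbours outside it. -/
theorem connectedOn_middle_diff (hm : 3 ≤ m) (hA : #A = 3) (hR : ∀ v ∈ R, v 0 ∈ A ∧ v m ∈ A) :
    ConnectedOn (wordGraph (m + 2)) (middle m A \ R) := by
  have hmul : ∀ v ∈ middle m A, ∀ r, r < m + 1 → v * swap 0 r ∈ middle m A := by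
    rintro v ⟨h1, h2⟩ r hr
    refine ⟨mul_mem_words h1 (swap_mem_words (by omega) (by omega)), ?_⟩
    rwa [mul_swap_apply, if_neg (by omega), if_neg (by omega)]
  have h1 := (connectedOn_blocks hm A).union_of_forall_adj
    (W := {v | v ∈ middle m A ∧ (v 0 ∉ A ∨ v m ∉ A)}) fun v hv => by
      by_cases hvm : v m ∈ A
      · refine Or.inr ⟨v * swap 0 m, ⟨hmul v hv.1 m (by omega), ?_⟩,
          adj_star _ (by omega) (by omega)⟩
        rw [mul_swap_apply, if_neg (by omega), if_pos rfl]
        exact hv.2.resolve_right (not_not.2 hvm)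
      · exact Or.inl ⟨hv.1, hvm⟩
  have h2 := h1.union_of_forall_adj (W := middle m A \ R) fun v hv => by
    by_cases hf : v 0 ∈ A ∧ v m ∈ A
    · right
      have hr : v 1 ∉ A ∨ v 2 ∉ A := by
        by_contra! hcon
        have hsub : ({v 0, v m, v 1, v 2} : Finset ℕ) ⊆ A := by
          simp only [insert_subset_iff, singleton_subset_iff]
          exact ⟨hf.1, hf.2, hcon.1, hcon.2⟩
        have := card_le_card hsub
        rw [card_insert_of_notMem, card_insert_of_notMem, card_pair (apply_ne v (by omega))] at this
        · omega
        · simp only [mem_insert, mem_singleton, v.injective.eq_iff]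
          omega
        · simp only [mem_insert, mem_singleton, v.injective.eq_iff]
          omega
      obtain ⟨r, hr1, hr2, hr⟩ : ∃ r, 1 ≤ r ∧ r < m ∧ v r ∉ A := by
        obtain h | h := hr
        exacts [⟨1, le_rfl, by omega, h⟩, ⟨2, by omega, by omega, h⟩]
      refine ⟨v * swap 0 r, Or.inr ⟨hmul v hv.1 r (by omega), Or.inl ?_⟩,
        adj_star _ (by omega) (by omega)⟩
      rwa [mul_swap_apply, if_pos rfl]
    · exact Or.inl (Or.inr ⟨hv.1, by tauto⟩)
  convert h2 using 1
  ext v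
  constructor
  · exact fun hv => Or.inr hv
  · rintro ((hv | hv) | hv)
    · exact ⟨hv.1, fun h => hv.2 (hR v h).2⟩
    · exact ⟨hv.1, fun h => hv.2.elim (fun h' => h' (hR v h).1) fun h' => h' (hR v h).2⟩
    · exact hv

theorem eq_outer_of_adj (h : (wordGraph (m + 2)).Adj u v) (hne : v (m + 1) ≠ u (m + 1)) :
    v = u * swap 0 (m + 1) ∨ v = u * swap m (m + 1) := by
  obtain ⟨s, hs, rfl⟩ := h
  obtain ⟨i, h1, h2, rfl⟩ | ⟨j, h1, h2, rfl⟩ := mem_gens.1 hs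
  · by_cases hi : i = m + 1
    · exact Or.inl (by rw [hi])
    · rw [mul_swap_apply, if_neg (by omega), if_neg (by omega)] at hne
      exact absurd rfl hne
  · by_cases hj : j = m
    · exact Or.inr (by rw [hj])
    · rw [mul_swap_apply, if_neg (by omega), if_neg (by omega)] at hne
      exact absurd rfl hne

/-- A word of the middle both of whose outer neighbours lie outside the middle. -/
def Locked (m : ℕ) (A : Finset ℕ) (v : Perm ℕ) : Prop := v ∈ middle m A ∧ v 0 ∈ A ∧ v m ∈ A

theorem Locked.eq_of_adj (hm : 1 ≤ m) (hu : Locked m A u) (hv : Locked m A v) (hp : p (m + 1) ∈ A)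
    (hpu : (wordGraph (m + 2)).Adj p u) (hpv : (wordGraph (m + 2)).Adj p v) : u = v := by
  have key : ∀ u v : Perm ℕ, Locked m A u → Locked m A v → u = p * swap 0 (m + 1) →
      v = p * swap m (m + 1) → False := by
    rintro u v hu hv rfl rfl
    have h1 := hu.2.2
    have h2 := hv.1.2
    rw [mul_swap_apply, if_neg (by omega), if_neg (by omega)] at h1
    rw [mul_swap_apply, if_neg (by omega), if_pos rfl] at h2
    exact h2 h1
  have h1 := eq_outer_of_adj hpu fun h => hu.1.2 (h ▸ hp)
  have h2 := eq_outer_of_adj hpv fun h => hv.1.2 (h ▸ hp)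
  obtain h1 | h1 := h1 <;> obtain h2 | h2 := h2
  exacts [h1.trans h2.symm, (key u v hu hv h1 h2).elim, (key v u hv hu h2 h1).elim,
    h1.trans h2.symm]

theorem exists_guard (hm : 1 ≤ m) (A : Finset ℕ) (hp : p (m + 1) ∈ A) :
    ∃ g, ∀ v, Locked m A v → (wordGraph (m + 2)).Adj p v → v = g := by
  by_cases h : ∃ v, Locked m A v ∧ (wordGraph (m + 2)).Adj p v
  · obtain ⟨v, hv, hpv⟩ := h
    exact ⟨v, fun u hu hpu => hu.eq_of_adj hm hv hp hpu hpv⟩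
  · exact ⟨p, fun v hv hpv => (h ⟨v, hv, hpv⟩).elim⟩

/-- Two adjacent locked words, adjacent to all the clusters with index in `A`. -/
def IsHub (m : ℕ) (A : Finset ℕ) (H : Set (Perm ℕ)) : Prop :=
  ∃ h q, Locked m A h ∧ 1 ≤ q ∧ q < m ∧ h q ∈ A ∧ (∀ c ∈ A, h 0 = c ∨ h m = c ∨ h q = c) ∧
    H = {h, h * swap 0 q}

theorem IsHub.locked (hH : IsHub m A H) (hv : v ∈ H) : Locked m A v := by
  obtain ⟨h, q, h1, h2, h3, h4, -, rfl⟩ := hH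
  obtain rfl | rfl := hv
  · exact h1
  · refine ⟨⟨mul_mem_words h1.1.1 (swap_mem_words (by omega) (by omega)), ?_⟩, ?_, ?_⟩
    · rw [mul_swap_apply, if_neg (by omega), if_neg (by omega)]
      exact h1.1.2
    · rwa [mul_swap_apply, if_pos rfl]
    · rw [mul_swap_apply, if_neg (by omega), if_neg (by omega)]
      exact h1.2.2

theorem IsHub.connectedOn (hH : IsHub m A H) : ConnectedOn (wordGraph (m + 2)) H := by
  obtain ⟨h, q, -, h2, h3, -, -, rfl⟩ := hH
  exact ConnectedOn.pair (adj_star _ h2 (by omega))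

theorem IsHub.exists_port (hH : IsHub m A H) (hc : c ∈ A) :
    ∃ p ∈ cluster m c, ∃ v ∈ H, (wordGraph (m + 2)).Adj p v := by
  have hmem := fun v => hH.locked (v := v)
  obtain ⟨h, q, h1, h2, h3, h4, h5, rfl⟩ := hH
  obtain h0 | h0 | h0 := h5 c hc
  · obtain ⟨p, hp, hhp⟩ := exists_outer h1.1.1 (Or.inl h0)
    exact ⟨p, hp, h, Or.inl rfl, hhp.symm⟩
  · obtain ⟨p, hp, hhp⟩ := exists_outer h1.1.1 (Or.inr h0)
    exact ⟨p, hp, h, Or.inl rfl, hhp.symm⟩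
  · obtain ⟨p, hp, hhp⟩ := exists_outer (c := c) (hmem _ (Or.inr rfl)).1.1 (Or.inl (by
      rw [mul_swap_apply, if_pos rfl, h0]))
    exact ⟨p, hp, _, Or.inr rfl, hhp.symm⟩

/-- There are many disjoint hubs avoiding a given set of words. -/
theorem exists_hubs {κ : Type} [Fintype κ] (hm : 2 ≤ m) (hA : #A = 3) (hAm : ∀ c ∈ A, c < m + 2)
    (D : Finset (Perm ℕ)) (hD : Fintype.card κ + #D ≤ 3 * ((m - 1) * (m - 1))) :
    ∃ K : κ → Set (Perm ℕ), (∀ a, IsHub m A (K a)) ∧ (∀ a b, a ≠ b → Disjoint (K a) (K b)) ∧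
      ∀ a, ∀ v ∈ D, v ∉ K a := by
  classical
  let I : Finset (ℕ × ℕ × ℕ) := A ×ˢ (range (m + 2) \ A) ×ˢ Ico 1 m
  have hI : #I = 3 * ((m - 1) * (m - 1)) := by
    rw [card_product, card_product, hA, card_sdiff_of_subset
      (fun c hc => mem_range.2 (hAm c hc)), hA, card_range, Nat.card_Ico]
    rfl
  have hex : ∀ e : ℕ × ℕ × ℕ, e ∈ I → ∃ h, Locked m A h ∧ h m = e.1 ∧ h (m + 1) = e.2.1 ∧
      h e.2.2 ∈ A ∧ ∀ c ∈ A, h 0 = c ∨ h m = c ∨ h e.2.2 = c := by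
    rintro ⟨a, c, q⟩ he
    simp only [I, mem_product, mem_sdiff, mem_range, mem_Ico] at he
    obtain ⟨ha, ⟨hc, hcA⟩, hq1, hq2⟩ := he
    have h2 : #(A.erase a) = 2 := by rw [card_erase_of_mem ha, hA]
    obtain ⟨b, d, hbd, hA'⟩ := card_eq_two.1 h2
    have hb : b ≠ a ∧ b ∈ A := mem_erase.1 (hA' ▸ mem_insert_self _ _)
    have hd : d ≠ a ∧ d ∈ A := mem_erase.1 (hA' ▸ mem_insert_of_mem (mem_singleton_self _))
    have hcov : ∀ e ∈ A, e = a ∨ e = b ∨ e = d := by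
      intro e he
      by_cases hea : e = a
      · exact Or.inl hea
      · have : e ∈ A.erase a := mem_erase.2 ⟨hea, he⟩
        rw [hA', mem_insert, mem_singleton] at this
        exact Or.inr this
    have hne : ∀ e ∈ A, e ≠ c := fun e he h => hcA (h ▸ he)
    obtain ⟨h, hh, k1, k2, k3, k4⟩ := exists_word₄ (n := m + 2) (p := 0) (q := m) (r := m + 1)
      (t := q) (by omega) (by omega) (by omega) (by omega) (hAm b hb.2) (hAm a ha) hc (hAm d hd.2)
      (by omega) (by omega) (by omega) (by omega) (by omega) (by omega) hb.1 (hne b hb.2) hbd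
      (hne a ha) hd.1.symm (hne d hd.2).symm
    refine ⟨h, ⟨⟨hh, k3 ▸ hcA⟩, k1 ▸ hb.2, k2 ▸ ha⟩, k2, k3, k4 ▸ hd.2, fun e he => ?_⟩
    simp only [k1, k2, k4]
    obtain rfl | rfl | rfl := hcov e he <;> tauto
  choose! f hf using hex
  have hhub : ∀ e ∈ I, IsHub m A {f e, f e * swap 0 e.2.2} := by
    intro e he
    have he' := he
    simp only [I, mem_product, mem_Ico] at he'
    obtain ⟨h1, -, -, h2, h3⟩ := hf e he
    exact ⟨f e, e.2.2, h1, he'.2.2.1, he'.2.2.2, h2, h3, rfl⟩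
  have hval : ∀ e ∈ I, ∀ v ∈ ({f e, f e * swap 0 e.2.2} : Set (Perm ℕ)), v m = e.1 ∧
      v (m + 1) = e.2.1 ∧ v e.2.2 ∈ A ∧ ∀ c ∈ A, v 0 = c ∨ v m = c ∨ v e.2.2 = c := by
    intro e he
    have he' := he
    simp only [I, mem_product, mem_Ico] at he'
    obtain ⟨h1, h2, h3, h4, h5⟩ := hf e he
    rintro v (rfl | rfl)
    · exact ⟨h2, h3, h4, h5⟩
    · have e0 : (f e * swap 0 e.2.2) 0 = f e e.2.2 := by rw [mul_swap_apply, if_pos rfl]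
      have eq : (f e * swap 0 e.2.2) e.2.2 = f e 0 := by
        rw [mul_swap_apply, if_neg (by omega), if_pos rfl]
      have em : (f e * swap 0 e.2.2) m = f e m := by
        rw [mul_swap_apply, if_neg (by omega), if_neg (by omega)]
      have el : (f e * swap 0 e.2.2) (m + 1) = f e (m + 1) := by
        rw [mul_swap_apply, if_neg (by omega), if_neg (by omega)]
      rw [e0, eq, em, el]
      refine ⟨h2, h3, h1.2.1, fun c hc => ?_⟩
      have := h5 c hc
      tauto
  have hdis : ∀ e ∈ I, ∀ e' ∈ I, ∀ v ∈ ({f e, f e * swap 0 e.2.2} : Set (Perm ℕ)),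
      v ∈ ({f e', f e' * swap 0 e'.2.2} : Set (Perm ℕ)) → e = e' := by
    intro e he e' he' v hv hv'
    obtain ⟨h1, h2, h3, h4⟩ := hval e he v hv
    obtain ⟨k1, k2, k3, k4⟩ := hval e' he' v hv'
    simp only [I, mem_product, mem_Ico] at he'
    refine Prod.ext (h1.symm.trans k1) (Prod.ext (h2.symm.trans k2) ?_)
    obtain h | h | h := h4 _ k3
    · have := v.injective h
      omega
    · have := v.injective h
      omega
    · exact v.injective h
  let good : Finset (ℕ × ℕ × ℕ) :=
    I.filter fun e => ∀ v ∈ D, v ∉ ({f e, f e * swap 0 e.2.2} : Set (Perm ℕ))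
  have hbad : #(I \ good) ≤ #D := by
    have : ∀ e : ℕ × ℕ × ℕ, e ∈ I \ good →
        ∃ v ∈ D, v ∈ ({f e, f e * swap 0 e.2.2} : Set (Perm ℕ)) := by
      intro e he
      rw [mem_sdiff] at he
      by_contra! hcon
      exact he.2 (mem_filter.2 ⟨he.1, hcon⟩)
    choose! g hg using this
    refine card_le_card_of_injOn g (fun e he => (hg e he).1) fun e he e' he' hgg => ?_
    exact hdis e (mem_sdiff.1 he).1 e' (mem_sdiff.1 he').1 (g e) (hg e he).2 (hgg ▸ (hg e' he').2)
  have hgood : Fintype.card κ ≤ Fintype.card good := by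
    have := card_sdiff_add_card_eq_card (s := good) (t := I) (filter_subset _ _)
    rw [Fintype.card_coe]
    omega
  obtain ⟨φ⟩ := Function.Embedding.nonempty_of_card_le hgood
  have hmem : ∀ a, (φ a : ℕ × ℕ × ℕ) ∈ I := fun a => (mem_filter.1 (φ a).2).1
  refine ⟨fun a => {f (φ a), f (φ a) * swap 0 (φ a : ℕ × ℕ × ℕ).2.2}, fun a => hhub _ (hmem a),
    fun a b hab => Set.disjoint_left.2 fun v hv hv' => hab ?_, fun a => (mem_filter.1 (φ a).2).2⟩
  exact φ.injective (Subtype.ext (hdis _ (hmem a) _ (hmem b) v hv hv'))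

end Middle

section Distinct

open Equiv

variable {m c i j l : ℕ} {A : Finset ℕ} {s u v x y z : Perm ℕ} {ι : Type}
  {H K X Y Z : ι → Set (Perm ℕ)}

/-- Disjoint connected subsets of the middle. -/
def IsFrame (m : ℕ) (A : Finset ℕ) (H : ι → Set (Perm ℕ)) : Prop :=
  (∀ a, ConnectedOn (wordGraph (m + 2)) (H a)) ∧ (∀ a, H a ⊆ middle m A) ∧
    ∀ a b, a ≠ b → Disjoint (H a) (H b)

/-- Disjoint subsets of the cluster `c`, away from `s`, extending a frame. -/
def IsLegs (m c : ℕ) (s : Perm ℕ) (H X : ι → Set (Perm ℕ)) : Prop :=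
  (∀ a, X a ⊆ cluster m c) ∧ (∀ a, s ∉ X a) ∧ (∀ a b, a ≠ b → Disjoint (X a) (X b)) ∧
    ∀ a, X a = ∅ ∨ (ConnectedOn (wordGraph (m + 2)) (X a) ∧
      ∃ u ∈ X a, ∃ v ∈ H a, (wordGraph (m + 2)).Adj u v)

theorem IsLegs.connectedOn_union {T : Set (Perm ℕ)} {a : ι} (hX : IsLegs m c s H X)
    (hT : ConnectedOn (wordGraph (m + 2)) T) (hHT : H a ⊆ T) :
    ConnectedOn (wordGraph (m + 2)) (T ∪ X a) := by
  obtain h | ⟨h, u, hu, v, hv, huv⟩ := hX.2.2.2 a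
  · rwa [h, Set.union_empty]
  · exact hT.union_of_adj h (hHT hv) hu huv.symm

theorem disjoint_cluster_middle (hc : c ∈ A) : Disjoint (cluster m c) (middle m A) :=
  Set.disjoint_left.2 fun _ h h' => h'.2 (h.2.symm ▸ hc)

theorem disjoint_cluster (hij : i ≠ j) : Disjoint (cluster m i) (cluster m j) :=
  Set.disjoint_left.2 fun _ h h' => hij (h.2.symm.trans h'.2)

theorem IsFrame.hasPacking (hH : IsFrame m A H) (hι : Nat.card ι = 2 * m)
    (hi : i ∈ A) (hj : j ∈ A) (hl : l ∈ A) (hij : i ≠ j) (hil : i ≠ l) (hjl : j ≠ l)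
    (hx : x ∈ cluster m i) (hy : y ∈ cluster m j) (hz : z ∈ cluster m l)
    (hX : IsLegs m i x H X) (hY : IsLegs m j y H Y) (hZ : IsLegs m l z H Z) (a₀ : ι)
    (hxT : ∀ a, ∃ t ∈ H a ∪ X a ∪ Y a ∪ Z a, (wordGraph (m + 2)).Adj x t)
    (hzT : ∀ a, ∃ t ∈ H a ∪ X a ∪ Y a ∪ Z a, (wordGraph (m + 2)).Adj z t)
    (hyT : ∀ a, (∃ t ∈ H a ∪ X a ∪ Y a ∪ Z a, (wordGraph (m + 2)).Adj y t) ∨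
      a = a₀ ∧ (wordGraph (m + 2)).Adj y x) :
    HasPacking (wordGraph (m + 2)) (words (m + 2)) {x, y, z} (2 * (m + 2) - 4) := by
  have hconn : ∀ a, ConnectedOn (wordGraph (m + 2)) (H a ∪ X a ∪ Y a ∪ Z a) := fun a =>
    hZ.connectedOn_union (hY.connectedOn_union (hX.connectedOn_union (hH.1 a) le_rfl)
      Set.subset_union_left) (Set.subset_union_left.trans Set.subset_union_left)
  refine ⟨ι, fun a => H a ∪ X a ∪ Y a ∪ Z a, a₀, by omega, fun a => ?_, fun a => ?_,
    fun a b hab => ?_, fun a ha => ⟨hconn a, ?_⟩, ?_⟩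
  · refine Set.union_subset (Set.union_subset (Set.union_subset ?_ ?_) ?_) ?_
    exacts [fun v hv => (hH.2.1 a hv).1, fun v hv => (hX.1 a hv).1, fun v hv => (hY.1 a hv).1,
      fun v hv => (hZ.1 a hv).1]
  · simp only [Set.disjoint_insert_right, Set.disjoint_singleton_right]
    have hunion : ∀ {s}, s ∉ H a → s ∉ X a → s ∉ Y a → s ∉ Z a → s ∉ H a ∪ X a ∪ Y a ∪ Z a := by
      simp only [Set.mem_union]
      tauto
    have hmid : ∀ {c s}, c ∈ A → s ∈ cluster m c → s ∉ H a := fun hc hs h =>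
      Set.disjoint_left.1 (disjoint_cluster_middle hc) hs (hH.2.1 a h)
    have hcl : ∀ {c d s} {W : Set (Perm ℕ)}, c ≠ d → s ∈ cluster m c → W ⊆ cluster m d → s ∉ W :=
      fun hcd hs hW h => Set.disjoint_left.1 (disjoint_cluster hcd) hs (hW h)
    exact ⟨hunion (hmid hi hx) (hX.2.1 a) (hcl hij hx (hY.1 a)) (hcl hil hx (hZ.1 a)),
      hunion (hmid hj hy) (hcl hij.symm hy (hX.1 a)) (hY.2.1 a) (hcl hjl hy (hZ.1 a)),
      hunion (hmid hl hz) (hcl hil.symm hz (hX.1 a)) (hcl hjl.symm hz (hY.1 a)) (hZ.2.1 a)⟩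
  · simp only [Set.disjoint_union_left, Set.disjoint_union_right]
    have hmid : ∀ {c} {W : Set (Perm ℕ)} a, c ∈ A → W ⊆ cluster m c → Disjoint W (H a) :=
      fun a hc hW => (disjoint_cluster_middle hc).mono hW (hH.2.1 a)
    have hcl : ∀ {c d} {W W' : Set (Perm ℕ)}, c ≠ d → W ⊆ cluster m c → W' ⊆ cluster m d →
      Disjoint W W' := fun hcd hW hW' => (disjoint_cluster hcd).mono hW hW'
    exact ⟨⟨⟨⟨⟨⟨hH.2.2 a b hab, hmid _ hi (hX.1 a)⟩, hmid _ hj (hY.1 a)⟩, hmid _ hl (hZ.1 a)⟩,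
      ⟨⟨(hmid _ hi (hX.1 b)).symm, hX.2.2.1 a b hab⟩, hcl hij.symm (hY.1 a) (hX.1 b)⟩,
        hcl hil.symm (hZ.1 a) (hX.1 b)⟩,
      ⟨⟨(hmid _ hj (hY.1 b)).symm, hcl hij (hX.1 a) (hY.1 b)⟩, hY.2.2.1 a b hab⟩,
        hcl hjl.symm (hZ.1 a) (hY.1 b)⟩,
      ⟨⟨(hmid _ hl (hZ.1 b)).symm, hcl hil (hX.1 a) (hZ.1 b)⟩, hcl hjl (hY.1 a) (hZ.1 b)⟩,
      hZ.2.2.1 a b hab⟩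
  · rintro s (rfl | rfl | rfl)
    exacts [hxT a, (hyT a).resolve_right fun h => ha h.1, hzT a]
  · obtain ⟨t, ht, hxt⟩ := hxT a₀
    obtain ⟨t', ht', hzt⟩ := hzT a₀
    have h1 := ((hconn a₀).insert_of_adj ht hxt).insert_of_adj (Set.mem_insert_of_mem _ ht') hzt
    have h2 : ConnectedOn (wordGraph (m + 2))
        (insert y (insert z (insert x (H a₀ ∪ X a₀ ∪ Y a₀ ∪ Z a₀)))) := by
      obtain ⟨t, ht, hyt⟩ | ⟨-, hyx⟩ := hyT a₀
      · exact h1.insert_of_adj (Set.mem_insert_of_mem _ (Set.mem_insert_of_mem _ ht)) hyt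
      · exact h1.insert_of_adj (Set.mem_insert_of_mem _ (Set.mem_insert _ _)) hyx
    convert h2 using 1
    ext v
    simp only [Set.mem_union, Set.mem_insert_iff, Set.mem_singleton_iff]
    tauto

/-- Ports of disjoint hubs in a cluster. -/
theorem exists_ports (hm : 1 ≤ m) (hc : c ∈ A) (hK : ∀ a, IsHub m A (K a))
    (hKd : ∀ a b, a ≠ b → Disjoint (K a) (K b)) :
    ∃ p : ι → Perm ℕ, Function.Injective p ∧ ∀ a, p a ∈ cluster m c ∧
      ∃ v ∈ K a, (wordGraph (m + 2)).Adj (p a) v := by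
  choose p hp v hv hpv using fun a => (hK a).exists_port hc
  refine ⟨p, fun a b hab => ?_, fun a => ⟨hp a, v a, hv a, hpv a⟩⟩
  by_contra hne
  have := ((hK a).locked (hv a)).eq_of_adj hm ((hK b).locked (hv b)) (p := p a)
    ((hp a).2.symm ▸ hc) (hpv a) (hab ▸ hpv b)
  exact Set.disjoint_left.1 (hKd a b hne) (hv a) (this ▸ hv b)

theorem exists_legs (hm : 2 ≤ m) (hc : c ∈ A) (hAm : ∀ c ∈ A, c < m + 2)
    (hK : ∀ a, IsHub m A (K a)) (hKd : ∀ a b, a ≠ b → Disjoint (K a) (K b))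
    (hKH : ∀ a, K a ⊆ H a) (hs : s ∈ cluster m c) (J : Finset ι) (hJ : #J ≤ 2 * m - 1)
    (hav : ∀ a ∈ J, ∀ v ∈ K a, ¬(wordGraph (m + 2)).Adj s v) :
    ∃ X, IsLegs m c s H X ∧ ∀ a ∈ J, ∃ t ∈ X a, (wordGraph (m + 2)).Adj s t := by
  classical
  obtain ⟨p, hpi, hp⟩ := exists_ports (by omega) hc hK hKd
  have hle : wordGraph (m + 1) ≤ wordGraph (m + 2) := wordGraph_mono (by omega)
  obtain ⟨P, hP, hPd⟩ := exists_fan_cluster hm (hAm c hc) hs (J.image p) (by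
      rw [coe_image]
      rintro _ ⟨a, -, rfl⟩
      exact (hp a).1) (by
      rw [mem_image]
      rintro ⟨a, ha, rfl⟩
      obtain ⟨v, hv, hpv⟩ := (hp a).2
      exact hav a ha v hv hpv) (card_image_le.trans hJ)
  have hP' := fun a ha => hP (p a) (mem_image_of_mem p ha)
  refine ⟨fun a => {u | a ∈ J ∧ u ∈ P (p a)}, ⟨fun a u hu => (hP' a hu.1).2.1 hu.2,
    fun a hu => (hP' a hu.1).2.2.2.1 hu.2, fun a b hab => ?_, fun a => ?_⟩, fun a ha => ?_⟩
  · exact Set.disjoint_left.2 fun u hu hu' => Set.disjoint_left.1 (hPd _ (mem_image_of_mem p hu.1) _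
      (mem_image_of_mem p hu'.1) (hpi.ne hab)) hu.2 hu'.2
  · by_cases ha : a ∈ J
    · right
      obtain ⟨v, hv, hpv⟩ := (hp a).2
      refine ⟨?_, p a, ⟨ha, (hP' a ha).1⟩, v, hKH a hv, hpv⟩
      simp only [ha, true_and]
      exact (hP' a ha).2.2.1.mono hle
    · left
      simp [ha]
  · obtain ⟨u, hu, hsu⟩ := (hP' a ha).2.2.2.2
    exact ⟨u, ⟨ha, hu⟩, hle hsu⟩

theorem exists_hooking_legs (hm : 2 ≤ m) (hc : c ∈ A) (hAm : ∀ c ∈ A, c < m + 2)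
    (hK : ∀ a, IsHub m A (K a)) (hKd : ∀ a b, a ≠ b → Disjoint (K a) (K b))
    (hKH : ∀ a, K a ⊆ H a) (hs : s ∈ cluster m c) (J : Finset ι) (hJ : #J ≤ 2 * m - 2)
    {b : ι} (hb : b ∉ J) {f g : Perm ℕ} (hf : f ∈ cluster m c) (hg : g ∈ cluster m c)
    (hfg : (wordGraph (m + 1)).Adj f g) (hsf : s ≠ f) (hsg : s ≠ g)
    (hgH : ∃ v ∈ H b, (wordGraph (m + 2)).Adj g v)
    (hav : ∀ a ∈ J, ∀ v ∈ K a, ¬(wordGraph (m + 2)).Adj s v ∧ ¬(wordGraph (m + 2)).Adj f v ∧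
      ¬(wordGraph (m + 2)).Adj g v) :
    ∃ X, IsLegs m c s H X ∧ f ∈ X b ∧
      ∀ a, a = b ∨ a ∈ J → ∃ t ∈ X a, (wordGraph (m + 2)).Adj s t := by
  classical
  obtain ⟨p, hpi, hp⟩ := exists_ports (by omega) hc hK hKd
  have hle : wordGraph (m + 1) ≤ wordGraph (m + 2) := wordGraph_mono (by omega)
  have hpJ : ∀ r, (∀ a ∈ J, ∀ v ∈ K a, ¬(wordGraph (m + 2)).Adj r v) → r ∉ J.image p := by
    intro r hr h
    obtain ⟨a, ha, rfl⟩ := mem_image.1 h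
    obtain ⟨v, hv, hpv⟩ := (hp a).2
    exact hr a ha v hv hpv
  have hcard : #(J.image p) ≤ 2 * m - 2 := card_image_le.trans hJ
  obtain ⟨P, F, hP, hPd, hfF, hgF, hF, hFc, hsF, u₀, hu₀, hsu₀⟩ :=
    exists_hooking_fan (wordGraph (m + 1)) (finite_cluster m c) hs hf hg hfg hsf hsg (J.image p) (by
      rw [coe_image]
      rintro _ ⟨a, -, rfl⟩
      exact (hp a).1) (hpJ s fun a ha v hv => (hav a ha v hv).1)
      (hpJ f fun a ha v hv => (hav a ha v hv).2.1) (hpJ g fun a ha v hv => (hav a ha v hv).2.2)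
      (fun D hD => connectedOn_cluster (superConnected (by omega)) hm (hAm c hc) D (by omega))
      (fun D hD hfD hgD => connectedOn_cluster_of_adj (superConnected (by omega)) hm (hAm c hc) D
        (by omega) hfD hgD hfg)
  have hP' := fun a ha => hP (p a) (mem_image_of_mem p ha)
  have hX : ∀ a, (if a = b then F else {u | a ∈ J ∧ u ∈ P (p a)}) =
      if a = b then F else if a ∈ J then P (p a) else ∅ := by
    intro a
    split_ifs with h1 h2 <;> simp [*]
  refine ⟨fun a => if a = b then F else {u | a ∈ J ∧ u ∈ P (p a)}, ⟨fun a => ?_, fun a => ?_,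
    fun a a' haa => ?_, fun a => ?_⟩, ?_, ?_⟩
  · beta_reduce
    split_ifs with h
    exacts [hF, fun u hu => (hP' a hu.1).2.1 hu.2]
  · beta_reduce
    split_ifs with h
    exacts [hsF, fun hu => (hP' a hu.1).2.2.2.1 hu.2]
  · beta_reduce
    split_ifs with h h' h'
    · exact absurd (h.trans h'.symm) haa
    · exact Set.disjoint_left.2 fun u hu hu' =>
        Set.disjoint_left.1 (hP' a' hu'.1).2.2.2.2.1 hu'.2 hu
    · exact Set.disjoint_left.2 fun u hu hu' =>
        Set.disjoint_left.1 (hP' a hu.1).2.2.2.2.1 hu.2 hu'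
    · exact Set.disjoint_left.2 fun u hu hu' => Set.disjoint_left.1 (hPd _
        (mem_image_of_mem p hu.1) _ (mem_image_of_mem p hu'.1) (hpi.ne haa)) hu.2 hu'.2
  · simp only [hX]
    split_ifs with h h'
    · subst h
      obtain ⟨v, hv, hgv⟩ := hgH
      exact Or.inr ⟨hFc.mono hle, g, hgF, v, hv, hgv⟩
    · obtain ⟨v, hv, hpv⟩ := (hp a).2
      exact Or.inr ⟨(hP' a h').2.2.1.mono hle, p a, (hP' a h').1, v, hKH a hv, hpv⟩
    · exact Or.inl rfl
  · simpa using hfF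
  · intro a ha
    simp only [hX]
    split_ifs with h h'
    · exact ⟨u₀, hu₀, hle hsu₀⟩
    · obtain ⟨u, hu, hsu⟩ := (hP' a h').2.2.2.2.2
      exact ⟨u, hu, hle hsu⟩
    · exact absurd ha (by tauto)

/-- The hubs `K a`, for `a ≠ o`, together with the rest of the middle. -/
def frame (m : ℕ) (A : Finset ℕ) (K : ι → Set (Perm ℕ)) (o a : ι) : Set (Perm ℕ) :=
  {v | v ∈ middle m A ∧ ((a = o ∧ ∀ b, b ≠ o → v ∉ K b) ∨ (a ≠ o ∧ v ∈ K a))}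

theorem subset_frame (hK : ∀ a, IsHub m A (K a)) (hKd : ∀ a b, a ≠ b → Disjoint (K a) (K b))
    (o a : ι) : K a ⊆ frame m A K o a := by
  refine fun v hv => ⟨((hK a).locked hv).1, ?_⟩
  by_cases h : a = o
  · subst h
    exact Or.inl ⟨rfl, fun b hb hvb => Set.disjoint_left.1 (hKd b a hb) hvb hv⟩
  · exact Or.inr ⟨h, hv⟩

theorem isFrame_frame (hm : 3 ≤ m) (hA : #A = 3) (hK : ∀ a, IsHub m A (K a))
    (hKd : ∀ a b, a ≠ b → Disjoint (K a) (K b)) (o : ι) : IsFrame m A (frame m A K o) := by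
  refine ⟨fun a => ?_, fun a v hv => hv.1, fun a b hab => Set.disjoint_left.2 fun v hv hv' => ?_⟩
  · by_cases h : a = o
    · subst h
      convert connectedOn_middle_diff hm hA (R := {v | ∃ b, b ≠ a ∧ v ∈ K b}) ?_ using 1
      · ext v
        simp only [frame, Set.mem_ofPred_eq, Set.mem_sdiff]
        simp
      · rintro v ⟨b, -, hv⟩
        exact ((hK b).locked hv).2
    · convert (hK a).connectedOn using 1
      ext v
      simp only [frame, Set.mem_ofPred_eq]
      exact ⟨fun hv => hv.2.resolve_left (fun hv => h hv.1) |>.2,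
        fun hv => ⟨((hK a).locked hv).1, Or.inr ⟨h, hv⟩⟩⟩
  · obtain ⟨-, ⟨rfl, h⟩ | ⟨h, hv₁⟩⟩ := hv <;> obtain ⟨-, ⟨rfl, k⟩ | ⟨k, hv₂⟩⟩ := hv'
    exacts [hab rfl, h b k hv₂, k a h hv₁, Set.disjoint_left.1 (hKd a b hab) hv₁ hv₂]

/-- A word with an outer neighbour in the middle is adjacent to the rest of the middle. -/
theorem exists_adj_frame (hs : s ∈ words (m + 2)) (h : ¬(s 0 ∈ A ∧ s m ∈ A)) {o : ι}
    (hav : ∀ b, b ≠ o → ∀ v ∈ K b, ¬(wordGraph (m + 2)).Adj s v) :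
    ∃ v ∈ frame m A K o o, (wordGraph (m + 2)).Adj s v := by
  have key : ∀ c, c ∉ A → s 0 = c ∨ s m = c →
      ∃ v ∈ frame m A K o o, (wordGraph (m + 2)).Adj s v := by
    intro c hc hsc
    obtain ⟨v, hv, hsv⟩ := exists_outer hs hsc
    exact ⟨v, ⟨⟨hv.1, hv.2.symm ▸ hc⟩, Or.inl ⟨rfl, fun b hb hvb => hav b hb v hvb hsv⟩⟩, hsv⟩
  by_cases h0 : s 0 ∈ A
  · exact key _ (fun hm => h ⟨h0, hm⟩) (Or.inr rfl)
  · exact key _ h0 (Or.inl rfl)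

theorem not_adj_middle (hs : s (m + 1) ∈ A) (h0 : s 0 ∈ A) (hm : s m ∈ A) (hv : v ∈ middle m A) :
    ¬(wordGraph (m + 2)).Adj s v := by
  intro hsv
  refine hv.2 ?_
  obtain rfl | rfl := eq_outer_of_adj hsv fun h => hv.2 (h ▸ hs)
  · rwa [mul_swap_apply, if_neg (by omega), if_pos rfl]
  · rwa [mul_swap_apply, if_neg (by omega), if_pos rfl]

/-- Three words with different last symbols, each with an outer neighbour in the middle. -/
theorem hasPacking_of_not_mem (hm : 3 ≤ m) (hA : #A = 3) (hAm : ∀ c ∈ A, c < m + 2)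
    (hi : i ∈ A) (hj : j ∈ A) (hl : l ∈ A) (hij : i ≠ j) (hil : i ≠ l) (hjl : j ≠ l)
    (hx : x ∈ cluster m i) (hy : y ∈ cluster m j) (hz : z ∈ cluster m l)
    (hxA : ¬(x 0 ∈ A ∧ x m ∈ A)) (hyA : ¬(y 0 ∈ A ∧ y m ∈ A)) (hzA : ¬(z 0 ∈ A ∧ z m ∈ A)) :
    HasPacking (wordGraph (m + 2)) (words (m + 2)) {x, y, z} (2 * (m + 2) - 4) := by
  classical
  obtain ⟨p, hp⟩ := exists_guard (p := x) (m := m) (by omega) A (hx.2.symm ▸ hi)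
  obtain ⟨q, hq⟩ := exists_guard (p := y) (m := m) (by omega) A (hy.2.symm ▸ hj)
  obtain ⟨r, hr⟩ := exists_guard (p := z) (m := m) (by omega) A (hz.2.symm ▸ hl)
  obtain ⟨k, rfl⟩ := Nat.exists_eq_add_of_le hm
  obtain ⟨K, hK, hKd, hKD⟩ := exists_hubs (κ := Fin (2 * (3 + k))) (by omega) hA hAm {p, q, r} (by
    have := card_le_three (a := p) (b := q) (c := r)
    rw [Fintype.card_fin, show 3 + k - 1 = k + 2 by omega]
    nlinarith)
  have hout : ∀ {c s g}, (∀ v, Locked (3 + k) A v → (wordGraph (3 + k + 2)).Adj s v → v = g) →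
      g ∈ ({p, q, r} : Finset (Perm ℕ)) → c ∈ A → s ∈ cluster (3 + k) c →
      ¬(s 0 ∈ A ∧ s (3 + k) ∈ A) → ∃ X, IsLegs (3 + k) c s (frame (3 + k) A K ⟨0, by omega⟩) X ∧
        ∀ a, ∃ t ∈ frame (3 + k) A K ⟨0, by omega⟩ a ∪ X a, (wordGraph (3 + k + 2)).Adj s t := by
    intro c s g hg hgD hc hs hsA
    have hav : ∀ a, ∀ v ∈ K a, ¬(wordGraph (3 + k + 2)).Adj s v := fun a v hv hsv =>
      hKD a g hgD (hg v ((hK a).locked hv) hsv ▸ hv)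
    obtain ⟨X, hX, hX'⟩ := exists_legs (by omega) hc hAm hK hKd (subset_frame hK hKd ⟨0, by omega⟩)
      hs (univ.erase ⟨0, by omega⟩) (by
        rw [card_erase_of_mem (mem_univ _), card_univ, Fintype.card_fin]) fun a _ => hav a
    refine ⟨X, hX, fun a => ?_⟩
    by_cases ha : a = ⟨0, by omega⟩
    · subst ha
      obtain ⟨v, hv, hsv⟩ := exists_adj_frame hs.1 hsA fun b _ => hav b
      exact ⟨v, Or.inl hv, hsv⟩
    · obtain ⟨t, ht, hst⟩ := hX' a (mem_erase.2 ⟨ha, mem_univ _⟩)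
      exact ⟨t, Or.inr ht, hst⟩
  obtain ⟨X, hX, hxT⟩ := hout hp (by simp) hi hx hxA
  obtain ⟨Y, hY, hyT⟩ := hout hq (by simp) hj hy hyA
  obtain ⟨Z, hZ, hzT⟩ := hout hr (by simp) hl hz hzA
  refine (isFrame_frame hm hA hK hKd _).hasPacking (by rw [Nat.card_fin]) hi hj hl hij hil hjl
    hx hy hz hX hY hZ ⟨0, by omega⟩ (fun a => ?_) (fun a => ?_) fun a => Or.inl ?_
  · obtain ⟨t, ht, h⟩ := hxT a
    exact ⟨t, by simp only [Set.mem_union] at ht ⊢; tauto, h⟩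
  · obtain ⟨t, ht, h⟩ := hzT a
    exact ⟨t, by simp only [Set.mem_union] at ht ⊢; tauto, h⟩
  · obtain ⟨t, ht, h⟩ := hyT a
    exact ⟨t, by simp only [Set.mem_union] at ht ⊢; tauto, h⟩

end Distinct

section Hooked

open Equiv

variable {m c i j l μ : ℕ} {A : Finset ℕ} {f s u v x y z : Perm ℕ}

theorem mem_of_adj_of_ne (hu : u (m + 1) ∈ A) (h0 : u 0 ∈ A) (hm : u m ∈ A)
    (h : (wordGraph (m + 2)).Adj u v) (hne : v (m + 1) ≠ u (m + 1)) : v 0 ∈ A ∧ v m ∈ A := by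
  obtain rfl | rfl := eq_outer_of_adj h hne
  · rw [mul_swap_apply, if_pos rfl, mul_swap_apply]
    refine ⟨hu, ?_⟩
    split_ifs
    exacts [hu, h0, hm]
  · rw [mul_swap_apply, mul_swap_apply, if_pos rfl]
    refine ⟨?_, hu⟩
    split_ifs
    exacts [hu, hm, h0]

/-- A word without outer neighbour in the middle has a neighbour with one. -/
theorem exists_exit (hm : 1 ≤ m) (hc : c ∈ A) (hf : f ∈ cluster m c) (h0 : f 0 ∈ A) (hfm : f m ∈ A)
    (hμ : μ < m + 2) (hμA : μ ∉ A) : ∃ t g h, 1 ≤ t ∧ t < m ∧ g ∈ cluster m c ∧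
      (wordGraph (m + 1)).Adj f g ∧ g 0 = μ ∧ (wordGraph (m + 2)).Adj g h ∧ h 0 = c ∧
      h m = f m ∧ h t = f 0 ∧ h (m + 1) = μ ∧ Locked m A h := by
  obtain ⟨t, ht, hft⟩ := exists_position hf.1 hμ
  have hne : ∀ p, f p ∈ A → t ≠ p := by
    rintro p hp rfl
    exact hμA (hft ▸ hp)
  have h1 := hne 0 h0
  have h2 := hne m hfm
  have h3 := hne (m + 1) (hf.2.symm ▸ hc)
  have hadj : (wordGraph (m + 1)).Adj f (f * swap 0 t) := adj_star f (by omega) (by omega)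
  have hg := mem_cluster_of_adj hadj hf
  have e0 : (f * swap 0 t * swap 0 (m + 1)) 0 = c := by rw [mul_swap_apply, if_pos rfl, hg.2]
  have em : (f * swap 0 t * swap 0 (m + 1)) m = f m := by
    rw [mul_swap_apply, if_neg (by omega), if_neg (by omega), mul_swap_apply, if_neg (by omega),
      if_neg (by omega)]
  have el : (f * swap 0 t * swap 0 (m + 1)) (m + 1) = μ := by
    rw [mul_swap_apply, if_neg (by omega), if_pos rfl, mul_swap_apply, if_pos rfl, hft]
  refine ⟨t, f * swap 0 t, f * swap 0 t * swap 0 (m + 1), by omega, by omega, hg, hadj, ?_,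
    adj_star _ (by omega) (by omega), e0, em, ?_, el, ⟨(star_mem_cluster hg.1).1, ?_⟩, ?_, ?_⟩
  · rw [mul_swap_apply, if_pos rfl, hft]
  · rw [mul_swap_apply, if_neg (by omega), if_neg (by omega), mul_swap_apply, if_neg (by omega),
      if_pos rfl]
  · rwa [el]
  · rwa [e0]
  · rwa [em]

theorem exists_fresh (hm : 3 ≤ m) (hA : #A = 3) (b : ℕ) : ∃ μ < m + 2, μ ∉ A ∧ μ ≠ b := by
  obtain ⟨μ, hμ, h⟩ := exists_mem_notMem_of_card_lt_card (s := insert b A) (t := range (m + 2)) (by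
    have := card_insert_le b A
    rw [card_range]
    omega)
  rw [mem_insert, not_or] at h
  exact ⟨μ, mem_range.1 hμ, h.2, h.1⟩

theorem exists_hooked_legs (hm : 3 ≤ m) (hA : #A = 3) (hAm : ∀ c ∈ A, c < m + 2)
    (hAe : ∀ c ∈ A, c = i ∨ c = j ∨ c = l) (hi : i ∈ A) (hl : l ∈ A) (hil : i ≠ l)
    (hx : x ∈ cluster m i) (hz : z ∈ cluster m l)
    (hx0 : x 0 ∈ A) (hxm : x m ∈ A) (hzA : ¬(z 0 ∈ A ∧ z m ∈ A))
    (hμ : μ < m + 2) (hμA : μ ∉ A) (hμz : μ ≠ z 0) (D : Finset (Perm ℕ)) (hD : #D ≤ 3) :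
    ∃ (K : Fin (2 * m) → Set (Perm ℕ)) (o w : Fin (2 * m)) (Z : Fin (2 * m) → Set (Perm ℕ)),
      o ≠ w ∧ (∀ a, IsHub m A (K a)) ∧ (∀ a b, a ≠ b → Disjoint (K a) (K b)) ∧
      (∀ a, a ≠ w → ∀ v ∈ D, v ∉ K a) ∧ (∀ v ∈ K w, v (m + 1) = μ) ∧
      IsLegs m l z (frame m A K o) Z ∧
      (∀ a, ∃ t ∈ frame m A K o a ∪ Z a, (wordGraph (m + 2)).Adj z t) ∧
      ∃ f ∈ Z w, (wordGraph (m + 2)).Adj x f := by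
  classical
  have hxl : x 0 = l ∨ x m = l := by
    have h0 := (hAe _ hx0).resolve_left fun h => apply_ne x (by omega) (h.trans hx.2.symm)
    have hm := (hAe _ hxm).resolve_left fun h => apply_ne x (by omega) (h.trans hx.2.symm)
    have h0m : x 0 ≠ x m := apply_ne x (by omega)
    obtain h0 | h0 := h0
    · exact Or.inr (hm.resolve_left fun h => h0m (h0.trans h.symm))
    · exact Or.inl h0
  obtain ⟨f, hf, hxf⟩ := exists_outer hx.1 hxl
  obtain ⟨hf0, hfm⟩ := mem_of_adj_of_ne (hx.2.symm ▸ hi) hx0 hxm hxf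
    (by rw [hx.2, hf.2]; exact hil.symm)
  obtain ⟨t, g, h, ht1, ht2, hg, hfg, hg0, hgh, hh0, hhm, hht, hhl, hh⟩ :=
    exists_exit (by omega) hl hf hf0 hfm hμ hμA
  have hW : IsHub m A {h, h * swap 0 t} := by
    refine ⟨h, t, hh, ht1, ht2, hht.symm ▸ hf0, fun c hc => ?_, rfl⟩
    rw [hh0, hhm, hht]
    have h0l : f 0 ≠ l := hf.2 ▸ apply_ne f (by omega)
    have hml : f m ≠ l := hf.2 ▸ apply_ne f (by omega)
    have h0m : f 0 ≠ f m := apply_ne f (by omega)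
    have h1 := (hAe _ hf0)
    have h2 := (hAe _ hfm)
    have h3 := hAe c hc
    omega
  have hWl : ∀ v ∈ ({h, h * swap 0 t} : Set (Perm ℕ)), v (m + 1) = μ ∧ v m ≠ l := by
    have hml : f m ≠ l := hf.2 ▸ apply_ne f (by omega)
    rintro v (rfl | rfl)
    · exact ⟨hhl, hhm.trans_ne hml⟩
    · rw [mul_swap_apply, if_neg (by omega), if_neg (by omega), mul_swap_apply, if_neg (by omega),
        if_neg (by omega)]
      exact ⟨hhl, hhm.trans_ne hml⟩
  obtain ⟨r, hr⟩ := exists_guard (p := z) (m := m) (by omega) A (hz.2.symm ▸ hl)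
  obtain ⟨k, rfl⟩ := Nat.exists_eq_add_of_le hm
  obtain ⟨K₀, hK₀, hKd₀, hKD₀⟩ := exists_hubs (κ := Fin (2 * (3 + k))) (by omega) hA hAm
    (D ∪ {r, h, h * swap 0 t}) (by
      have h1 := card_le_three (a := r) (b := h) (c := h * swap 0 t)
      have h2 := card_union_le D {r, h, h * swap 0 t}
      rw [Fintype.card_fin, show 3 + k - 1 = k + 2 by omega]
      nlinarith)
  let o : Fin (2 * (3 + k)) := ⟨0, by omega⟩
  let w : Fin (2 * (3 + k)) := ⟨1, by omega⟩
  have how : o ≠ w := by simp [o, w]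
  let K := Function.update K₀ w {h, h * swap 0 t}
  have hKw : K w = {h, h * swap 0 t} := Function.update_self ..
  have hKa : ∀ a, a ≠ w → K a = K₀ a := fun a ha => Function.update_of_ne ha ..
  have hK : ∀ a, IsHub (3 + k) A (K a) := by
    intro a
    by_cases ha : a = w
    · rwa [ha, hKw]
    · rw [hKa a ha]
      exact hK₀ a
  have hWd : ∀ a, a ≠ w → Disjoint (K a) (K w) := by
    intro a ha
    rw [hKw, hKa a ha, Set.disjoint_insert_right, Set.disjoint_singleton_right]
    exact ⟨hKD₀ a h (by simp), hKD₀ a _ (by simp)⟩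
  have hKd : ∀ a b, a ≠ b → Disjoint (K a) (K b) := by
    intro a b hab
    by_cases ha : a = w
    · subst ha
      exact (hWd b hab.symm).symm
    by_cases hb : b = w
    · subst hb
      exact hWd a ha
    · rw [hKa a ha, hKa b hb]
      exact hKd₀ a b hab
  have hzK : ∀ a, ∀ v ∈ K a, ¬(wordGraph (3 + k + 2)).Adj z v := by
    intro a v hv hzv
    by_cases ha : a = w
    · subst ha
      rw [hKw] at hv
      obtain ⟨h1, h2⟩ := hWl v hv
      obtain rfl | rfl := eq_outer_of_adj hzv fun h => hμA (h1 ▸ h.symm ▸ hz.2.symm ▸ hl)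
      · rw [mul_swap_apply, if_neg (by omega), if_pos rfl] at h1
        exact hμz h1.symm
      · rw [mul_swap_apply, if_pos rfl] at h2
        exact h2 hz.2
    · have hv' := (hK a).locked hv
      rw [hKa a ha] at hv
      exact hKD₀ a r (by simp) (hr v hv' hzv ▸ hv)
  have hhw : h ∈ K w := hKw ▸ Or.inl rfl
  obtain ⟨Z, hZ, hfZ, hzZ⟩ := exists_hooking_legs (by omega) hl hAm hK hKd
    (subset_frame hK hKd o) hz
    ((univ.erase w).erase o) (by
      rw [card_erase_of_mem (mem_erase.2 ⟨how, mem_univ _⟩), card_erase_of_mem (mem_univ _),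
        card_univ, Fintype.card_fin]
      omega) (b := w) (by simp) hf hg hfg (by rintro rfl; exact hzA ⟨hf0, hfm⟩)
    (by rintro rfl; exact hμz hg0.symm) ⟨h, subset_frame hK hKd o w hhw, hgh⟩
    fun a ha v hv => ⟨hzK a v hv, not_adj_middle (hf.2.symm ▸ hl) hf0 hfm ((hK a).locked hv).1,
      fun hgv => by
        have := ((hK a).locked hv).eq_of_adj (by omega) hh (hg.2.symm ▸ hl) hgv hgh
        exact Set.disjoint_left.1 (hWd a (by simp at ha; exact ha.2)) hv (this ▸ hhw)⟩
  refine ⟨K, o, w, Z, how, hK, hKd, fun a ha v hv => ?_, fun v hv => ?_, hZ, fun a => ?_, f, hfZ,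
    hxf⟩
  · rw [hKa a ha]
    exact hKD₀ a v (mem_union_left _ hv)
  · rw [hKw] at hv
    exact (hWl v hv).1
  · by_cases ha : a = o
    · subst ha
      obtain ⟨v, hv, hzv⟩ := exists_adj_frame hz.1 hzA fun b _ => hzK b
      exact ⟨v, Or.inl hv, hzv⟩
    · obtain ⟨v, hv, hzv⟩ := hzZ a (by simp only [mem_erase, mem_univ]; tauto)
      exact ⟨v, Or.inr hv, hzv⟩

/-- Three words with different last symbols, of which `x` but not `z` has all its outer neighbours
in the three clusters. -/
theorem hasPacking_of_mem (hm : 3 ≤ m) (hA : #A = 3) (hAm : ∀ c ∈ A, c < m + 2)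
    (hAe : ∀ c ∈ A, c = i ∨ c = j ∨ c = l) (hi : i ∈ A) (hj : j ∈ A) (hl : l ∈ A)
    (hij : i ≠ j) (hil : i ≠ l) (hjl : j ≠ l)
    (hx : x ∈ cluster m i) (hy : y ∈ cluster m j) (hz : z ∈ cluster m l)
    (hx0 : x 0 ∈ A) (hxm : x m ∈ A) (hzA : ¬(z 0 ∈ A ∧ z m ∈ A)) :
    HasPacking (wordGraph (m + 2)) (words (m + 2)) {x, y, z} (2 * (m + 2) - 4) := by
  classical
  obtain ⟨μ, hμ, hμA, hμz⟩ := exists_fresh hm hA (z 0)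
  have hhook := exists_hooked_legs hm hA hAm hAe hi hl hil hx hz hx0 hxm hzA hμ hμA hμz
  have hxlegs : ∀ {K : Fin (2 * m) → Set (Perm ℕ)} (o w), (∀ a, IsHub m A (K a)) →
      (∀ a b, a ≠ b → Disjoint (K a) (K b)) → ∃ X, IsLegs m i x (frame m A K o) X ∧
        ∀ a, a ≠ w → ∃ t ∈ X a, (wordGraph (m + 2)).Adj x t := by
    intro K o w hK hKd
    obtain ⟨X, hX, hX'⟩ := exists_legs (by omega) hi hAm hK hKd (subset_frame hK hKd o) hx
      (univ.erase w) (by rw [card_erase_of_mem (mem_univ _), card_univ, Fintype.card_fin])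
      fun a _ v hv => not_adj_middle (hx.2.symm ▸ hi) hx0 hxm ((hK a).locked hv).1
    exact ⟨X, hX, fun a ha => hX' a (by simp [ha])⟩
  by_cases hyA : y 0 ∈ A ∧ y m ∈ A
  · have hylegs : ∀ {K : Fin (2 * m) → Set (Perm ℕ)} (o), (∀ a, IsHub m A (K a)) →
        (∀ a b, a ≠ b → Disjoint (K a) (K b)) → ∃ Y, IsLegs m j y (frame m A K o) Y ∧
          ∀ a, a ≠ o → ∃ t ∈ Y a, (wordGraph (m + 2)).Adj y t := by
      intro K o hK hKd
      obtain ⟨Y, hY, hY'⟩ := exists_legs (by omega) hj hAm hK hKd (subset_frame hK hKd o) hy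
        (univ.erase o) (by rw [card_erase_of_mem (mem_univ _), card_univ, Fintype.card_fin])
        fun a _ v hv => not_adj_middle (hy.2.symm ▸ hj) hyA.1 hyA.2 ((hK a).locked hv).1
      exact ⟨Y, hY, fun a ha => hY' a (by simp [ha])⟩
    have hyi : y 0 = i ∨ y m = i := by
      have h0j : y 0 ≠ j := hy.2 ▸ apply_ne y (by omega)
      have hmj : y m ≠ j := hy.2 ▸ apply_ne y (by omega)
      have h0m : y 0 ≠ y m := apply_ne y (by omega)
      have h1 := hAe _ hyA.1
      have h2 := hAe _ hyA.2
      omega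
    obtain ⟨f, hf, hyf⟩ := exists_outer hy.1 hyi
    by_cases hfx : f = x
    · subst hfx
      obtain ⟨K, o, w, Z, how, hK, hKd, -, -, hZ, hzT, e, he, hxe⟩ := hhook ∅ (by simp)
      obtain ⟨X, hX, hxX⟩ := hxlegs o w hK hKd
      obtain ⟨Y, hY, hyY⟩ := hylegs o hK hKd
      refine (isFrame_frame hm hA hK hKd o).hasPacking (by rw [Nat.card_fin]) hi hj hl hij hil hjl
        hx hy hz hX hY hZ o (fun a => ?_) (fun a => ?_) fun a => ?_
      · by_cases ha : a = w
        · subst ha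
          exact ⟨e, Or.inr he, hxe⟩
        · obtain ⟨t, ht, hxt⟩ := hxX a ha
          exact ⟨t, Or.inl (Or.inl (Or.inr ht)), hxt⟩
      · obtain ⟨t, ht, hzt⟩ := hzT a
        exact ⟨t, by simp only [Set.mem_union] at ht ⊢; tauto, hzt⟩
      · by_cases ha : a = o
        · exact Or.inr ⟨ha, hyf⟩
        · obtain ⟨t, ht, hyt⟩ := hyY a ha
          exact Or.inl ⟨t, Or.inl (Or.inr ht), hyt⟩
    · obtain ⟨hf0, hfm⟩ := mem_of_adj_of_ne (hy.2.symm ▸ hj) hyA.1 hyA.2 hyf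
        (by rw [hy.2, hf.2]; exact hij)
      obtain ⟨μ', hμ', hμA', hμμ⟩ := exists_fresh hm hA μ
      obtain ⟨t, g, h, -, -, hg, hfg, hg0, hgh, -, -, -, hhl, hh⟩ :=
        exists_exit (by omega) hi hf hf0 hfm hμ' hμA'
      obtain ⟨K, o, w, Z, how, hK, hKd, hKD, hKw, hZ, hzT, e, he, hxe⟩ := hhook {h} (by simp)
      obtain ⟨Y, hY, hyY⟩ := hylegs o hK hKd
      have hhK : ∀ a, h ∉ K a := by
        intro a ha
        by_cases haw : a = w
        · subst haw
          exact hμμ (hhl.symm.trans (hKw h ha))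
        · exact hKD a haw h (by simp) ha
      have hav : ∀ {s}, s ∈ cluster m i → s 0 ∈ A → s m ∈ A → ∀ a, ∀ v ∈ K a,
          ¬(wordGraph (m + 2)).Adj s v := fun hs h0 hsm a v hv =>
        not_adj_middle (hs.2.symm ▸ hi) h0 hsm ((hK a).locked hv).1
      obtain ⟨X, hX, hfX, hxX⟩ := exists_hooking_legs (by omega) hi hAm hK hKd
        (subset_frame hK hKd o) hx ((univ.erase w).erase o) (by
          rw [card_erase_of_mem (mem_erase.2 ⟨how, mem_univ _⟩), card_erase_of_mem (mem_univ _),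
            card_univ, Fintype.card_fin]
          omega) (b := o) (by simp) hf hg hfg (Ne.symm hfx)
        (by rintro rfl; exact hμA' (hg0 ▸ hx0)) ⟨h, ⟨hh.1, Or.inl ⟨rfl, fun b _ => hhK b⟩⟩, hgh⟩
        fun a _ v hv => ⟨hav hx hx0 hxm a v hv, hav hf hf0 hfm a v hv, fun hgv => hhK a
          (((hK a).locked hv).eq_of_adj (by omega) hh (hg.2.symm ▸ hi) hgv hgh ▸ hv)⟩
      refine (isFrame_frame hm hA hK hKd o).hasPacking (by rw [Nat.card_fin]) hi hj hl hij hil hjl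
        hx hy hz hX hY hZ o (fun a => ?_) (fun a => ?_) fun a => Or.inl ?_
      · by_cases ha : a = w
        · subst ha
          exact ⟨e, Or.inr he, hxe⟩
        · obtain ⟨t, ht, hxt⟩ := hxX a (by simp only [mem_erase, mem_univ]; tauto)
          exact ⟨t, Or.inl (Or.inl (Or.inr ht)), hxt⟩
      · obtain ⟨t, ht, hzt⟩ := hzT a
        exact ⟨t, by simp only [Set.mem_union] at ht ⊢; tauto, hzt⟩
      · by_cases ha : a = o
        · subst ha
          exact ⟨f, Or.inl (Or.inl (Or.inr hfX)), hyf⟩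
        · obtain ⟨t, ht, hyt⟩ := hyY a ha
          exact ⟨t, Or.inl (Or.inr ht), hyt⟩
  · obtain ⟨q, hq⟩ := exists_guard (p := y) (m := m) (by omega) A (hy.2.symm ▸ hj)
    obtain ⟨K, o, w, Z, how, hK, hKd, hKD, -, hZ, hzT, e, he, hxe⟩ := hhook {q} (by simp)
    obtain ⟨X, hX, hxX⟩ := hxlegs o w hK hKd
    have hyK : ∀ a, a ≠ w → ∀ v ∈ K a, ¬(wordGraph (m + 2)).Adj y v := fun a ha v hv hyv =>
      hKD a ha q (by simp) (hq v ((hK a).locked hv) hyv ▸ hv)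
    obtain ⟨Y, hY, hyT⟩ : ∃ Y, IsLegs m j y (frame m A K o) Y ∧
        ∀ a, ∃ t ∈ frame m A K o a ∪ Y a, (wordGraph (m + 2)).Adj y t := by
      have hlegs : ∀ b, (∀ a, a ≠ b → ∀ v ∈ K a, ¬(wordGraph (m + 2)).Adj y v) →
          (∃ t ∈ frame m A K o b, (wordGraph (m + 2)).Adj y t) → ∃ Y,
          IsLegs m j y (frame m A K o) Y ∧
            ∀ a, ∃ t ∈ frame m A K o a ∪ Y a, (wordGraph (m + 2)).Adj y t := by
        rintro b hb ⟨t, ht, hyt⟩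
        obtain ⟨Y, hY, hY'⟩ := exists_legs (by omega) hj hAm hK hKd (subset_frame hK hKd o) hy
          (univ.erase b) (by rw [card_erase_of_mem (mem_univ _), card_univ, Fintype.card_fin])
          fun a ha => hb a (by simpa using ha)
        refine ⟨Y, hY, fun a => ?_⟩
        by_cases ha : a = b
        · subst ha
          exact ⟨t, Or.inl ht, hyt⟩
        · obtain ⟨t, ht, hyt⟩ := hY' a (by simp [ha])
          exact ⟨t, Or.inr ht, hyt⟩
      by_cases hyw : ∃ v ∈ K w, (wordGraph (m + 2)).Adj y v
      · obtain ⟨v, hv, hyv⟩ := hyw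
        exact hlegs w hyK ⟨v, subset_frame hK hKd o w hv, hyv⟩
      · have hyK' : ∀ a, ∀ v ∈ K a, ¬(wordGraph (m + 2)).Adj y v := by
          intro a v hv hyv
          by_cases ha : a = w
          · subst ha
            exact hyw ⟨v, hv, hyv⟩
          · exact hyK a ha v hv hyv
        exact hlegs o (fun a _ => hyK' a) (exists_adj_frame hy.1 hyA fun b _ => hyK' b)
    refine (isFrame_frame hm hA hK hKd o).hasPacking (by rw [Nat.card_fin]) hi hj hl hij hil hjl
      hx hy hz hX hY hZ o (fun a => ?_) (fun a => ?_) fun a => Or.inl ?_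
    · by_cases ha : a = w
      · subst ha
        exact ⟨e, Or.inr he, hxe⟩
      · obtain ⟨t, ht, hxt⟩ := hxX a ha
        exact ⟨t, Or.inl (Or.inl (Or.inr ht)), hxt⟩
    · obtain ⟨t, ht, hzt⟩ := hzT a
      exact ⟨t, by simp only [Set.mem_union] at ht ⊢; tauto, hzt⟩
    · obtain ⟨t, ht, hyt⟩ := hyT a
      exact ⟨t, by simp only [Set.mem_union] at ht ⊢; tauto, hyt⟩

end Hooked

section Reflection

open Equiv

variable {n m : ℕ} {A : Finset ℕ} {u v x y z : Perm ℕ}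

/-- The reversal of the positions `1, …, n - 1`. -/
def reversal (n : ℕ) : Perm ℕ :=
  Function.Involutive.toPerm (fun p => if 1 ≤ p ∧ p < n then n - p else p) fun p => by
    beta_reduce
    split_ifs <;> omega

theorem reversal_apply (n p : ℕ) : reversal n p = if 1 ≤ p ∧ p < n then n - p else p := rfl

theorem reversal_mul_reversal (n : ℕ) : reversal n * reversal n = 1 :=
  Equiv.ext fun p => Function.Involutive.toPerm_involutive _ p

theorem reversal_mem_words (n : ℕ) : reversal n ∈ words n := fun p hp => by
  rw [reversal_apply, if_neg (by omega)]

theorem adj_mul_reversal (h : (wordGraph n).Adj u v) :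
    (wordGraph n).Adj (u * reversal n) (v * reversal n) := by
  obtain ⟨s, hs, rfl⟩ := h
  have hconj : ∀ a b, swap a b * reversal n =
      reversal n * swap (reversal n a) (reversal n b) := by
    intro a b
    rw [swap_mul_eq_mul_swap, inv_eq_of_mul_eq_one_left (reversal_mul_reversal n)]
  obtain ⟨i, h1, h2, rfl⟩ | ⟨j, h1, h2, rfl⟩ := mem_gens.1 hs
  · rw [mul_assoc, hconj, ← mul_assoc, reversal_apply, if_neg (by omega), reversal_apply,
      if_pos ⟨h1, h2⟩]
    exact adj_star _ (by omega) (by omega)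
  · rw [mul_assoc, hconj, ← mul_assoc, reversal_apply, if_pos (by omega), reversal_apply,
      if_pos (by omega), swap_comm, show n - j = n - (j + 1) + 1 by omega]
    exact adj_bubble _ (by omega) (by omega)

theorem HasPacking.of_reversal {r : ℕ}
    (h : HasPacking (wordGraph n) (words n) {x * reversal n, y * reversal n, z * reversal n} r) :
    HasPacking (wordGraph n) (words n) {x, y, z} r := by
  have hrr : ∀ u : Perm ℕ, u * reversal n * reversal n = u := fun u => by
    rw [mul_assoc, reversal_mul_reversal, mul_one]
  have hadj : ∀ {u v}, (wordGraph n).Adj (u * reversal n) v →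
      (wordGraph n).Adj u (v * reversal n) := by
    intro u v h
    have := adj_mul_reversal h
    rwa [hrr] at this
  have hconn : ∀ Z, ConnectedOn (wordGraph n) Z →
      ConnectedOn (wordGraph n) ((· * reversal n) ⁻¹' Z) := by
    intro Z h a ha b hb
    have := (h _ ha _ hb).map (Z' := (· * reversal n) ⁻¹' Z) (· * reversal n)
      fun u hu v hv huv => JoinedWithin.single (adj_mul_reversal huv) (by
        rwa [Set.mem_preimage, hrr]) (by rwa [Set.mem_preimage, hrr])
    rwa [hrr, hrr] at this
  have hS : (· * reversal n) ⁻¹' {x * reversal n, y * reversal n, z * reversal n} = {x, y, z} := by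
    ext v
    simp
  obtain ⟨ι, T, a₀, hι, hTK, hTS, hT, hT1, hT0⟩ := h
  refine ⟨ι, fun a => (· * reversal n) ⁻¹' T a, a₀, hι, fun a v hv => ?_, fun a => ?_,
    fun a b hab => (hT a b hab).preimage _, fun a ha => ⟨hconn _ (hT1 a ha).1, fun s hs => ?_⟩, ?_⟩
  · have := mul_mem_words (hTK a hv) (reversal_mem_words n)
    rwa [hrr] at this
  · rw [← hS]
    exact (hTS a).preimage _
  · rw [← hS] at hs
    obtain ⟨t, ht, hst⟩ := (hT1 a ha).2 _ hs
    exact ⟨t * reversal n, by rwa [Set.mem_preimage, hrr], hadj hst⟩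
  · rw [← hS, ← Set.preimage_union]
    exact hconn _ hT0

theorem HasPacking.perm_left {r : ℕ} {G : SimpleGraph (Perm ℕ)} {K : Set (Perm ℕ)}
    (h : HasPacking G K {y, x, z} r) : HasPacking G K {x, y, z} r := by
  rwa [Set.insert_comm]

theorem HasPacking.perm_right {r : ℕ} {G : SimpleGraph (Perm ℕ)} {K : Set (Perm ℕ)}
    (h : HasPacking G K {x, z, y} r) : HasPacking G K {x, y, z} r := by
  rwa [Set.pair_comm]

/-- Three words which do not end in three different symbols. -/
theorem hasPacking_of_eq (hm : 2 ≤ m) (ih : TriplyConnected (m + 1)) (hx : x ∈ words (m + 2))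
    (hy : y ∈ words (m + 2)) (hz : z ∈ words (m + 2)) (hxy : x ≠ y) (hxz : x ≠ z) (hyz : y ≠ z)
    (h : x (m + 1) = y (m + 1) ∨ x (m + 1) = z (m + 1) ∨ y (m + 1) = z (m + 1)) :
    HasPacking (wordGraph (m + 2)) (words (m + 2)) {x, y, z} (2 * (m + 2) - 4) := by
  have hlt : ∀ {u}, u ∈ words (m + 2) → u (m + 1) < m + 2 := fun hu => apply_lt hu (by omega)
  by_cases h1 : x (m + 1) = y (m + 1)
  · by_cases h2 : x (m + 1) = z (m + 1)
    · exact hasPacking_of_same_cluster hm ih (hlt hx) ⟨hx, rfl⟩ ⟨hy, h1.symm⟩ ⟨hz, h2.symm⟩ hxy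
        hxz hyz
    · exact hasPacking_of_two_clusters hm (hlt hx) (hlt hz) h2 ⟨hx, rfl⟩ ⟨hy, h1.symm⟩ ⟨hz, rfl⟩ hxy
  · obtain h2 | h2 := h.resolve_left h1
    · exact (hasPacking_of_two_clusters hm (hlt hx) (hlt hy) h1 ⟨hx, rfl⟩ ⟨hz, h2.symm⟩ ⟨hy, rfl⟩
        hxz).perm_right
    · exact (hasPacking_of_two_clusters hm (hlt hy) (hlt hx) (Ne.symm h1) ⟨hy, rfl⟩ ⟨hz, h2.symm⟩
        ⟨hx, rfl⟩ hyz).perm_right.perm_left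

/-- The words of a triple differ pairwise in their last symbols and in their second symbols. -/
def Spread (m : ℕ) (x y z : Perm ℕ) : Prop :=
  ((x (m + 1) ≠ y (m + 1)) ∧ (x (m + 1) ≠ z (m + 1)) ∧ y (m + 1) ≠ z (m + 1)) ∧
    x 1 ≠ y 1 ∧ x 1 ≠ z 1 ∧ y 1 ≠ z 1

theorem mul_reversal_apply_last (u : Perm ℕ) : (u * reversal (m + 2)) (m + 1) = u 1 := by
  rw [Perm.mul_apply, reversal_apply, if_pos (by omega), show m + 2 - (m + 1) = 1 by omega]

theorem triplyConnected_of_spread (hm : 2 ≤ m) (ih : TriplyConnected (m + 1))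
    (h : ∀ x ∈ words (m + 2), ∀ y ∈ words (m + 2), ∀ z ∈ words (m + 2), Spread m x y z →
      HasPacking (wordGraph (m + 2)) (words (m + 2)) {x, y, z} (2 * (m + 2) - 4)) :
    TriplyConnected (m + 2) := by
  intro x hx y hy z hz hxy hxz hyz
  by_cases hl : x (m + 1) = y (m + 1) ∨ x (m + 1) = z (m + 1) ∨ y (m + 1) = z (m + 1)
  · exact hasPacking_of_eq hm ih hx hy hz hxy hxz hyz hl
  by_cases hf : x 1 = y 1 ∨ x 1 = z 1 ∨ y 1 = z 1
  · have hr := reversal_mem_words (m + 2)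
    have hne := mul_left_injective (reversal (m + 2))
    refine (hasPacking_of_eq hm ih (mul_mem_words hx hr) (mul_mem_words hy hr)
      (mul_mem_words hz hr) (hne.ne hxy) (hne.ne hxz) (hne.ne hyz) ?_).of_reversal
    simpa only [mul_reversal_apply_last] using hf
  · exact h x hx y hy z hz (by unfold Spread; tauto)

theorem hasPacking_of_spread (hm : 3 ≤ m) (hx : x ∈ words (m + 2)) (hy : y ∈ words (m + 2))
    (hz : z ∈ words (m + 2)) (h : Spread m x y z) :
    HasPacking (wordGraph (m + 2)) (words (m + 2)) {x, y, z} (2 * (m + 2) - 4) := by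
  obtain ⟨⟨hxy, hxz, hyz⟩, h1xy, h1xz, h1yz⟩ := h
  have hlt : ∀ {u}, u ∈ words (m + 2) → u (m + 1) < m + 2 := fun hu => apply_lt hu (by omega)
  let A : Finset ℕ := {x (m + 1), y (m + 1), z (m + 1)}
  have hA : #A = 3 := card_eq_three.2 ⟨_, _, _, hxy, hxz, hyz, rfl⟩
  have hAe : ∀ c ∈ A, c = x (m + 1) ∨ c = y (m + 1) ∨ c = z (m + 1) := by simp [A]
  have hAm : ∀ c ∈ A, c < m + 2 := by
    intro c hc
    obtain rfl | rfl | rfl := hAe c hc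
    exacts [hlt hx, hlt hy, hlt hz]
  have hxA : x (m + 1) ∈ A := by simp [A]
  have hyA : y (m + 1) ∈ A := by simp [A]
  have hzA : z (m + 1) ∈ A := by simp [A]
  by_cases hx' : x 0 ∈ A ∧ x m ∈ A
  · by_cases hz' : z 0 ∈ A ∧ z m ∈ A
    · by_cases hy' : y 0 ∈ A ∧ y m ∈ A
      · have key : ∀ u : Perm ℕ, u (m + 1) ∈ A → u 0 ∈ A → u m ∈ A → u 1 ∉ A := by
          intro u h1 h2 h3 h4
          have hsub : ({u 0, u m, u 1, u (m + 1)} : Finset ℕ) ⊆ A := by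
            simp only [insert_subset_iff, singleton_subset_iff]
            exact ⟨h2, h3, h4, h1⟩
          have := card_le_card hsub
          rw [card_insert_of_notMem, card_insert_of_notMem, card_pair (apply_ne u (by omega))]
            at this
          · omega
          · simp only [mem_insert, mem_singleton, u.injective.eq_iff]
            omega
          · simp only [mem_insert, mem_singleton, u.injective.eq_iff]
            omega
        have hx1 := key x hxA hx'.1 hx'.2
        have hy1 := key y hyA hy'.1 hy'.2
        have hz1 := key z hzA hz'.1 hz'.2
        have hr := reversal_mem_words (m + 2)
        have hB : ∀ u : Perm ℕ, u 0 ∈ A →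
            ¬((u * reversal (m + 2)) 0 ∈ ({x 1, y 1, z 1} : Finset ℕ) ∧
              (u * reversal (m + 2)) m ∈ ({x 1, y 1, z 1} : Finset ℕ)) := by
          rintro u hu ⟨h, -⟩
          rw [Perm.mul_apply, reversal_apply, if_neg (by omega)] at h
          simp only [mem_insert, mem_singleton] at h
          obtain h | h | h := h
          exacts [hx1 (h ▸ hu), hy1 (h ▸ hu), hz1 (h ▸ hu)]
        refine (hasPacking_of_not_mem (A := {x 1, y 1, z 1}) hm
          (card_eq_three.2 ⟨_, _, _, h1xy, h1xz, h1yz, rfl⟩) ?_ (i := x 1) (j := y 1) (l := z 1)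
          (by simp) (by simp) (by simp) h1xy h1xz h1yz
          ⟨mul_mem_words hx hr, mul_reversal_apply_last x⟩
          ⟨mul_mem_words hy hr, mul_reversal_apply_last y⟩
          ⟨mul_mem_words hz hr, mul_reversal_apply_last z⟩
          (hB x hx'.1) (hB y hy'.1) (hB z hz'.1)).of_reversal
        intro c hc
        simp only [mem_insert, mem_singleton] at hc
        obtain rfl | rfl | rfl := hc
        exacts [apply_lt hx (by omega), apply_lt hy (by omega), apply_lt hz (by omega)]
      · exact (hasPacking_of_mem hm hA hAm (fun c hc => (by have := hAe c hc; tauto)) hxA hzA hyA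
          hxz hxy hyz.symm ⟨hx, rfl⟩ ⟨hz, rfl⟩ ⟨hy, rfl⟩ hx'.1 hx'.2 hy').perm_right
    · exact hasPacking_of_mem hm hA hAm hAe hxA hyA hzA hxy hxz hyz ⟨hx, rfl⟩ ⟨hy, rfl⟩ ⟨hz, rfl⟩
        hx'.1 hx'.2 hz'
  · by_cases hy' : y 0 ∈ A ∧ y m ∈ A
    · exact (hasPacking_of_mem hm hA hAm (fun c hc => (by have := hAe c hc; tauto)) hyA hzA hxA
        hyz hxy.symm hxz.symm ⟨hy, rfl⟩ ⟨hz, rfl⟩ ⟨hx, rfl⟩ hy'.1 hy'.2 hx').perm_right.perm_left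
    · by_cases hz' : z 0 ∈ A ∧ z m ∈ A
      · exact (hasPacking_of_mem hm hA hAm (fun c hc => (by have := hAe c hc; tauto)) hzA hyA hxA
          hyz.symm hxz.symm hxy.symm ⟨hz, rfl⟩ ⟨hy, rfl⟩ ⟨hx, rfl⟩ hz'.1 hz'.2
          hx').perm_left.perm_right.perm_left
      · exact hasPacking_of_not_mem hm hA hAm hxA hyA hzA hxy hxz hyz ⟨hx, rfl⟩ ⟨hy, rfl⟩ ⟨hz, rfl⟩
          hx' hy' hz'

end Reflection

section Certificates

variable {V : Type} {G : SimpleGraph V} {K : Set V}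

theorem HasPacking.of_lists (S L : List V) (Ts : List (List V)) (hSK : ∀ u ∈ L ++ Ts.flatten, u ∈ K)
    (hnd : (L ++ Ts.flatten).Nodup) (hS : ∀ s ∈ S, s ∈ L) (hL : ConnectedOn G {v | v ∈ L})
    (hTs : ∀ t ∈ Ts, ConnectedOn G {v | v ∈ t} ∧ ∀ s ∈ S, ∃ u ∈ t, G.Adj s u) :
    HasPacking G K {v | v ∈ S} (Ts.length + 1) := by
  obtain ⟨-, h1, h2⟩ := List.nodup_append'.1 hnd
  have hsub : ∀ i : Fin Ts.length, ∀ v ∈ Ts[i], v ∈ Ts.flatten := fun i v hv =>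
    List.mem_flatten_of_mem (List.getElem_mem _) hv
  have hpw := (List.nodup_flatten.1 h1).2
  rw [List.pairwise_iff_getElem] at hpw
  refine ⟨Option (Fin Ts.length),
    fun a => a.elim ({v | v ∈ L} \ {v | v ∈ S}) fun i => {v | v ∈ Ts[i]},
    none, by simp, ?_, ?_, ?_, ?_, ?_⟩
  · rintro (_ | i) v hv
    exacts [hSK v (List.mem_append_left _ hv.1), hSK v (List.mem_append_right _ (hsub i v hv))]
  · rintro (_ | i)
    · exact Set.disjoint_sdiff_left
    · exact Set.disjoint_left.2 fun v hv hvS => h2 (hS v hvS) (hsub i v hv)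
  · rintro (_ | i) (_ | j) hij
    · exact absurd rfl hij
    · exact Set.disjoint_left.2 fun v hv hv' => h2 hv.1 (hsub j v hv')
    · exact Set.disjoint_left.2 fun v hv hv' => h2 hv'.1 (hsub i v hv)
    · refine Set.disjoint_left.2 fun v hv hv' => ?_
      obtain h | h := lt_or_gt_of_ne fun h : (i : ℕ) = j => hij (congrArg some (Fin.ext h))
      exacts [hpw i j i.2 j.2 h hv hv', hpw j i j.2 i.2 h hv' hv]
  · rintro (_ | i) hi
    · exact absurd rfl hi
    · exact hTs _ (List.getElem_mem _)
  · convert hL using 1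
    ext v
    simp only [Option.elim, Set.mem_union, Set.mem_sdiff, Set.mem_ofPred_eq]
    have := hS v
    tauto

/-- Every entry of the list but the last is adjacent to a later one. -/
def linked {ι : Type} (adj : ι → ι → Bool) : List ι → Bool
  | [] => true
  | v :: l => (l.isEmpty || l.any (adj v)) && linked adj l

theorem connectedOn_of_linked {ι : Type} {adj : ι → ι → Bool} {f : ι → V}
    (hadj : ∀ u v, adj u v = true → G.Adj (f u) (f v)) :
    ∀ l : List ι, linked adj l = true → ConnectedOn G {v | v ∈ l.map f}
  | [], _ => fun a ha => absurd ha (by simp)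
  | v :: l, h => by
    rw [linked, Bool.and_eq_true, Bool.or_eq_true, List.isEmpty_iff, List.any_eq_true] at h
    have ih := connectedOn_of_linked hadj l h.2
    have heq : {u | u ∈ (v :: l).map f} = insert (f v) {u | u ∈ l.map f} := by
      ext u
      simp
    rw [heq]
    obtain rfl | ⟨u, hu, huv⟩ := h.1
    · simpa using ConnectedOn.singleton (G := G) (f v)
    · exact ih.insert_of_adj (List.mem_map_of_mem hu) (hadj _ _ huv)

/-- A check that `L`, which contains `S`, and the lists in `Ts` form a packing. -/
def isPacking {ι : Type} [DecidableEq ι] (adj : ι → ι → Bool) (S L : List ι) (Ts : List (List ι)) :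
    Bool :=
  decide (L ++ Ts.flatten).Nodup && S.all (fun s => L.contains s) && linked adj L &&
    Ts.all fun t => linked adj t && S.all fun s => t.any (adj s)

theorem HasPacking.of_isPacking {ι : Type} [DecidableEq ι] {adj : ι → ι → Bool} {f : ι → V}
    (hf : Function.Injective f) (hK : ∀ i, f i ∈ K)
    (hadj : ∀ u v, adj u v = true → G.Adj (f u) (f v)) {S L : List ι} {Ts : List (List ι)}
    (h : isPacking adj S L Ts = true) :
    HasPacking G K {v | v ∈ S.map f} (Ts.length + 1) := by
  simp only [isPacking, Bool.and_eq_true, decide_eq_true_eq, List.all_eq_true, List.any_eq_true,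
    List.contains_iff_mem] at h
  obtain ⟨⟨⟨h1, h2⟩, h3⟩, h4⟩ := h
  have hflat : L.map f ++ (Ts.map (List.map f)).flatten = (L ++ Ts.flatten).map f := by
    rw [List.map_append, List.map_flatten]
  have := HasPacking.of_lists (G := G) (K := K) (S.map f) (L.map f) (Ts.map (List.map f))
    (by
      rw [hflat]
      intro u hu
      obtain ⟨i, -, rfl⟩ := List.mem_map.1 hu
      exact hK i) (by rw [hflat]; exact h1.map hf) (by
      intro s hs
      obtain ⟨i, hi, rfl⟩ := List.mem_map.1 hs
      exact List.mem_map_of_mem (h2 i hi)) (connectedOn_of_linked hadj L h3) (by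
      intro t' ht'
      obtain ⟨t, ht, rfl⟩ := List.mem_map.1 ht'
      refine ⟨connectedOn_of_linked hadj t (h4 t ht).1, fun s hs => ?_⟩
      obtain ⟨i, hi, rfl⟩ := List.mem_map.1 hs
      obtain ⟨u, hu, hiu⟩ := (h4 t ht).2 i hi
      exact ⟨f u, List.mem_map_of_mem hu, hadj _ _ hiu⟩)
  rwa [List.length_map] at this

end Certificates

section Small

open Equiv

variable {x y z : Perm ℕ}

theorem triplyConnected_three : TriplyConnected 3 := by
  have hcard : ∀ s : ℤˣ, #(univ.filter fun σ : Perm (Fin 3) => Perm.sign σ = s) = 3 := by decide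
  have hex : ∀ s (D : Finset (Perm (Fin 3))), #D ≤ 2 → ∃ p, Perm.sign p = s ∧ p ∉ D := by
    intro s D hD
    obtain ⟨p, hp, hpD⟩ := exists_mem_notMem_of_card_lt_card (s := D) (lt_of_lt_of_eq
      (Nat.lt_succ_of_le hD) (hcard s).symm)
    exact ⟨p, (mem_filter.1 hp).2, hpD⟩
  have hneg : ∀ s : ℤˣ, s ≠ -s := by decide
  have key : ∀ σ τ ρ : Perm (Fin 3), Perm.sign σ = Perm.sign τ → σ ≠ τ → σ ≠ ρ → τ ≠ ρ →
      HasPacking (wordGraph 3) (words 3) {toWord 3 σ, toWord 3 τ, toWord 3 ρ} 2 := by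
    intro σ τ ρ hστ h1 h2 h3
    let adj : Perm (Fin 3) → Perm (Fin 3) → Bool := fun a b => decide (Perm.sign a ≠ Perm.sign b)
    have hpack : ∀ {L Ts}, isPacking adj [σ, τ, ρ] L [Ts] = true →
        HasPacking (wordGraph 3) (words 3) {toWord 3 σ, toWord 3 τ, toWord 3 ρ} 2 := by
      intro L Ts h
      have : HasPacking _ _ _ 2 := HasPacking.of_isPacking (G := wordGraph 3) (K := words 3)
        (toWord_injective 3)
        (fun σ => range_toWord 3 ▸ Set.mem_range_self σ)
        (fun u v huv => adj_toWord_three (of_decide_eq_true huv)) h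
      convert this using 1
      ext v
      simp
    obtain ⟨q, hq, hqD⟩ := hex (-Perm.sign σ) {ρ} (by simp)
    obtain ⟨r, hr, hrD⟩ := hex (-Perm.sign σ) {ρ, q} card_le_two
    have hσ := hneg (Perm.sign σ)
    have hne : ∀ a b : Perm (Fin 3), Perm.sign a = Perm.sign σ → Perm.sign b = -Perm.sign σ →
        a ≠ b := by
      rintro a b ha hb rfl
      exact hσ (ha.symm.trans hb)
    by_cases hρ : Perm.sign ρ = Perm.sign σ
    · refine hpack (L := [σ, τ, ρ, q]) (Ts := [r]) ?_
      rw [mem_insert, mem_singleton, not_or] at hrD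
      simp [isPacking, linked, adj, ← hστ, hρ, hq, hr, hσ, h1, h2, h3, hne σ q rfl hq,
        hne σ r rfl hr, hne τ q hστ.symm hq, hne τ r hστ.symm hr, hne ρ q hρ hq, hne ρ r hρ hr,
        Ne.symm hrD.2]
    · obtain ⟨p, hp, hpD⟩ := hex (Perm.sign σ) {σ, τ} card_le_two
      refine hpack (L := [ρ, τ, q, σ]) (Ts := [p, r]) ?_
      replace hρ := Int.units_ne_iff_eq_neg.1 hρ
      rw [mem_singleton] at hqD
      rw [mem_insert, mem_singleton, not_or] at hrD hpD
      simp [isPacking, linked, adj, ← hστ, hρ, hq, hr, hp, hσ, hσ.symm, h1, h2, h3, h1.symm,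
        h2.symm, h3.symm, hne σ q rfl hq, hne σ r rfl hr, (hne σ q rfl hq).symm, Ne.symm hqD,
        Ne.symm hrD.1, Ne.symm hrD.2, hne τ q hστ.symm hq, hne τ r hστ.symm hr, hne p r hp hr,
        (hne p ρ hp hρ).symm, (hne p q hp hq).symm, Ne.symm hpD.1, Ne.symm hpD.2]
  rintro x hx y hy z hz hxy hxz hyz
  rw [← range_toWord] at hx hy hz
  obtain ⟨σ, rfl⟩ := hx
  obtain ⟨τ, rfl⟩ := hy
  obtain ⟨ρ, rfl⟩ := hz
  rw [(toWord_injective 3).ne_iff] at hxy hxz hyz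
  have hs : ∀ a b c : ℤˣ, a = b ∨ a = c ∨ b = c := by decide
  obtain h | h | h := hs (Perm.sign σ) (Perm.sign τ) (Perm.sign ρ)
  · exact key σ τ ρ h hxy hxz hyz
  · exact (key σ ρ τ h hxz hxy hyz.symm).perm_right
  · exact (key τ ρ σ h hyz hxy.symm hxz.symm).perm_right.perm_left

/-- An enumeration of the permutations of four positions. -/
def perm₄ (i : Fin 24) : Perm (Fin 4) :=
  swap 0 (Fin.ofNat 4 i) * (swap 1 (Fin.ofNat 4 (1 + i / 4 % 3)) *
    swap 2 (Fin.ofNat 4 (2 + i / 12)))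

/-- The adjacency of the words of length four, as bit masks. -/
def adj₄ (i j : Fin 24) : Bool :=
  (([4126, 10337, 49249, 49793, 65761, 655382, 8650774, 4849688, 1117696, 6422792, 7078144,
    9175298, 1105921, 10752002, 4329484, 10489868, 917776, 82592, 76864, 68768, 14684416, 1091072,
    1066624, 1091648] : List ℕ).getD i 0).testBit j

/-- For words `y`, `z` a list containing the words `1`, `y`, `z`, followed by further trees. -/
def packings₄ : List (Fin 24 × Fin 24 × List (Fin 24) × List (List (Fin 24))) :=
  [(7, 8, [8, 9, 7, 3, 0], [[16, 4], [19, 11, 1], [22, 20, 12]]),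
   (7, 10, [10, 7, 22, 14, 2, 0], [[21, 9, 3], [18, 16, 4], [19, 5, 1]]),
   (7, 11, [11, 18, 16, 7, 4, 0], [[23, 15, 3], [17, 5, 1], [22, 12, 20, 8]]),
   (7, 13, [13, 21, 9, 7, 3, 0], [[18, 16, 4], [17, 5, 1], [22, 20, 12]]),
   (7, 18, [18, 16, 7, 4, 0], [[19, 11, 1], [17, 14, 6, 2], [22, 20, 13, 12]]),
   (7, 20, [20, 21, 9, 7, 3, 0], [[22, 14, 2], [23, 6, 4], [19, 8, 11, 1]]),
   (7, 21, [21, 9, 7, 3, 0], [[22, 20, 12], [17, 15, 14, 2], [13, 4, 5, 1]]),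
   (7, 23, [23, 15, 7, 3, 0], [[6, 4], [19, 11, 1], [22, 20, 12]]),
   (8, 13, [13, 8, 11, 1, 0], [[20, 12], [21, 9, 3], [18, 16, 4]]),
   (8, 17, [17, 8, 9, 3, 0], [[16, 4], [11, 5, 1], [20, 14, 12]]),
   (8, 23, [23, 8, 11, 1, 0], [[20, 12], [15, 9, 3], [16, 6, 4]]),
   (9, 11, [9, 17, 11, 5, 1, 0], [[19, 7, 3], [8, 16, 4], [21, 18, 13, 12]]),
   (9, 13, [13, 9, 21, 15, 2, 0], [[12, 14, 3], [17, 5, 1], [18, 8, 16, 4]]),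
   (9, 16, [16, 9, 17, 14, 2, 0], [[19, 7, 3], [12, 20, 8], [21, 18, 13, 1]]),
   (9, 18, [9, 21, 18, 13, 12, 0], [[17, 16, 4], [8, 11, 1], [22, 14, 6, 2]]),
   (9, 19, [19, 9, 7, 3, 0], [[17, 16, 4], [8, 11, 1], [22, 14, 5, 2]]),
   (9, 23, [23, 15, 9, 3, 0], [[21, 13, 1], [22, 20, 12], [17, 14, 6, 2]]),
   (10, 13, [10, 19, 13, 11, 1, 0], [[21, 9, 3], [18, 6, 2], [22, 20, 12]]),
   (10, 17, [10, 22, 17, 14, 2, 0], [[21, 9, 3], [19, 5, 1], [18, 16, 4]]),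
   (10, 23, [23, 10, 21, 15, 2, 0], [[19, 11, 1], [18, 6, 4], [22, 20, 12]]),
   (11, 17, [17, 11, 5, 1, 0], [[18, 16, 4], [19, 7, 3], [23, 20, 14, 12]]),
   (11, 20, [20, 13, 12, 11, 1, 0], [[23, 15, 2], [8, 9, 3], [22, 19, 7, 4]]),
   (11, 21, [21, 13, 11, 1, 0], [[23, 15, 2], [8, 9, 3], [10, 18, 16, 4]]),
   (11, 22, [11, 23, 22, 20, 12, 0], [[19, 7, 3], [14, 17, 5, 1], [9, 8, 16, 4]]),
   (13, 16, [16, 18, 13, 11, 1, 0], [[23, 6, 4], [12, 20, 8], [21, 17, 9, 3]]),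
   (13, 17, [17, 14, 13, 12, 0], [[5, 1], [21, 9, 3], [18, 16, 4]]),
   (13, 19, [19, 13, 11, 1, 0], [[18, 16, 4], [12, 14, 5, 2], [21, 15, 7, 3]]),
   (13, 22, [22, 20, 13, 12, 0], [[21, 9, 3], [23, 15, 14, 2], [7, 19, 11, 1]]),
   (16, 20, [20, 23, 16, 6, 4, 0], [[8, 9, 3], [17, 14, 12], [21, 18, 13, 1]]),
   (16, 21, [21, 16, 18, 13, 1, 0], [[17, 9, 3], [12, 20, 8], [15, 4, 5, 2]]),
   (16, 22, [22, 16, 7, 4, 0], [[17, 14, 2], [12, 20, 8], [10, 18, 13, 1]]),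
   (16, 23, [23, 16, 6, 4, 0], [[18, 13, 1], [12, 20, 8], [17, 15, 14, 3]]),
   (17, 18, [18, 17, 16, 4, 0], [[11, 5, 1], [14, 6, 2], [13, 21, 9, 3]]),
   (17, 20, [20, 17, 14, 12, 0], [[21, 9, 3], [22, 7, 4], [23, 15, 5, 2]]),
   (17, 21, [21, 17, 9, 3, 0], [[20, 14, 12], [13, 5, 1], [10, 18, 16, 4]]),
   (17, 23, [23, 20, 17, 14, 12, 0], [[15, 9, 3], [11, 5, 1], [16, 6, 4]]),
   (18, 20, [20, 18, 13, 12, 0], [[23, 6, 1], [8, 16, 4], [10, 22, 14, 2]]),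
   (18, 21, [21, 18, 13, 1, 0], [[15, 6, 2], [12, 20, 23, 11], [16, 17, 9, 3]]),
   (18, 22, [22, 18, 14, 6, 2, 0], [[16, 7, 4], [20, 13, 12], [10, 8, 11, 1]]),
   (19, 20, [20, 23, 19, 11, 1, 0], [[22, 7, 3], [8, 16, 4], [12, 14, 5, 2]]),
   (19, 21, [21, 19, 13, 5, 1, 0], [[15, 7, 3], [12, 20, 23, 11], [9, 17, 16, 4]]),
   (19, 22, [22, 19, 7, 3, 0], [[14, 5, 2], [12, 15, 21, 10], [20, 8, 16, 4]]),
   (19, 23, [23, 19, 11, 1, 0], [[15, 5, 2], [16, 6, 4], [12, 20, 10, 8]]),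
   (22, 23, [23, 22, 20, 12, 0], [[15, 14, 2], [7, 6, 4], [10, 8, 11, 1]])]

theorem injective_perm₄ : Function.Injective perm₄ := by
  unfold Function.Injective
  decide +kernel

theorem surjective_perm₄ : Function.Surjective perm₄ :=
  ((Fintype.bijective_iff_injective_and_card perm₄).2
    ⟨injective_perm₄, by rw [Fintype.card_perm, Fintype.card_fin, Fintype.card_fin]; rfl⟩).2

theorem exists_swap_of_adj₄ : ∀ i j, adj₄ i j = true →
    ∃ s ∈ [swap 0 1, swap 0 2, swap 0 3, swap 1 2, swap 2 3], perm₄ j = perm₄ i * s := by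
  decide +kernel

theorem isPacking_of_mem_packings₄ : ∀ e ∈ packings₄,
    isPacking adj₄ [0, e.1, e.2.1] e.2.2.1 e.2.2.2 = true ∧ e.2.2.2.length = 3 := by
  decide +kernel

theorem exists_mem_packings₄ : ∀ j k, j < k → (3 ≠ perm₄ j 3 ∧ 3 ≠ perm₄ k 3 ∧
    perm₄ j 3 ≠ perm₄ k 3) ∧ 1 ≠ perm₄ j 1 ∧ 1 ≠ perm₄ k 1 ∧ perm₄ j 1 ≠ perm₄ k 1 →
    ∃ e ∈ packings₄, e.1 = j ∧ e.2.1 = k := by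
  decide +kernel

theorem hasPacking₄_of_spread (hx : x ∈ words 4) (hy : y ∈ words 4)
    (hz : z ∈ words 4) (h : Spread 2 x y z) : HasPacking (wordGraph 4) (words 4) {x, y, z} 4 := by
  obtain ⟨f, hfdef⟩ : ∃ f : Fin 24 → Perm ℕ, ∀ i, f i = toWord 4 (perm₄ i) := ⟨_, fun _ => rfl⟩
  have hf : Function.Injective f := fun i j hij =>
    injective_perm₄ (toWord_injective 4 (by rw [← hfdef, ← hfdef, hij]))
  have hf0 : f 0 = 1 := by
    have : perm₄ 0 = 1 := by decide +kernel
    rw [hfdef, this, map_one]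
  have hfK : ∀ i, f i ∈ words 4 := fun i => by
    rw [hfdef, ← range_toWord]
    exact Set.mem_range_self _
  have hadj : ∀ i j, adj₄ i j = true → (wordGraph 4).Adj (f i) (f j) := by
    intro i j hij
    obtain ⟨s, hs, h⟩ := exists_swap_of_adj₄ i j hij
    refine ⟨toWord 4 s, ?_, by rw [hfdef, hfdef, ← map_mul, ← h]⟩
    simp only [List.mem_cons, List.not_mem_nil, or_false] at hs
    rw [mem_gens]
    obtain rfl | rfl | rfl | rfl | rfl := hs <;> rw [toWord_swap]
    exacts [Or.inl ⟨1, by decide, by decide, rfl⟩, Or.inl ⟨2, by decide, by decide, rfl⟩,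
      Or.inl ⟨3, by decide, by decide, rfl⟩, Or.inr ⟨1, by decide, by decide, rfl⟩,
      Or.inr ⟨2, by decide, by decide, rfl⟩]
  have key : ∀ j k, j < k → Spread 2 1 (f j) (f k) →
      HasPacking (wordGraph 4) (words 4) {1, f j, f k} 4 := by
    intro j k hjk h
    have happ : ∀ i (p : Fin 4), f i p = perm₄ i p := fun i p => by rw [hfdef, toWord_apply]
    have h1 : ∀ i, f i 1 = perm₄ i 1 := fun i => happ i 1
    have h3 : ∀ i, f i (2 + 1) = perm₄ i 3 := fun i => happ i 3
    rw [Spread, ← hf0, h1, h1, h1, h3, h3, h3] at h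
    simp only [ne_eq, Fin.val_inj] at h
    obtain ⟨e, he, rfl, rfl⟩ := exists_mem_packings₄ j k hjk h
    obtain ⟨he1, he2⟩ := isPacking_of_mem_packings₄ e he
    have := HasPacking.of_isPacking (G := wordGraph 4) (K := words 4) hf hfK hadj he1
    rw [he2] at this
    convert this using 1
    ext v
    simp [hf0]
  have hsurj : ∀ u ∈ words 4, ∃ i, f i = u := by
    intro u hu
    rw [← range_toWord] at hu
    obtain ⟨σ, rfl⟩ := hu
    obtain ⟨i, rfl⟩ := surjective_perm₄ σ
    exact ⟨i, hfdef i⟩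
  obtain ⟨j, hj⟩ := hsurj _ (mul_mem_words (inv_mem_words hx) hy)
  obtain ⟨k, hk⟩ := hsurj _ (mul_mem_words (inv_mem_words hx) hz)
  have hsp : Spread 2 1 (f j) (f k) := by
    have hx1 : (1 : Perm ℕ) = x⁻¹ * x := by simp
    rw [hj, hk, hx1]
    simpa only [Spread, Perm.mul_apply, (x⁻¹).injective.ne_iff] using h
  have h1 : HasPacking (wordGraph 4) (words 4) {1, f j, f k} 4 := by
    obtain hjk | rfl | hjk := lt_trichotomy j k
    · exact key j k hjk hsp
    · exact absurd rfl hsp.1.2.2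
    · obtain ⟨⟨a, b, c⟩, d, e, g⟩ := hsp
      exact (key k j hjk ⟨⟨b, a, c.symm⟩, e, d, g.symm⟩).perm_right
  have h2 := h1.mul_left x
  have hK : (x⁻¹ * ·) ⁻¹' words 4 = words 4 := by
    ext u
    refine ⟨fun hu => ?_, fun hu => mul_mem_words (inv_mem_words hx) hu⟩
    have := mul_mem_words hx hu
    rwa [mul_inv_cancel_left] at this
  rw [hK] at h2
  convert h2 using 1
  ext v
  simp only [Set.mem_insert_iff, Set.mem_singleton_iff, Set.mem_preimage, hj, hk, mul_right_inj]
  rw [inv_mul_eq_one, eq_comm]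

theorem triplyConnected {n : ℕ} (hn : 3 ≤ n) : TriplyConnected n := by
  induction n, hn using Nat.le_induction with
  | base => exact triplyConnected_three
  | succ n hn ih =>
    obtain ⟨m, rfl⟩ := Nat.exists_eq_add_of_le' (show 1 ≤ n by omega)
    refine triplyConnected_of_spread (by omega) ih fun x hx y hy z hz h => ?_
    obtain rfl | hm := Nat.eq_or_lt_of_le (show 2 ≤ m by omega)
    · exact hasPacking₄_of_spread hx hy hz h
    · exact hasPacking_of_spread hm hx hy hz h

end Small

section Trees

variable {V : Type*} {G H : SimpleGraph V} {Z S : Set V} {x y z : V} {r : ℕ}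

theorem ConnectedOn.exists_isTree (hZ : ConnectedOn H Z) (hne : Z.Nonempty) (hHG : H ≤ G) :
    ∃ T : G.Subgraph, T.verts = Z ∧ T.coe.IsTree ∧ ∀ u v, T.Adj u v → H.Adj u v := by
  have hreach : ∀ a (ha : a ∈ Z) b, JoinedWithin H Z a b → ∀ hb : b ∈ Z,
      (H.induce Z).Reachable ⟨a, ha⟩ ⟨b, hb⟩ := by
    intro a ha b h
    induction h with
    | refl => exact fun _ => SimpleGraph.Reachable.refl _
    | tail _ h ih => exact fun hb => (ih h.2.1).trans (SimpleGraph.Adj.reachable h.1)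
  have hconn : (H.induce Z).Connected :=
    { preconnected := fun a b => hreach a a.2 b (hZ a a.2 b b.2) b.2
      nonempty := hne.to_subtype }
  obtain ⟨F, hF, hT⟩ := hconn.exists_isTree_le
  refine ⟨⟨Z, fun u v => ∃ hu hv, F.Adj ⟨u, hu⟩ ⟨v, hv⟩, fun h => hHG (hF h.2.2), fun h => h.1,
    ⟨fun _ _ h => ⟨h.2.1, h.1, h.2.2.symm⟩⟩⟩, rfl, ?_, fun u v h => hF h.2.2⟩
  convert hT using 1
  ext u v
  exact ⟨fun h => h.2.2, fun h => ⟨u.2, v.2, h⟩⟩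

theorem exists_adj_of_isTree {T : G.Subgraph} (hT : T.coe.IsTree) (hx : x ∈ T.verts)
    (hy : y ∈ T.verts) (hxy : x ≠ y) : ∃ u, T.Adj x u := by
  by_contra! h
  have : Nontrivial T.verts := ⟨⟨x, hx⟩, ⟨y, hy⟩, fun h => hxy (congrArg Subtype.val h)⟩
  obtain ⟨u, hu⟩ := hT.connected.preconnected.exists_adj_of_nontrivial ⟨x, hx⟩
  exact h u hu

theorem mem_of_isTree_of_closed {T : G.Subgraph} (hT : T.coe.IsTree) {W : Set V}
    (hW : ∀ u ∈ W, ∀ v, T.Adj u v → v ∈ W) (hx : x ∈ T.verts) (hxW : x ∈ W) (hz : z ∈ T.verts) :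
    z ∈ W := by
  have h := (SimpleGraph.reachable_iff_reflTransGen _ _).1
    (hT.connected.preconnected ⟨x, hx⟩ ⟨z, hz⟩)
  suffices ∀ w, Relation.ReflTransGen T.coe.Adj ⟨x, hx⟩ w → (w : V) ∈ W from this _ h
  intro w h
  induction h with
  | refl => exact hxW
  | tail _ h ih => exact hW _ ih _ h

theorem eq_of_adj_of_adj {T : Fin r → G.Subgraph}
    (hT : ∀ a b, a ≠ b → Disjoint (T a).edgeSet (T b).edgeSet) {a b : Fin r} (ha : (T a).Adj x y)
    (hb : (T b).Adj x y) : a = b := by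
  by_contra hne
  exact Set.disjoint_left.1 (hT a b hne) (SimpleGraph.Subgraph.mem_edgeSet.2 ha)
    (SimpleGraph.Subgraph.mem_edgeSet.2 hb)

/-- Edge-disjoint subgraphs with a common vertex `x` choose distinct neighbours of `x`. -/
theorem injective_of_edgeSet_disjoint {T : Fin r → G.Subgraph}
    (hT : ∀ a b, a ≠ b → Disjoint (T a).edgeSet (T b).edgeSet) {f : Fin r → V}
    (hf : ∀ a, (T a).Adj x (f a)) : Function.Injective f := fun a b hab =>
  eq_of_adj_of_adj hT (hf a) (hab ▸ hf b)

theorem ConnectsSet.le_ncard_neighborSet (h : ConnectsSet G S r) (hfin : (G.neighborSet x).Finite)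
    (hx : x ∈ S) (hy : y ∈ S) (hxy : x ≠ y) : r ≤ (G.neighborSet x).ncard := by
  obtain ⟨T, h1, h2, -, h4⟩ := h
  choose f hf using fun a => exists_adj_of_isTree (h1 a) (h2 a hx) (h2 a hy) hxy
  rw [← Nat.card_fin r, ← Set.ncard_range_of_injective (injective_of_edgeSet_disjoint h4 hf)]
  exact Set.ncard_le_ncard (Set.range_subset_iff.2 fun a => (hf a).adj_sub) hfin

theorem exists_adj_and_unique {T : Fin r → G.Subgraph}
    (hT : ∀ a b, a ≠ b → Disjoint (T a).edgeSet (T b).edgeSet)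
    (hne : ∀ a, ∃ u, (T a).Adj x u) (hfin : (G.neighborSet x).Finite)
    (hr : (G.neighborSet x).ncard ≤ r) :
    (∀ u, G.Adj x u → ∃ a, (T a).Adj x u) ∧
      ∀ a u v, (T a).Adj x u → (T a).Adj x v → u = v := by
  choose f hf using hne
  have hinj := injective_of_edgeSet_disjoint hT hf
  have hrange : Set.range f = G.neighborSet x := by
    refine Set.eq_of_subset_of_ncard_le (Set.range_subset_iff.2 fun a => (hf a).adj_sub) ?_ hfin
    rwa [Set.ncard_range_of_injective hinj, Nat.card_fin]
  have hval : ∀ a u, (T a).Adj x u → u = f a := by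
    intro a u hu
    obtain ⟨c, rfl⟩ : u ∈ Set.range f := hrange ▸ hu.adj_sub
    rw [eq_of_adj_of_adj hT hu (hf c)]
  refine ⟨fun u hu => ?_, fun a u v hu hv => (hval a u hu).trans (hval a v hv).symm⟩
  obtain ⟨c, rfl⟩ : u ∈ Set.range f := hrange ▸ hu
  exact ⟨c, hf c⟩

theorem ConnectsSet.lt_of_adj {d : ℕ} (h : ConnectsSet G S r) (hxy : G.Adj x y)
    (hx : x ∈ S) (hy : y ∈ S) (hz : z ∈ S) (hzx : z ≠ x) (hzy : z ≠ y)
    (hfx : (G.neighborSet x).Finite) (hfy : (G.neighborSet y).Finite)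
    (hdx : (G.neighborSet x).ncard ≤ d) (hdy : (G.neighborSet y).ncard ≤ d) : r < d := by
  by_contra! hr
  obtain ⟨T, h1, h2, -, h4⟩ := h
  obtain ⟨h5, h6⟩ := exists_adj_and_unique h4
    (fun a => exists_adj_of_isTree (h1 a) (h2 a hx) (h2 a hy) hxy.ne) hfx (hdx.trans hr)
  obtain ⟨-, h7⟩ := exists_adj_and_unique h4
    (fun a => exists_adj_of_isTree (h1 a) (h2 a hy) (h2 a hx) hxy.ne') hfy (hdy.trans hr)
  obtain ⟨a, ha⟩ := h5 y hxy
  have := mem_of_isTree_of_closed (h1 a) (W := {x, y}) (by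
    rintro u (rfl | rfl) v huv
    exacts [Or.inr (h6 a v y huv ha), Or.inl (h7 a v x huv ha.symm)]) (h2 a hx) (Or.inl rfl)
    (h2 a hz)
  exact this.elim hzx hzy

end Trees

section Transfer

variable {V W : Type} {G : SimpleGraph V} {H : SimpleGraph W} {K S : Set V} {r : ℕ}

theorem HasPacking.connectsSet (h : HasPacking G K S r) (hS : S.Nonempty) (hr : 0 < r) :
    ConnectsSet G S r := by
  obtain ⟨ι, P, a₀, hι, -, h2, h3, h4, h5⟩ := h
  let H := G.deleteEdges {e | ∀ v ∈ e, v ∈ S}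
  have hH : ∀ u v, H.Adj u v ↔ G.Adj u v ∧ ¬(u ∈ S ∧ v ∈ S) := by
    intro u v
    simp [H, SimpleGraph.deleteEdges_adj]
  have htree : ∀ a, ∃ T : G.Subgraph, T.verts = P a ∪ S ∧ T.coe.IsTree ∧
      (a ≠ a₀ → ∀ u v, T.Adj u v → ¬(u ∈ S ∧ v ∈ S)) := by
    intro a
    by_cases ha : a = a₀
    · subst ha
      obtain ⟨T, h, h', -⟩ := h5.exists_isTree hS.inr le_rfl
      exact ⟨T, h, h', fun h => absurd rfl h⟩
    · obtain ⟨h6, h7⟩ := h4 a ha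
      have hnS := Set.disjoint_left.1 (h2 a)
      have h8 : ConnectedOn H (P a) := fun u hu v hv => (h6 u hu v hv).of_forall_adj
        fun s hs t ht hst => .single ((hH s t).2 ⟨hst, fun h => hnS hs h.1⟩) hs ht
      obtain ⟨T, h, h', h''⟩ := (h8.union_of_forall_adj (W := S) fun s hs => by
        obtain ⟨t, ht, hst⟩ := h7 s hs
        exact Or.inr ⟨t, ht, (hH s t).2 ⟨hst, fun h => hnS ht h.2⟩⟩).exists_isTree hS.inr
          (G.deleteEdges_le _)
      exact ⟨T, h, h', fun _ u v huv => ((hH u v).1 (h'' u v huv)).2⟩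
  choose T hT using htree
  have hinter : ∀ a b, a ≠ b → (T a).verts ∩ (T b).verts = S := by
    intro a b hab
    rw [(hT a).1, (hT b).1, ← Set.inter_union_distrib_right, (h3 a b hab).inter_eq, Set.empty_union]
  have hdisj : ∀ a b, a ≠ b → Disjoint (T a).edgeSet (T b).edgeSet := by
    intro a b hab
    refine Set.disjoint_left.2 fun e => ?_
    induction e with | h u v =>
    intro (ha : (T a).Adj u v) (hb : (T b).Adj u v)
    have hu : u ∈ S := hinter a b hab ▸ ⟨ha.fst_mem, hb.fst_mem⟩
    have hv : v ∈ S := hinter a b hab ▸ ⟨ha.snd_mem, hb.snd_mem⟩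
    by_cases haa : a = a₀
    · exact (hT b).2.2 (fun hba => hab (haa.trans hba.symm)) u v hb ⟨hu, hv⟩
    · exact (hT a).2.2 haa u v ha ⟨hu, hv⟩
  have : Finite ι := Nat.finite_of_card_ne_zero (by omega)
  let e : Fin r ≃ ι := (Finite.equivFinOfCardEq hι).symm
  refine ⟨fun i => T (e i), fun i => (hT _).2.1, fun i => ?_, fun i j hij => ?_, fun i j hij => ?_⟩
  · rw [(hT _).1]
    exact Set.subset_union_right
  · exact hinter _ _ (e.injective.ne hij)
  · exact hdisj _ _ (e.injective.ne hij)

theorem ConnectedOn.preimage {f : W → V} (hadj : ∀ u v, G.Adj (f u) (f v) → H.Adj u v)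
    (hf : Function.Injective f) {Z : Set V} (hZ : ConnectedOn G Z) (hZf : Z ⊆ Set.range f) :
    ConnectedOn H (f ⁻¹' Z) := by
  intro a ha b hb
  have : Nonempty W := ⟨a⟩
  have hinv := Function.leftInverse_invFun hf
  have := (hZ _ ha _ hb).map (G' := H) (Z' := f ⁻¹' Z) (Function.invFun f) fun u hu v hv huv => by
    obtain ⟨u, rfl⟩ := hZf hu
    obtain ⟨v, rfl⟩ := hZf hv
    rw [hinv, hinv]
    exact .single (hadj u v huv) hu hv
  rwa [hinv, hinv] at this

theorem HasPacking.preimage {f : W → V} (hadj : ∀ u v, G.Adj (f u) (f v) → H.Adj u v)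
    (hf : Function.Injective f) (hK : K = Set.range f) (hS : S ⊆ K) (h : HasPacking G K S r) :
    HasPacking H Set.univ (f ⁻¹' S) r := by
  subst hK
  obtain ⟨ι, P, a₀, hι, h1, h2, h3, h4, h5⟩ := h
  refine ⟨ι, fun a => f ⁻¹' P a, a₀, hι, fun _ => Set.subset_univ _, fun a => (h2 a).preimage f,
    fun a b hab => (h3 a b hab).preimage f, fun a ha => ?_, ?_⟩
  · obtain ⟨h6, h7⟩ := h4 a ha
    refine ⟨h6.preimage hadj hf (h1 a), fun s hs => ?_⟩
    obtain ⟨t, ht, hst⟩ := h7 _ hs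
    obtain ⟨t, rfl⟩ := h1 a ht
    exact ⟨t, ht, hadj s t hst⟩
  · exact h5.preimage hadj hf (Set.union_subset (h1 a₀) hS)

end Transfer

section BubbleSortStar

open Equiv

variable {n : ℕ} (hn : 3 ≤ n) {σ τ : Perm (Fin n)}

theorem bubbleSortStar_adj_iff :
    (bubbleSortStar n hn).Adj σ τ ↔ (wordGraph n).Adj (toWord n σ) (toWord n τ) := by
  have hgen : ∀ σ τ : Perm (Fin n),
      (∃ s ∈ ({σ | ∃ i : Fin n, 1 ≤ (i : ℕ) ∧ σ = swap ⟨0, by omega⟩ i} ∪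
        {σ | ∃ j : ℕ, ∃ h : j + 1 < n, 1 ≤ j ∧ σ = swap ⟨j, by omega⟩ ⟨j + 1, h⟩} :
          Set (Perm (Fin n))), τ = σ * s) ↔ (wordGraph n).Adj (toWord n σ) (toWord n τ) := by
    intro σ τ
    constructor
    · rintro ⟨s, ⟨i, hi, rfl⟩ | ⟨j, hj, hj1, rfl⟩, rfl⟩ <;> rw [map_mul, toWord_swap]
      · exact adj_star _ hi i.2
      · exact adj_bubble _ hj1 hj
    · rintro ⟨s, hs, h⟩
      obtain ⟨i, h1, h2, rfl⟩ | ⟨j, h1, h2, rfl⟩ := mem_gens.1 hs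
      · refine ⟨swap ⟨0, by omega⟩ ⟨i, h2⟩, Or.inl ⟨_, h1, rfl⟩, toWord_injective n ?_⟩
        rw [h, map_mul, toWord_swap]
      · refine ⟨swap ⟨j, by omega⟩ ⟨j + 1, h2⟩, Or.inr ⟨j, h2, h1, rfl⟩, toWord_injective n ?_⟩
        rw [h, map_mul, toWord_swap]
  rw [bubbleSortStar, cayleyGraph, SimpleGraph.fromRel_adj, hgen, hgen,
    SimpleGraph.adj_comm _ (toWord n τ), or_self, and_iff_right_iff_imp]
  exact fun h hστ => h.ne (congrArg _ hστ)

theorem connectsSet_bubbleSortStar {S : Set (Perm (Fin n))} (hS : S.ncard = 3) :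
    ConnectsSet (bubbleSortStar n hn) S (2 * n - 4) := by
  obtain ⟨x, y, z, hxy, hxz, hyz, rfl⟩ := Set.ncard_eq_three.1 hS
  have hw : ∀ σ : Perm (Fin n), toWord n σ ∈ words n := fun σ =>
    range_toWord n ▸ Set.mem_range_self σ
  have hinj := toWord_injective n
  have := (triplyConnected hn _ (hw x) _ (hw y) _ (hw z) (hinj.ne hxy) (hinj.ne hxz)
    (hinj.ne hyz)).preimage (fun u v => (bubbleSortStar_adj_iff hn).2) hinj (range_toWord n).symm
    (by rintro u (rfl | rfl | rfl) <;> exact hw _)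
  convert this.connectsSet ⟨x, Or.inl rfl⟩ (by omega) using 1
  ext u
  simp [hinj.eq_iff]

theorem ncard_neighborSet_le (σ : Perm (Fin n)) :
    ((bubbleSortStar n hn).neighborSet σ).ncard ≤ 2 * n - 3 := by
  rw [← card_nbrs (by omega) (toWord n σ), ← Set.ncard_coe_finset]
  exact Set.ncard_le_ncard_of_injOn (toWord n)
    (fun τ hτ => mem_nbrs.2 ((bubbleSortStar_adj_iff hn).1 hτ)) (toWord_injective n).injOn
    (Finset.finite_toSet _)

end BubbleSortStar

/-- `κ₃(BS_n) = 2n - 4` for every `n ≥ 3`. -/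
theorem stmt_13 (n : ℕ) (hn : 3 ≤ n) :
    kappa3 (bubbleSortStar n hn) = 2 * n - 4 := by
  have hbdd : ∀ S : Set (Equiv.Perm (Fin n)), S.ncard = 3 →
      BddAbove {r | ConnectsSet (bubbleSortStar n hn) S r} := by
    intro S hS
    obtain ⟨x, y, z, hxy, -, -, rfl⟩ := Set.ncard_eq_three.1 hS
    exact ⟨2 * n - 3, fun r hr => (hr.le_ncard_neighborSet (Set.toFinite _) (Or.inl rfl)
      (Or.inr (Or.inl rfl)) hxy).trans (ncard_neighborSet_le hn x)⟩
  have hge : ∀ S : Set (Equiv.Perm (Fin n)), S.ncard = 3 →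
      2 * n - 4 ≤ treeConn (bubbleSortStar n hn) S := fun S hS =>
    le_csSup (hbdd S hS) (connectsSet_bubbleSortStar hn hS)
  let s : Equiv.Perm (Fin n) := Equiv.swap ⟨0, by omega⟩ ⟨1, by omega⟩
  let t : Equiv.Perm (Fin n) := Equiv.swap ⟨0, by omega⟩ ⟨2, by omega⟩
  have hs : s ≠ 1 := by simp [s, Equiv.swap_eq_one_iff]
  have ht : t ≠ 1 := by simp [t, Equiv.swap_eq_one_iff]
  have hst : s ≠ t := fun h => by
    have := congrArg (fun σ => ((σ ⟨0, by omega⟩ : Fin n) : ℕ)) h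
    simp [s, t] at this
  have hcard : ({1, s, t} : Set (Equiv.Perm (Fin n))).ncard = 3 :=
    Set.ncard_eq_three.2 ⟨1, s, t, hs.symm, ht.symm, hst, rfl⟩
  have hadj : (bubbleSortStar n hn).Adj 1 s := by
    rw [bubbleSortStar_adj_iff, map_one, toWord_swap]
    simpa using adj_star (n := n) 1 le_rfl (by omega : 1 < n)
  refine le_antisymm (Nat.sInf_le ⟨_, hcard, ?_⟩) (le_csInf ⟨_, _, hcard, rfl⟩ ?_)
  · refine le_antisymm (csSup_le ⟨_, connectsSet_bubbleSortStar hn hcard⟩ fun r hr => ?_)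
      (hge _ hcard)
    have := hr.lt_of_adj hadj (Or.inl rfl) (Or.inr (Or.inl rfl)) (Or.inr (Or.inr rfl)) ht hst.symm
      (Set.toFinite _) (Set.toFinite _) (ncard_neighborSet_le hn 1) (ncard_neighborSet_le hn s)
    omega
  · rintro _ ⟨S, hS, rfl⟩
    exact hge S hS
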